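/- arXiv:2108.07066 — 2 statements merged into one kernel-verified Lean document; each statement's English description precedes it below -/
import Mathlib

section
/- Let s ≥ 1 be an integer, let G be an H_s-free graph with clique number ω satisfying ω ≥ 200 and ω³ > ω + s/7, and let 𝓛 = (L_0, L_1, …, L_k) be an optimal s-template in G whose value is at least 28ω^{s+6}. Suppose d ≥ 1 and D ≥ 0 are integers such that every H_s-free graph G' with ω(G') < ω is (ω(G')^d, D)-colourable, and suppose c ≥ 2s satisfies the Kővári–Sós–Turán-type bound for H_s. Then V(𝓛) ∪ N(𝓛) is (K, D)-colourable, where K = (ω−1)^d + ω^{(c+1)(s+7)}. -/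
open SimpleGraph Set

/-- `G` contains no induced subgraph isomorphic to `H`. -/
def IsInducedFree {V : Type*} {W : Type*} (G : SimpleGraph V) (H : SimpleGraph W) : Prop :=
  ∀ s : Set V, ¬ Nonempty ((G.induce s) ≃g H)

/-- The double star `H_s`: two adjacent internal vertices `0` and `1`; `0` is adjacent to the
`s` leaves `2,…,s+1` and `1` is adjacent to the `s` leaves `s+2,…,2s+1`. -/
def doubleStarGraph (s : ℕ) : SimpleGraph (Fin (2*s+2)) :=
  SimpleGraph.fromRel (fun a b =>
    ((a : ℕ) = 0 ∧ (b : ℕ) = 1) ∨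
    ((a : ℕ) = 0 ∧ 2 ≤ (b : ℕ) ∧ (b : ℕ) ≤ s+1) ∨
    ((a : ℕ) = 1 ∧ s+2 ≤ (b : ℕ)))

/-- A graph has degeneracy at most `d` if every nonempty subgraph has a vertex whose degree
in that subgraph is at most `d`. -/
def DegeneracyAtMost {V : Type*} (G : SimpleGraph V) (d : ℕ) : Prop :=
  ∀ H : G.Subgraph, H.verts.Nonempty → ∃ v ∈ H.verts, (H.neighborSet v).ncard ≤ d

/-- A `(k,d)`-colouring: a partition of the vertex set into `k` parts, each inducing a
subgraph of degeneracy at most `d`. -/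
def KDColorable {V : Type*} (G : SimpleGraph V) (k d : ℕ) : Prop :=
  ∃ f : V → Fin k, ∀ i : Fin k, DegeneracyAtMost (G.induce {v | f v = i}) d

/-- `G` contains the complete bipartite graph `K_{t,t}` as a (not necessarily induced)
subgraph. -/
def ContainsKtt {V : Type*} (G : SimpleGraph V) (t : ℕ) : Prop :=
  ∃ A B : Finset V, A.card = t ∧ B.card = t ∧ Disjoint A B ∧
    ∀ a ∈ A, ∀ b ∈ B, G.Adj a b

/-- A set of vertices is stable (independent) if no two of its members are adjacent. -/
def IsStableSet {V : Type*} (G : SimpleGraph V) (S : Set V) : Prop :=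
  ∀ a ∈ S, ∀ b ∈ S, a ≠ b → ¬ G.Adj a b

/-- An `s`-template in `G`: a clique `L0` complete to all the `L i`, pairwise disjoint sets
`L 1, …, L k` (here indexed by `Fin k`) whose sizes lie between `ω^{s+5}` and `14 ω^{s+6}`,
such that each vertex of `L i` has at most `ω^{s+3}` non-neighbours in each other `L j`. -/
def IsTemplate {V : Type*} (G : SimpleGraph V) (s : ℕ) (L0 : Set V) {k : ℕ}
    (L : Fin k → Set V) : Prop :=
  (∀ i : Fin k, Disjoint L0 (L i)) ∧
  (Pairwise fun i j : Fin k => Disjoint (L i) (L j)) ∧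
  G.IsClique L0 ∧
  (∀ u ∈ L0, ∀ i : Fin k, ∀ v ∈ L i, G.Adj u v) ∧
  (∀ i : Fin k, G.cliqueNum ^ (s+5) ≤ (L i).ncard ∧ (L i).ncard ≤ 14 * G.cliqueNum ^ (s+6)) ∧
  (∀ i j : Fin k, i ≠ j → ∀ v ∈ L i,
    ({u ∈ L j | ¬ G.Adj v u}).ncard ≤ G.cliqueNum ^ (s+3))

/-- The value of an `s`-template. -/
noncomputable def templateValue {V : Type*} (G : SimpleGraph V) (s : ℕ) (L0 : Set V) {k : ℕ}
    (L : Fin k → Set V) : ℕ :=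
  (⋃ i, L i).ncard + 7 * G.cliqueNum ^ (s+5) * L0.ncard + k * G.cliqueNum ^ (s+5)

/-- An optimal `s`-template: one of maximum value among all `s`-templates in `G`. -/
def IsOptimalTemplate {V : Type*} (G : SimpleGraph V) (s : ℕ) (L0 : Set V) {k : ℕ}
    (L : Fin k → Set V) : Prop :=
  IsTemplate G s L0 L ∧
  ∀ (k' : ℕ) (L0' : Set V) (L' : Fin k' → Set V), IsTemplate G s L0' L' →
    templateValue G s L0' L' ≤ templateValue G s L0 L

/-- `V(𝓛)`, the vertex set of a template. -/
def templateVerts {V : Type*} (L0 : Set V) {k : ℕ} (L : Fin k → Set V) : Set V :=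
  L0 ∪ ⋃ i, L i

/-- `N(𝓛)`: the vertices outside `V(𝓛)` with a neighbour in `L 1 ∪ ⋯ ∪ L k`. -/
def templateNbhd {V : Type*} (G : SimpleGraph V) (L0 : Set V) {k : ℕ}
    (L : Fin k → Set V) : Set V :=
  {v | v ∉ templateVerts L0 L ∧ ∃ i : Fin k, ∃ u ∈ L i, G.Adj v u}


/-- A vertex `v` is pendant with respect to the template: there are distinct `i, j`, a vertex
`u ∈ L j` and a stable set `S ⊆ L i` of `s+1` common neighbours of `u` such that `v` is not
adjacent to `u` and `v` has exactly one neighbour in `S`. -/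
def TemplatePendant {V : Type*} (G : SimpleGraph V) (s : ℕ) {k : ℕ}
    (L : Fin k → Set V) (v : V) : Prop :=
  ∃ i j : Fin k, i ≠ j ∧ ∃ u ∈ L j, ∃ S : Set V, S ⊆ L i ∧ S.ncard = s + 1 ∧
    IsStableSet G S ∧ (∀ w ∈ S, G.Adj u w) ∧ ¬ G.Adj v u ∧ ({w ∈ S | G.Adj v w}).ncard = 1

/-- A vertex `v` is dense with respect to the template: there are `j` and `u ∈ L j` such that
for all `i ≠ j`, fewer than `ω^{s+2}/14` vertices of `L i` are adjacent to `u` and not to `v`. -/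
def TemplateDense {V : Type*} (G : SimpleGraph V) (s : ℕ) {k : ℕ}
    (L : Fin k → Set V) (v : V) : Prop :=
  ∃ j : Fin k, ∃ u ∈ L j, ∀ i : Fin k, i ≠ j →
    14 * ({w ∈ L i | G.Adj u w ∧ ¬ G.Adj v w}).ncard < G.cliqueNum ^ (s+2)

/-- A vertex `v` is pure with respect to the template: it has no neighbour in at least two of
the sets `L i`, and for each `i`, either it has no neighbour in `L i` or it has at most
`ω^{s+2}/7` non-neighbours in `L i`. -/
def TemplatePure {V : Type*} (G : SimpleGraph V) (s : ℕ) {k : ℕ}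
    (L : Fin k → Set V) (v : V) : Prop :=
  (∃ i₁ i₂ : Fin k, i₁ ≠ i₂ ∧ (∀ w ∈ L i₁, ¬ G.Adj v w) ∧ (∀ w ∈ L i₂, ¬ G.Adj v w)) ∧
  (∀ i : Fin k, (∀ w ∈ L i, ¬ G.Adj v w) ∨
    7 * ({w ∈ L i | ¬ G.Adj v w}).ncard ≤ G.cliqueNum ^ (s+2))

/-- `M_I`: the pure vertices `v` (with respect to the template) whose set `I_v` of indices `i`
such that `v` has a neighbour in `L i` equals `I`. -/
def templatePart {V : Type*} (G : SimpleGraph V) (s : ℕ) (L0 : Set V) {k : ℕ}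
    (L : Fin k → Set V) (I : Set (Fin k)) : Set V :=
  {v | v ∈ templateNbhd G L0 L ∧ TemplatePure G s L v ∧
    ∀ i : Fin k, (∃ u ∈ L i, G.Adj v u) ↔ i ∈ I}

/-- Two disjoint sets `A, B` are `s`-crowded if there is no stable set meeting each of them
in exactly `s` vertices. -/
def SCrowded {V : Type*} (G : SimpleGraph V) (s : ℕ) (A B : Set V) : Prop :=
  ¬ ∃ X : Set V, IsStableSet G X ∧ (X ∩ A).ncard = s ∧ (X ∩ B).ncard = s

/-- `c` satisfies the Kővári–Sós–Turán-type bound for `H_s`: every `H_s`-free graph either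
contains `K_{t,t}` as a subgraph or has degeneracy less than `t^c`. -/
def KSTBound (s c : ℕ) : Prop :=
  ∀ (W : Type) [Fintype W], ∀ G' : SimpleGraph W, IsInducedFree G' (doubleStarGraph s) →
    ∀ t : ℕ, ContainsKtt G' t ∨ ∃ D : ℕ, D < t ^ c ∧ DegeneracyAtMost G' D

/-- `Z(𝓛)`: the union of `L0` with the set of vertices of `N(𝓛)` having at most `ω^{s+2}/4`
non-neighbours in each `L i`. -/
def templateZ {V : Type*} (G : SimpleGraph V) (s : ℕ) (L0 : Set V) {k : ℕ}
    (L : Fin k → Set V) : Set V :=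
  L0 ∪ {v ∈ templateNbhd G L0 L |
    ∀ i : Fin k, 4 * ({u ∈ L i | ¬ G.Adj v u}).ncard ≤ G.cliqueNum ^ (s+2)}

/-- `Y(𝓛) = (V(𝓛) ∪ N(𝓛)) \ Z(𝓛)`. -/
def templateY {V : Type*} (G : SimpleGraph V) (s : ℕ) (L0 : Set V) {k : ℕ}
    (L : Fin k → Set V) : Set V :=
  (templateVerts L0 L ∪ templateNbhd G L0 L) \ templateZ G s L0 L

/-- `N_A(𝓛)`: the vertices of `A \ V(𝓛)` with a neighbour in `L 1 ∪ ⋯ ∪ L k`. -/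
def templateNbhdIn {V : Type*} (G : SimpleGraph V) (A : Set V) (L0 : Set V) {k : ℕ}
    (L : Fin k → Set V) : Set V :=
  {v ∈ A | v ∉ templateVerts L0 L ∧ ∃ i : Fin k, ∃ u ∈ L i, G.Adj v u}

/-- `Z_A(𝓛)`: the union of `L0` with the set of vertices of `A \ V(𝓛)` having at most
`ω^{s+2}/4` non-neighbours in each `L i`. -/
def templateZIn {V : Type*} (G : SimpleGraph V) (s : ℕ) (A : Set V) (L0 : Set V) {k : ℕ}
    (L : Fin k → Set V) : Set V :=
  L0 ∪ {v ∈ A | v ∉ templateVerts L0 L ∧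
    ∀ i : Fin k, 4 * ({u ∈ L i | ¬ G.Adj v u}).ncard ≤ G.cliqueNum ^ (s+2)}

/-- `Y_A(𝓛) = (V(𝓛) ∪ N_A(𝓛)) \ Z_A(𝓛)`. -/
def templateYIn {V : Type*} (G : SimpleGraph V) (s : ℕ) (A : Set V) (L0 : Set V) {k : ℕ}
    (L : Fin k → Set V) : Set V :=
  (templateVerts L0 L ∪ templateNbhdIn G A L0 L) \ templateZIn G s A L0 L



namespace DS
open scoped Classical

/-- No double star. -/
def NoHs {V : Type*} (G : SimpleGraph V) (s : ℕ) : Prop :=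
  ∀ (a b : V) (S T : Finset V), G.Adj a b → S.card = s → T.card = s →
    (∀ x ∈ S, G.Adj a x ∧ ¬ G.Adj b x ∧ x ≠ b) →
    (∀ x ∈ T, G.Adj b x ∧ ¬ G.Adj a x ∧ x ≠ a) →
    (∀ x ∈ S, ∀ y ∈ S, ¬ G.Adj x y) → (∀ x ∈ T, ∀ y ∈ T, ¬ G.Adj x y) →
    (∀ x ∈ S, ∀ y ∈ T, ¬ G.Adj x y) → False

lemma exists_enum {V : Type*} (S : Finset V) (s : ℕ) (hS : S.card = s) (a : V) :
    ∃ f : ℕ → V, (∀ i < s, f i ∈ S) ∧ ∀ i < s, ∀ j < s, f i = f j → i = j := by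
  let eS : Fin s ≃ S := (S.equivFinOfCardEq hS).symm
  refine ⟨fun i => if h : i < s then (eS ⟨i, h⟩ : V) else a, ?_, ?_⟩
  · intro i hi
    simp [hi]
  · intro i hi j hj h
    simp only [hi, hj, dif_pos] at h
    have := eS.injective (Subtype.ext h)
    simpa using this

lemma noHs_of_free {V : Type*} (G : SimpleGraph V) (s : ℕ)
    (h : IsInducedFree G (doubleStarGraph s)) : NoHs G s := by
  intro a b S T hab hS hT hSa hTb hSS hTT hST
  obtain ⟨f, hfS, hfi⟩ := exists_enum S s hS a
  obtain ⟨g, hgT, hgi⟩ := exists_enum T s hT a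
  let φ : Fin (2*s+2) → V := fun n =>
    if (n : ℕ) = 0 then a else if (n : ℕ) = 1 then b else
    if (n : ℕ) ≤ s+1 then f ((n : ℕ) - 2) else g ((n : ℕ) - (s+2))
  have hcase : ∀ n : Fin (2*s+2), ((n : ℕ) = 0 ∧ φ n = a) ∨ ((n : ℕ) = 1 ∧ φ n = b) ∨
      (∃ i < s, (n : ℕ) = i + 2 ∧ φ n = f i) ∨ (∃ i < s, (n : ℕ) = i + (s + 2) ∧ φ n = g i) := by
    intro n
    have hn := n.2
    by_cases h0 : (n : ℕ) = 0
    · left; exact ⟨h0, if_pos h0⟩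
    by_cases h1 : (n : ℕ) = 1
    · right; left; exact ⟨h1, (if_neg h0).trans (if_pos h1)⟩
    by_cases h2 : (n : ℕ) ≤ s + 1
    · right; right; left
      exact ⟨(n : ℕ) - 2, by omega, by omega,
        (if_neg h0).trans ((if_neg h1).trans (if_pos h2))⟩
    · right; right; right
      exact ⟨(n : ℕ) - (s+2), by omega, by omega,
        (if_neg h0).trans ((if_neg h1).trans (if_neg h2))⟩
  have hadj : ∀ x y, G.Adj (φ x) (φ y) ↔ (doubleStarGraph s).Adj x y := by
    intro x y
    unfold doubleStarGraph
    rw [SimpleGraph.fromRel_adj, Ne, Fin.ext_iff]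
    rcases hcase x with ⟨hx, hx'⟩ | ⟨hx, hx'⟩ | ⟨i, hi, hx, hx'⟩ | ⟨i, hi, hx, hx'⟩ <;>
    rcases hcase y with ⟨hy, hy'⟩ | ⟨hy, hy'⟩ | ⟨j, hj, hy, hy'⟩ | ⟨j, hj, hy, hy'⟩ <;>
    rw [hx', hy', hx, hy]
    · simp
    · simp [hab]
    · have := (hSa _ (hfS j hj)).1
      exact iff_of_true this (by omega)
    · have := (hTb _ (hgT j hj)).2.1
      exact iff_of_false this (by omega)
    · simp [hab.symm]
    · simp
    · have := (hSa _ (hfS j hj)).2.1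
      exact iff_of_false this (by omega)
    · have := (hTb _ (hgT j hj)).1
      exact iff_of_true this (by omega)
    · have := (hSa _ (hfS i hi)).1.symm
      exact iff_of_true this (by omega)
    · have := fun h : G.Adj (f i) b => (hSa _ (hfS i hi)).2.1 h.symm
      exact iff_of_false this (by omega)
    · have := hSS _ (hfS i hi) _ (hfS j hj)
      exact iff_of_false this (by omega)
    · have := hST _ (hfS i hi) _ (hgT j hj)
      exact iff_of_false this (by omega)
    · have := fun h : G.Adj (g i) a => (hTb _ (hgT i hi)).2.1 h.symm
      exact iff_of_false this (by omega)
    · have := (hTb _ (hgT i hi)).1.symm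
      exact iff_of_true this (by omega)
    · have := fun h : G.Adj (g i) (f j) => hST _ (hfS j hj) _ (hgT i hi) h.symm
      exact iff_of_false this (by omega)
    · have := hTT _ (hgT i hi) _ (hgT j hj)
      exact iff_of_false this (by omega)
  have hinj : Function.Injective φ := by
    intro x y hxy
    rw [Fin.ext_iff]
    rcases hcase x with ⟨hx, hx'⟩ | ⟨hx, hx'⟩ | ⟨i, hi, hx, hx'⟩ | ⟨i, hi, hx, hx'⟩ <;>
    rcases hcase y with ⟨hy, hy'⟩ | ⟨hy, hy'⟩ | ⟨j, hj, hy, hy'⟩ | ⟨j, hj, hy, hy'⟩ <;>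
    rw [hx', hy'] at hxy <;> rw [hx, hy]
    · exact absurd hxy hab.ne
    · exact absurd hxy (hSa _ (hfS j hj)).1.ne
    · exact absurd hxy.symm (hTb _ (hgT j hj)).2.2
    · exact absurd hxy.symm hab.ne
    · exact absurd hxy.symm (hSa _ (hfS j hj)).2.2
    · exact absurd hxy (hTb _ (hgT j hj)).1.ne
    · exact absurd hxy.symm (hSa _ (hfS i hi)).1.ne
    · exact absurd hxy (hSa _ (hfS i hi)).2.2
    · rw [hfi i hi j hj hxy]
    · exact absurd (hxy ▸ (hSa _ (hfS i hi)).1) (hTb _ (hgT j hj)).2.1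
    · exact absurd hxy (hTb _ (hgT i hi)).2.2
    · exact absurd hxy.symm (hTb _ (hgT i hi)).1.ne
    · exact absurd (hxy ▸ (hSa _ (hfS j hj)).1) (hTb _ (hgT i hi)).2.1
    · rw [hgi i hi j hj hxy]
  let e : doubleStarGraph s ↪g G := ⟨⟨φ, hinj⟩, fun {x y} => hadj x y⟩
  exact h _ ⟨e.isoInduceRange.symm⟩

/-- Ramsey-type bound. -/
def ram (w : ℕ) : ℕ → ℕ
  | 0 => 0
  | (s+1) => w * ram w s + 1

lemma ram_lt (w s : ℕ) (hw : 2 ≤ w) : ram w s < w ^ s := by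
  induction s with
  | zero => simp [ram]
  | succ n ih =>
    simp only [ram]
    have h1 : w * (ram w n + 1) ≤ w * w ^ n := Nat.mul_le_mul_left w ih
    rw [pow_succ, mul_comm (w^n) w]
    have : w * (ram w n + 1) = w * ram w n + w := by ring
    omega

lemma exists_stable {V : Type*} (G : SimpleGraph V) (w : ℕ)
    (hclq : ∀ K : Finset V, G.IsClique (K : Set V) → K.card ≤ w) (s : ℕ) :
    ∀ X : Finset V, ram w s ≤ X.card →
      ∃ S ⊆ X, S.card = s ∧ ∀ x ∈ S, ∀ y ∈ S, ¬ G.Adj x y := by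
  induction s with
  | zero => intro X _; exact ⟨∅, by simp, by simp, by simp⟩
  | succ n ih =>
    intro X hX
    simp only [ram] at hX
    obtain ⟨K, hK, hKm⟩ := Finset.exists_max_image
      (X.powerset.filter (fun K : Finset V => G.IsClique (K : Set V))) Finset.card
      ⟨∅, by simp⟩
    simp only [Finset.mem_filter, Finset.mem_powerset] at hK hKm
    have hcov : X ⊆ K.biUnion (fun x => X.filter (fun y => ¬ G.Adj x y)) := by
      intro y hy
      simp only [Finset.mem_biUnion, Finset.mem_filter]
      by_cases hyK : y ∈ K
      · exact ⟨y, hyK, hy, G.loopless.irrefl y⟩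
      by_contra hcon
      push Not at hcon
      have := hKm (insert y K) ⟨Finset.insert_subset hy hK.1, by
        rw [Finset.coe_insert, SimpleGraph.isClique_insert]
        exact ⟨hK.2, fun b hb _ => (hcon b hb hy).symm⟩⟩
      rw [Finset.card_insert_of_notMem hyK] at this
      omega
    have hex : ∃ x ∈ K, ram w n < (X.filter (fun y => ¬ G.Adj x y)).card := by
      by_contra hcon
      push Not at hcon
      have h1 := (Finset.card_le_card hcov).trans
        (Finset.card_biUnion_le_card_mul _ _ _ hcon)
      have h2 := Nat.mul_le_mul_right (ram w n) (hclq K hK.2)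
      omega
    obtain ⟨x, hxK, hx⟩ := hex
    have hxX := hK.1 hxK
    obtain ⟨S, hSX, hSc, hSs⟩ := ih ((X.filter (fun y => ¬ G.Adj x y)).erase x) (by
      have := Finset.pred_card_le_card_erase (s := X.filter (fun y => ¬ G.Adj x y)) (a := x)
      omega)
    have hS' : ∀ y ∈ S, y ≠ x ∧ y ∈ X ∧ ¬ G.Adj x y := by
      intro y hy
      have := hSX hy
      simpa using this
    refine ⟨insert x S, ?_, ?_, ?_⟩
    · apply Finset.insert_subset hxX
      intro y hy
      exact (hS' y hy).2.1
    · rw [Finset.card_insert_of_notMem, hSc]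
      intro hx; exact (hS' x hx).1 rfl
    · intro y hy z hz
      rw [Finset.mem_insert] at hy hz
      rcases hy with rfl | hy <;> rcases hz with rfl | hz
      · exact G.loopless.irrefl _
      · exact (hS' z hz).2.2
      · exact fun h => (hS' y hy).2.2 h.symm
      · exact hSs y hy z hz

/-- Proper colouring of a relation on a finset. -/
def PCol {V : Type*} (E : V → V → Prop) (X : Finset V) (r : ℕ) : Prop :=
  ∃ f : V → ℕ, (∀ v ∈ X, f v < r) ∧ ∀ u ∈ X, ∀ v ∈ X, u ≠ v → E u v → f u ≠ f v

lemma PCol.mono {V : Type*} {E : V → V → Prop} {X Y : Finset V} {r t : ℕ} (h : PCol E X r)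
    (hY : Y ⊆ X) (ht : r ≤ t) : PCol E Y t := by
  obtain ⟨f, h1, h2⟩ := h
  exact ⟨f, fun v hv => (h1 v (hY hv)).trans_le ht,
    fun u hu v hv => h2 u (hY hu) v (hY hv)⟩

lemma PCol.union {V : Type*} {E : V → V → Prop} {X Y : Finset V} {r t : ℕ} (h : PCol E X r)
    (h' : PCol E Y t) : PCol E (X ∪ Y) (r + t) := by
  obtain ⟨f, h1, h2⟩ := h
  obtain ⟨g, g1, g2⟩ := h'
  refine ⟨fun v => if v ∈ X then f v else r + g v, ?_, ?_⟩
  · intro v hv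
    by_cases hX : v ∈ X
    · simp only [hX, if_true]; have := h1 v hX; omega
    · have := g1 v (by simpa [hX] using hv)
      simp only [hX, if_false]; omega
  · intro u hu v hv huv he
    by_cases hX : u ∈ X <;> by_cases hX' : v ∈ X <;> simp only [hX, hX', if_true, if_false]
    · exact h2 u hX v hX' huv he
    · have := h1 u hX; omega
    · have := h1 v hX'; omega
    · have := g2 u (by simpa [hX] using hu) v (by simpa [hX'] using hv) huv he
      omega

lemma PCol.empty {V : Type*} {E : V → V → Prop} (r : ℕ) : PCol E (∅ : Finset V) r :=
  ⟨fun _ => 0, by simp, by simp⟩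

lemma PCol.biUnion {V ι : Type*} {E : V → V → Prop} (I : Finset ι) (X : ι → Finset V) {r : ℕ}
    (h : ∀ i ∈ I, PCol E (X i) r) : PCol E (I.biUnion X) (I.card * r) := by
  induction I using Finset.induction_on with
  | empty => simpa using PCol.empty _
  | insert a I ha ih =>
    rw [Finset.biUnion_insert, Finset.card_insert_of_notMem ha]
    have := (h a (by simp)).union (ih (fun i hi => h i (by simp [hi])))
    exact this.mono (le_refl _) (by ring_nf; omega)

lemma PCol.card {V : Type*} {E : V → V → Prop} (X : Finset V) : PCol E X X.card := by
  let e := X.equivFin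
  refine ⟨fun v => if h : v ∈ X then e ⟨v, h⟩ else 0, ?_, ?_⟩
  · intro v hv
    simp [hv]
  · intro u hu v hv huv _ h
    simp only [hu, hv, dif_pos] at h
    have := e.injective (Fin.ext h)
    exact huv (by simpa using this)

lemma PCol.prod {V : Type*} {E E₁ E₂ : V → V → Prop} {X : Finset V} {r t : ℕ}
    (h : PCol E₁ X r) (h' : PCol E₂ X t)
    (hE : ∀ u ∈ X, ∀ v ∈ X, E u v → E₁ u v ∨ E₂ u v) : PCol E X (r * t) := by
  obtain ⟨f, h1, h2⟩ := h
  obtain ⟨g, g1, g2⟩ := h'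
  refine ⟨fun v => f v * t + g v, ?_, ?_⟩
  · intro v hv
    have h3 := h1 v hv
    have h4 := g1 v hv
    calc f v * t + g v < f v * t + t := by omega
      _ = (f v + 1) * t := by ring
      _ ≤ r * t := Nat.mul_le_mul_right t h3
  · intro u hu v hv huv he h
    have h : f u * t + g u = f v * t + g v := h
    have h3 := g1 u hu
    have h4 := g1 v hv
    have ht : 0 < t := by omega
    have e1 : f u = f v := by
      have := congrArg (· / t) h
      simpa [Nat.add_div_of_dvd_right, Nat.mul_add_div, mul_comm _ t, ht,
        Nat.div_eq_of_lt h3, Nat.div_eq_of_lt h4] using this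
    have e2 : g u = g v := by rw [e1] at h; simpa using h
    rcases hE u hu v hv he with h5 | h5
    · exact h2 u hu v hv huv h5 e1
    · exact g2 u hu v hv huv h5 e2

lemma PCol.of_degen {V : Type*} {E : V → V → Prop} (hsym : ∀ u v, E u v → E v u) (r : ℕ) (X : Finset V)
    (h : ∀ Y ⊆ X, Y.Nonempty → ∃ v ∈ Y, (Y.filter (fun u => u ≠ v ∧ E v u)).card < r) :
    PCol E X r := by
  induction hn : X.card generalizing X with
  | zero =>
    rw [Finset.card_eq_zero] at hn
    subst hn; exact PCol.empty _
  | succ n ih =>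
    obtain ⟨v, hv, hd⟩ := h X (le_refl _) (Finset.card_pos.1 (by omega))
    obtain ⟨f, h1, h2⟩ := ih (X.erase v)
      (fun Y hY => h Y (hY.trans (Finset.erase_subset _ _)))
      (by rw [Finset.card_erase_of_mem hv]; omega)
    set N := X.filter (fun u => u ≠ v ∧ E v u)
    obtain ⟨c, hc, hcN⟩ : ∃ c ∈ Finset.range r, c ∉ N.image f := by
      by_contra hcon
      push Not at hcon
      have h3 := Finset.card_le_card (show Finset.range r ⊆ N.image f from hcon)
      have h4 := Finset.card_image_le (s := N) (f := f)
      simp only [Finset.card_range] at h3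
      omega
    have hcN' : ∀ u ∈ X, u ≠ v → E v u → f u ≠ c := by
      intro u hu huv he h
      exact hcN (Finset.mem_image.2 ⟨u, by simp [N, hu, huv, he], h⟩)
    rw [Finset.mem_range] at hc
    refine ⟨fun u => if u = v then c else f u, ?_, ?_⟩
    · intro u hu
      by_cases huv : u = v
      · simp [huv, hc]
      · simp [huv, h1 u (by simp [hu, huv])]
    · intro a ha b hb hab he
      by_cases hav : a = v <;> by_cases hbv : b = v
      · exact absurd (hav.trans hbv.symm) hab
      · subst hav
        simpa [hbv] using (hcN' b hb hbv he).symm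
      · subst hbv
        simpa [hav] using hcN' a ha hav (hsym _ _ he)
      · simpa [hav, hbv] using h2 a (by simp [ha, hav]) b (by simp [hb, hbv]) hab he

/-- Orientation with bounded out-degree gives a colouring. -/
lemma PCol.of_orient {V : Type*} {E : V → V → Prop} (hsym : ∀ u v, E u v → E v u)
    (R : V → V → Prop) (r : ℕ) (X : Finset V)
    (hR : ∀ u ∈ X, ∀ v ∈ X, u ≠ v → E u v → R u v ∨ R v u)
    (hd : ∀ u ∈ X, (X.filter (fun v => v ≠ u ∧ E u v ∧ R u v)).card ≤ r) :
    PCol E X (2 * r + 1) := by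
  apply PCol.of_degen hsym
  intro Y hY hne
  by_contra hcon
  push Not at hcon
  -- sum of degrees
  have h1 : Y.card * (2 * r + 1) ≤ ∑ v ∈ Y, (Y.filter (fun u => u ≠ v ∧ E v u)).card := by
    rw [← smul_eq_mul]
    exact Finset.card_nsmul_le_sum _ _ _ hcon
  have h2 : ∀ v ∈ Y, (Y.filter (fun u => u ≠ v ∧ E v u)).card ≤
      (Y.filter (fun u => u ≠ v ∧ E v u ∧ R v u)).card +
      (Y.filter (fun u => u ≠ v ∧ E v u ∧ R u v)).card := by
    intro v hv
    refine (Finset.card_le_card ?_).trans (Finset.card_union_le _ _)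
    intro u hu
    simp only [Finset.mem_filter, Finset.mem_union] at hu ⊢
    rcases hR v (hY hv) u (hY hu.1) hu.2.1.symm hu.2.2 with h | h
    · exact Or.inl ⟨hu.1, hu.2.1, hu.2.2, h⟩
    · exact Or.inr ⟨hu.1, hu.2.1, hu.2.2, h⟩
  have h3 : ∑ v ∈ Y, (Y.filter (fun u => u ≠ v ∧ E v u ∧ R u v)).card =
      ∑ v ∈ Y, (Y.filter (fun u => u ≠ v ∧ E v u ∧ R v u)).card := by
    have := Finset.sum_card_bipartiteAbove_eq_sum_card_bipartiteBelow (s := Y) (t := Y)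
      (fun a b => b ≠ a ∧ E a b ∧ R a b)
    simp only [Finset.bipartiteAbove, Finset.bipartiteBelow] at this
    rw [this]
    refine Finset.sum_congr rfl (fun v _ => ?_)
    congr 1
    ext u
    simp only [Finset.mem_filter]
    constructor
    · rintro ⟨a, b, c, d⟩; exact ⟨a, b.symm, hsym _ _ c, d⟩
    · rintro ⟨a, b, c, d⟩; exact ⟨a, b.symm, hsym _ _ c, d⟩
  have h4 : ∑ v ∈ Y, (Y.filter (fun u => u ≠ v ∧ E v u ∧ R v u)).card ≤ Y.card * r := by
    rw [← smul_eq_mul]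
    apply Finset.sum_le_card_nsmul
    intro v hv
    exact (Finset.card_le_card (Finset.filter_subset_filter _ hY)).trans (hd v (hY hv))
  have h5 := Finset.sum_le_sum h2
  rw [Finset.sum_add_distrib, h3] at h5
  have := Finset.card_pos.2 hne
  nlinarith

end DS

namespace DS
open scoped Classical

/-- Non-neighbours of `v` in `X`. -/
noncomputable def nn {V : Type*} (G : SimpleGraph V) (v : V) (X : Finset V) : Finset V :=
  X.filter (fun u => ¬ G.Adj v u)

lemma mem_nn {V : Type*} {G : SimpleGraph V} {v u : V} {X : Finset V} :
    u ∈ nn G v X ↔ u ∈ X ∧ ¬ G.Adj v u := by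
  simp [nn]

lemma nn_mono {V : Type*} {G : SimpleGraph V} (v : V) {X Y : Finset V} (h : X ⊆ Y) :
    nn G v X ⊆ nn G v Y := Finset.filter_subset_filter _ h

lemma nn_sub {V : Type*} {G : SimpleGraph V} (v : V) (X : Finset V) :
    nn G v X ⊆ X := Finset.filter_subset _ _

/-- Finset version of templates. -/
structure Tmp {V : Type*} (G : SimpleGraph V) (s w : ℕ) {ι : Type} (L0 : Finset V)
    (L : ι → Finset V) : Prop where
  d0 : ∀ i, Disjoint L0 (L i)
  dis : ∀ i j, i ≠ j → Disjoint (L i) (L j)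
  clq : G.IsClique (L0 : Set V)
  comp : ∀ u ∈ L0, ∀ i, ∀ v ∈ L i, G.Adj u v
  lo : ∀ i, w ^ (s+5) ≤ (L i).card
  hi : ∀ i, (L i).card ≤ 14 * w ^ (s+6)
  far : ∀ i j, i ≠ j → ∀ v ∈ L i, (nn G v (L j)).card ≤ w ^ (s+3)

/-- Value of a finset template. -/
noncomputable def val {V : Type*} (s w : ℕ) {ι : Type} [Fintype ι] (L0 : Finset V)
    (L : ι → Finset V) : ℕ :=
  ∑ i, ((L i).card + w ^ (s+5)) + 7 * w ^ (s+5) * L0.card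

/-- The standing assumptions. -/
structure Ctx {V : Type*} (G : SimpleGraph V) (s w k : ℕ) (L0 : Finset V)
    (L : Fin k → Finset V) : Prop where
  hs : 1 ≤ s
  noH : NoHs G s
  hw : 200 ≤ w
  hw3 : 7 * w + s < 7 * w ^ 3
  clq : ∀ K : Finset V, G.IsClique (K : Set V) → K.card ≤ w
  tmp : Tmp G s w L0 L
  opt : ∀ (ι : Type) [Fintype ι] (L0' : Finset V) (L' : ι → Finset V),
    Tmp G s w L0' L' → val s w L0' L' ≤ val s w L0 L

lemma card_common {V : Type*} (G : SimpleGraph V) (X P : Finset V) (b : ℕ)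
    (h : ∀ p ∈ P, (nn G p X).card ≤ b) :
    X.card ≤ (X.filter (fun x => ∀ p ∈ P, G.Adj p x)).card + P.card * b := by
  have h1 : X ⊆ (X.filter (fun x => ∀ p ∈ P, G.Adj p x)) ∪ P.biUnion (fun p => nn G p X) := by
    intro x hx
    simp only [Finset.mem_union, Finset.mem_filter, Finset.mem_biUnion, mem_nn]
    by_cases hh : ∀ p ∈ P, G.Adj p x
    · exact Or.inl ⟨hx, hh⟩
    · push Not at hh
      obtain ⟨p, hp, hpx⟩ := hh
      exact Or.inr ⟨p, hp, hx, hpx⟩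
  have h2 := (Finset.card_le_card h1).trans (Finset.card_union_le _ _)
  have h3 := Finset.card_biUnion_le_card_mul P (fun p => nn G p X) b h
  omega

lemma dcount {V : Type*} (G : SimpleGraph V) (X Y : Finset V) (b c : ℕ)
    (h : ∀ x ∈ X, (nn G x Y).card ≤ b) :
    (Y.filter (fun y => c < (nn G y X).card)).card * c ≤ X.card * b := by
  have h1 : ∑ x ∈ X, (nn G x Y).card = ∑ y ∈ Y, (nn G y X).card := by
    have := Finset.sum_card_bipartiteAbove_eq_sum_card_bipartiteBelow (s := X) (t := Y)
      (fun a b => ¬ G.Adj a b)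
    simp only [Finset.bipartiteAbove, Finset.bipartiteBelow] at this
    simp only [nn]
    rw [this]
    refine Finset.sum_congr rfl (fun v _ => ?_)
    simp only [G.adj_comm]
  have h2 : ∑ x ∈ X, (nn G x Y).card ≤ X.card * b := by
    rw [← smul_eq_mul]; exact Finset.sum_le_card_nsmul _ _ _ h
  have h3 : (Y.filter (fun y => c < (nn G y X).card)).card * c ≤
      ∑ y ∈ Y.filter (fun y => c < (nn G y X).card), (nn G y X).card := by
    rw [← smul_eq_mul]; apply Finset.card_nsmul_le_sum
    intro y hy
    exact (Finset.mem_filter.1 hy).2.le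
  have h4 : ∑ y ∈ Y.filter (fun y => c < (nn G y X).card), (nn G y X).card ≤
      ∑ y ∈ Y, (nn G y X).card :=
    Finset.sum_le_sum_of_subset (Finset.filter_subset _ _)
  omega

lemma nn_card_add {V : Type*} (G : SimpleGraph V) (v : V) (X : Finset V) :
    (X.filter (fun u => G.Adj v u)).card + (nn G v X).card = X.card :=
  Finset.card_filter_add_card_filter_not _

namespace Ctx
variable {V : Type*} {G : SimpleGraph V} {s w k : ℕ} {L0 : Finset V} {L : Fin k → Finset V}

lemma pw (C : Ctx G s w k L0 L) (n : ℕ) : 200 * w ^ n ≤ w ^ (n+1) := by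
  rw [pow_succ, mul_comm]; exact Nat.mul_le_mul_left _ C.hw

lemma pos (C : Ctx G s w k L0 L) (n : ℕ) : 0 < w ^ n := by
  have := C.hw
  positivity

lemma small (C : Ctx G s w k L0 L) (X : Finset V)
    (h : ∀ S ⊆ X, S.card = s → (∀ x ∈ S, ∀ y ∈ S, ¬ G.Adj x y) → False) :
    X.card < w ^ s := by
  by_contra hcon
  have := ram_lt w s (by have := C.hw; omega)
  obtain ⟨S, h1, h2, h3⟩ := exists_stable G w C.clq s X (by omega)
  exact h S h1 h2 h3

lemma transversal (C : Ctx G s w k L0 L) (P : Finset V) (hP : G.IsClique (P : Set V))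
    (J : Finset (Fin k)) (hPJ : ∀ p ∈ P, ∀ j ∈ J, (nn G p (L j)).card ≤ w ^ (s+3)) :
    ∃ x : Fin k → V, (∀ j ∈ J, x j ∈ L j) ∧ (∀ j ∈ J, ∀ p ∈ P, G.Adj p (x j)) ∧
      (∀ i ∈ J, ∀ j ∈ J, i ≠ j → G.Adj (x i) (x j)) ∧ P.card + J.card ≤ w := by
  induction J using Finset.induction_on with
  | empty =>
    have h0 := C.clq P hP
    by_cases hk : Nonempty V
    · exact ⟨fun _ => hk.some, by simp, by simp, by simp, by simpa using h0⟩
    · refine ⟨fun j => absurd ?_ hk, by simp, by simp, by simp, by simpa using h0⟩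
      have h1 := C.tmp.lo j
      have h2 := C.pos (s+5)
      obtain ⟨x, _⟩ := Finset.card_pos.1 (show 0 < (L j).card by omega)
      exact ⟨x⟩
  | insert j J hj ih =>
    obtain ⟨x, hx1, hx2, hx3, hx4⟩ := ih (fun p hp i hi => hPJ p hp i (by simp [hi]))
    have hc := card_common G (L j) (P ∪ J.image x) (w^(s+3)) (by
      intro p hp
      rw [Finset.mem_union, Finset.mem_image] at hp
      rcases hp with hp | ⟨i, hi, rfl⟩
      · exact hPJ p hp j (by simp)
      · exact C.tmp.far i j (by rintro rfl; exact hj hi) _ (hx1 i hi))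
    have hle : (P ∪ J.image x).card ≤ w :=
      (Finset.card_union_le _ _).trans ((Nat.add_le_add_left Finset.card_image_le _).trans hx4)
    have h1 : (P ∪ J.image x).card * w^(s+3) ≤ w^(s+4) := by
      rw [pow_succ w (s+3), mul_comm (w^(s+3))]
      exact Nat.mul_le_mul_right _ hle
    have h2 : 200 * w^(s+4) ≤ w^(s+5) := C.pw (s+4)
    have h3 := C.tmp.lo j
    have h4 := C.pos (s+4)
    obtain ⟨y, hy⟩ := Finset.card_pos.1 (show 0 < ((L j).filter
      (fun u => ∀ p ∈ P ∪ J.image x, G.Adj p u)).card by omega)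
    rw [Finset.mem_filter] at hy
    have hyP : ∀ p ∈ P, G.Adj p y := fun p hp => hy.2 p (by simp [hp])
    have hyJ : ∀ i ∈ J, G.Adj (x i) y := fun i hi => hy.2 (x i) (by
      rw [Finset.mem_union, Finset.mem_image]; exact Or.inr ⟨i, hi, rfl⟩)
    have hne : ∀ i ∈ J, i ≠ j := by rintro i hi rfl; exact hj hi
    have k1 : ∀ i ∈ insert j J, Function.update x j y i ∈ L i := by
      intro i hi
      rcases Finset.mem_insert.1 hi with rfl | hi
      · simpa using hy.1
      · simpa [hne i hi] using hx1 i hi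
    have k2 : ∀ i ∈ insert j J, ∀ p ∈ P, G.Adj p (Function.update x j y i) := by
      intro i hi p hp
      rcases Finset.mem_insert.1 hi with rfl | hi
      · simpa using hyP p hp
      · simpa [hne i hi] using hx2 i hi p hp
    have k3 : ∀ i ∈ insert j J, ∀ i' ∈ insert j J, i ≠ i' →
        G.Adj (Function.update x j y i) (Function.update x j y i') := by
      intro i hi i' hi' hii
      rcases Finset.mem_insert.1 hi with h1 | h1 <;>
      rcases Finset.mem_insert.1 hi' with h2 | h2
      · exact absurd (h1.trans h2.symm) hii
      · subst h1; simpa [hne i' h2] using (hyJ i' h2).symm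
      · subst h2; simpa [hne i h1] using hyJ i h1
      · replace hi := h1
        replace hi' := h2
        simpa [hne i hi, hne i' hi'] using hx3 i hi i' hi' hii
    refine ⟨Function.update x j y, k1, k2, k3, ?_⟩
    generalize Function.update x j y = z at *
    have hinj : Set.InjOn z (insert j J : Finset (Fin k)) := by
      intro a ha b hb hab
      by_contra hne
      exact (k3 a ha b hb hne).ne hab
    rw [← Finset.card_image_of_injOn hinj, ← Finset.card_union_of_disjoint]
    · apply C.clq
      intro a ha b hb hab
      simp only [Finset.coe_union, Set.mem_union, Finset.mem_coe, Finset.mem_image] at ha hb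
      rcases ha with ha | ⟨a, ha, rfl⟩ <;> rcases hb with hb | ⟨b, hb, rfl⟩
      · exact hP ha hb hab
      · exact k2 b hb a ha
      · exact (k2 a ha b hb).symm
      · exact k3 a ha b hb (by rintro rfl; exact hab rfl)
    · rw [Finset.disjoint_left]
      intro a ha hb
      obtain ⟨i, hi, rfl⟩ := Finset.mem_image.1 hb
      exact (k2 i hi _ ha).ne rfl

lemma nn_L0 (C : Ctx G s w k L0 L) {z : V} (hz : z ∈ L0) (i : Fin k) : nn G z (L i) = ∅ := by
  rw [Finset.eq_empty_iff_forall_notMem]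
  intro u hu
  rw [mem_nn] at hu
  exact hu.2 (C.tmp.comp z hz i u hu.1)

lemma L0k (C : Ctx G s w k L0 L) : L0.card + k ≤ w := by
  obtain ⟨x, _, _, _, h⟩ := C.transversal L0 C.tmp.clq Finset.univ (by
    intro p hp j _
    rw [C.nn_L0 hp]; simp)
  simpa using h

lemma O1 (C : Ctx G s w k L0 L) (i : Fin k) : 5 * w ^ (s+5) < (L i).card := by
  by_contra hcon
  push Not at hcon
  set J : Finset (Fin k) := Finset.univ.filter (fun j => (L j).card ≤ 5 * w^(s+5)) with hJ
  have hJm : ∀ j, j ∈ J ↔ (L j).card ≤ 5 * w^(s+5) := by intro j; simp [hJ]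
  have hJ0 : 0 < J.card := Finset.card_pos.2 ⟨i, (hJm i).2 hcon⟩
  obtain ⟨x, x1, x2, x3, x4⟩ := C.transversal L0 C.tmp.clq J (by
    intro p hp j _
    rw [C.nn_L0 hp]; simp)
  have hk := C.L0k
  have hinj : Set.InjOn x J := by
    intro a ha b hb hab
    by_contra hne
    exact (x3 a ha b hb hne).ne hab
  have hdis : Disjoint L0 (J.image x) := by
    rw [Finset.disjoint_left]
    intro a ha hb
    obtain ⟨i, hi, rfl⟩ := Finset.mem_image.1 hb
    exact (x2 i hi _ ha).ne rfl
  let L' : {j // j ∈ Jᶜ} → Finset V := fun i => (L i).filter (fun u => ∀ p ∈ J.image x, G.Adj p u)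
  have hsub : ∀ i, L' i ⊆ L i := fun i => Finset.filter_subset _ _
  have hcard : ∀ i : {j // j ∈ Jᶜ}, (L i).card ≤ (L' i).card + J.card * w^(s+3) := by
    intro i
    have hi := i.2
    rw [Finset.mem_compl] at hi
    have := card_common G (L i) (J.image x) (w^(s+3)) (by
      intro p hp
      obtain ⟨j, hj, rfl⟩ := Finset.mem_image.1 hp
      exact C.tmp.far j i (by rintro rfl; exact hi hj) _ (x1 j hj))
    rwa [Finset.card_image_of_injOn hinj] at this
  have e1 : J.card * w^(s+3) ≤ w^(s+4) := by
    rw [pow_succ w (s+3), mul_comm (w^(s+3))]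
    exact Nat.mul_le_mul_right _ (by omega)
  have e2 : 200 * w^(s+4) ≤ w^(s+5) := C.pw (s+4)
  have hT : Tmp G s w (L0 ∪ J.image x) L' := by
    refine ⟨?_, ?_, ?_, ?_, ?_, ?_, ?_⟩
    · intro i
      rw [Finset.disjoint_left]
      intro a ha hb
      rcases Finset.mem_union.1 ha with ha | ha
      · exact (C.tmp.comp a ha i a (hsub i hb)).ne rfl
      · exact ((Finset.mem_filter.1 hb).2 a ha).ne rfl
    · intro i j hij
      exact (C.tmp.dis i j (fun h => hij (Subtype.ext h))).mono (hsub i) (hsub j)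
    · intro a ha b hb hab
      simp only [Finset.coe_union, Set.mem_union, Finset.mem_coe, Finset.mem_image] at ha hb
      rcases ha with ha | ⟨a, ha, rfl⟩ <;> rcases hb with hb | ⟨b, hb, rfl⟩
      · exact C.tmp.clq ha hb hab
      · exact x2 b hb a ha
      · exact (x2 a ha b hb).symm
      · exact x3 a ha b hb (by rintro rfl; exact hab rfl)
    · intro u hu i v hv
      rcases Finset.mem_union.1 hu with hu | hu
      · exact C.tmp.comp u hu i v (hsub i hv)
      · exact (Finset.mem_filter.1 hv).2 u hu
    · intro i
      have h1 := hcard i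
      have hi := i.2
      rw [Finset.mem_compl, hJm] at hi
      omega
    · intro i
      exact (Finset.card_le_card (hsub i)).trans (C.tmp.hi i)
    · intro i j hij v hv
      exact (Finset.card_le_card (nn_mono v (hsub j))).trans
        (C.tmp.far i j (fun h => hij (Subtype.ext h)) v (hsub i hv))
  have hopt := C.opt _ _ _ hT
  unfold val at hopt
  rw [Finset.card_union_of_disjoint hdis, Finset.card_image_of_injOn hinj] at hopt
  have s1 : ∑ i : {j // j ∈ Jᶜ}, ((L i).card + w^(s+5)) ≤
      ∑ i : {j // j ∈ Jᶜ}, ((L' i).card + w^(s+5)) + k * (J.card * w^(s+3)) := by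
    have h1 : ∑ i : {j // j ∈ Jᶜ}, ((L i).card + w^(s+5)) ≤
        ∑ i : {j // j ∈ Jᶜ}, (((L' i).card + w^(s+5)) + J.card * w^(s+3)) :=
      Finset.sum_le_sum (fun i _ => by have := hcard i; omega)
    rw [Finset.sum_add_distrib (f := fun i : {j // j ∈ Jᶜ} => (L' i).card + w^(s+5)),
      Finset.sum_const, smul_eq_mul] at h1
    have h2 : (Finset.univ : Finset {j // j ∈ Jᶜ}).card ≤ k := by
      rw [Finset.card_univ, Fintype.card_coe]
      exact (Finset.card_le_univ _).trans (by simp)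
    have := Nat.mul_le_mul_right (J.card * w^(s+3)) h2
    omega
  have s2 : ∑ i : {j // j ∈ Jᶜ}, ((L i).card + w^(s+5)) = ∑ i ∈ Jᶜ, ((L i).card + w^(s+5)) :=
    Finset.sum_coe_sort Jᶜ (fun i => (L i).card + w^(s+5))
  have s3 : ∑ i ∈ J, ((L i).card + w^(s+5)) ≤ J.card * (6 * w^(s+5)) := by
    rw [← smul_eq_mul]
    apply Finset.sum_le_card_nsmul
    intro i hi
    have := (hJm i).1 hi
    omega
  have s4 := Finset.sum_add_sum_compl J (fun i => (L i).card + w^(s+5))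
  have s5 : k * (J.card * w^(s+3)) ≤ J.card * w^(s+4) := by
    calc k * (J.card * w^(s+3)) ≤ w * (J.card * w^(s+3)) := Nat.mul_le_mul_right _ (by omega)
      _ = J.card * w^(s+4) := by ring
  have s6 : J.card * (6 * w^(s+5)) + J.card * w^(s+4) < 7 * w^(s+5) * J.card := by
    have : J.card * w^(s+4) < J.card * w^(s+5) := by
      apply Nat.mul_lt_mul_of_pos_left _ hJ0
      have := C.pos (s+4)
      omega
    linarith
  have s7 : 7 * w^(s+5) * (L0.card + J.card) = 7 * w^(s+5) * L0.card + 7 * w^(s+5) * J.card := by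
    ring
  omega

lemma O2 (C : Ctx G s w k L0 L) (x : V) (h0 : ∀ z ∈ L0, G.Adj x z)
    (h1 : ∀ i, (nn G x (L i)).card ≤ 4 * w ^ (s+5))
    (h2 : ∑ i, (nn G x (L i)).card < 7 * w ^ (s+5)) : False := by
  have hx0 : x ∉ L0 := fun h => (h0 x h).ne rfl
  let L' : Fin k → Finset V := fun i => (L i).filter (fun u => G.Adj x u)
  have hsub : ∀ i, L' i ⊆ L i := fun i => Finset.filter_subset _ _
  have hc : ∀ i, (L' i).card + (nn G x (L i)).card = (L i).card := fun i => nn_card_add G x (L i)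
  have hT : Tmp G s w (insert x L0) L' := by
    refine ⟨?_, ?_, ?_, ?_, ?_, ?_, ?_⟩
    · intro i
      rw [Finset.disjoint_left]
      intro a ha hb
      rcases Finset.mem_insert.1 ha with rfl | ha
      · exact ((Finset.mem_filter.1 hb).2).ne rfl
      · exact (C.tmp.comp a ha i a (hsub i hb)).ne rfl
    · intro i j hij
      exact (C.tmp.dis i j hij).mono (hsub i) (hsub j)
    · rw [Finset.coe_insert, SimpleGraph.isClique_insert]
      exact ⟨C.tmp.clq, fun b hb _ => h0 b hb⟩
    · intro u hu i v hv
      rcases Finset.mem_insert.1 hu with rfl | hu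
      · exact (Finset.mem_filter.1 hv).2
      · exact C.tmp.comp u hu i v (hsub i hv)
    · intro i
      have a1 := hc i
      have a2 := C.O1 i
      have a3 := h1 i
      omega
    · intro i
      exact (Finset.card_le_card (hsub i)).trans (C.tmp.hi i)
    · intro i j hij v hv
      exact (Finset.card_le_card (nn_mono v (hsub j))).trans (C.tmp.far i j hij v (hsub i hv))
  have hopt := C.opt _ _ _ hT
  unfold val at hopt
  rw [Finset.card_insert_of_notMem hx0] at hopt
  have : ∑ i, ((L i).card + w^(s+5)) = ∑ i, ((L' i).card + w^(s+5)) + ∑ i, (nn G x (L i)).card := by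
    rw [← Finset.sum_add_distrib]
    refine Finset.sum_congr rfl (fun i _ => ?_)
    rw [← hc i]; ring
  have s7 : 7 * w^(s+5) * (L0.card + 1) = 7 * w^(s+5) * L0.card + 7 * w^(s+5) := by ring
  omega

lemma O3 (C : Ctx G s w k L0 L) (i : Fin k) (A0 A1 : Finset V) (hA0 : A0 ⊆ L i) (hA1 : A1 ⊆ L i)
    (hd : Disjoint A0 A1) (c0 : 2 * w ^ (s+5) ≤ A0.card) (c1 : 2 * w ^ (s+5) ≤ A1.card)
    (hc : (L i).card ≤ A0.card + A1.card + w ^ (s+3))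
    (hn : ∀ x ∈ A1, (nn G x A0).card ≤ w ^ s) : False := by
  set B : Finset V := A0.filter (fun y => ¬ (w^(s+3) < (nn G y A1).card)) with hB
  have hBA : B ⊆ A0 := Finset.filter_subset _ _
  have hcB : A0.card ≤ B.card + 14 * w^(s+3) := by
    have h1 := dcount G A1 A0 (w^s) (w^(s+3)) hn
    have h2 := Finset.card_filter_add_card_filter_not (s := A0) (fun y => w^(s+3) < (nn G y A1).card)
    have h3 := (Finset.card_le_card hA1).trans (C.tmp.hi i)
    have h4 : (A0.filter (fun y => w^(s+3) < (nn G y A1).card)).card ≤ 14 * w^(s+3) := by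
      have h5 : (A0.filter (fun y => w^(s+3) < (nn G y A1).card)).card * w^(s+3) ≤
          (14 * w^(s+3)) * w^(s+3) := by
        refine h1.trans ((Nat.mul_le_mul_right _ h3).trans (le_of_eq ?_))
        ring
      exact Nat.le_of_mul_le_mul_right h5 (C.pos _)
    rw [← hB] at h2
    omega
  let L' : Option (Fin k) → Finset V := fun o => o.elim A1 (fun j => if j = i then B else L j)
  have hsome : ∀ j, L' (some j) ⊆ L j := by
    intro j
    by_cases hj : j = i
    · subst hj; simpa [L'] using hBA.trans hA0
    · simp [L', hj]
  have hi' : L' (some i) = B := by simp [L']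
  have hj' : ∀ j, j ≠ i → L' (some j) = L j := by intro j hj; simp [L', hj]
  have p3 : 200 * w^(s+3) ≤ w^(s+4) := C.pw (s+3)
  have p4 : 200 * w^(s+4) ≤ w^(s+5) := C.pw (s+4)
  have pp := C.pos (s+3)
  have hdn : ∀ j, Disjoint A1 (L' (some j)) := by
    intro j
    by_cases hj : j = i
    · subst hj; rw [hi']; exact hd.symm.mono_right hBA
    · rw [hj' j hj]
      exact (C.tmp.dis i j (Ne.symm hj)).mono_left hA1
  have hT : Tmp G s w L0 L' := by
    refine ⟨?_, ?_, C.tmp.clq, ?_, ?_, ?_, ?_⟩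
    · rintro (_ | j)
      · exact (C.tmp.d0 i).mono_right hA1
      · exact (C.tmp.d0 j).mono_right (hsome j)
    · rintro (_ | j) (_ | j') hij
      · exact absurd rfl hij
      · exact hdn j'
      · exact (hdn j).symm
      · exact (C.tmp.dis j j' (fun h => hij (by rw [h]))).mono (hsome j) (hsome j')
    · rintro u hu (_ | j) v hv
      · exact C.tmp.comp u hu i v (hA1 hv)
      · exact C.tmp.comp u hu j v (hsome j hv)
    · rintro (_ | j)
      · show _ ≤ A1.card
        omega
      · by_cases hj : j = i
        · subst hj; rw [hi']; omega
        · rw [hj' j hj]; exact C.tmp.lo j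
    · rintro (_ | j)
      · exact (Finset.card_le_card hA1).trans (C.tmp.hi i)
      · exact (Finset.card_le_card (hsome j)).trans (C.tmp.hi j)
    · rintro (_ | j) (_ | j') hij v hv
      · exact absurd rfl hij
      · by_cases hj : j' = i
        · subst hj
          rw [hi']
          refine (Finset.card_le_card (nn_mono v hBA)).trans ((hn v hv).trans ?_)
          exact Nat.pow_le_pow_right (by have := C.hw; omega) (by omega)
        · rw [hj' j' hj]
          exact C.tmp.far i j' (Ne.symm hj) v (hA1 hv)
      · by_cases hj : j = i
        · subst hj
          rw [hi'] at hv
          have := (Finset.mem_filter.1 hv).2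
          exact not_lt.1 this
        · exact (Finset.card_le_card (nn_mono v hA1)).trans (C.tmp.far j i hj v (hsome j hv))
      · have hne : j ≠ j' := fun h => hij (by rw [h])
        exact (Finset.card_le_card (nn_mono v (hsome j'))).trans
          (C.tmp.far j j' hne v (hsome j hv))
  have hopt := C.opt _ _ _ hT
  unfold val at hopt
  rw [Fintype.sum_option] at hopt
  have e1 : (L' none) = A1 := rfl
  rw [e1] at hopt
  have s1 := Finset.add_sum_erase Finset.univ (fun j => (L j).card + w^(s+5)) (Finset.mem_univ i)
  have s2 := Finset.add_sum_erase Finset.univ (fun j => (L' (some j)).card + w^(s+5))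
    (Finset.mem_univ i)
  have s3 : ∑ j ∈ Finset.univ.erase i, ((L' (some j)).card + w^(s+5)) =
      ∑ j ∈ Finset.univ.erase i, ((L j).card + w^(s+5)) := by
    refine Finset.sum_congr rfl (fun j hj => ?_)
    rw [hj' j (Finset.mem_erase.1 hj).1]
  simp only [hi'] at s2
  rw [s3] at s2
  omega

lemma O4 (C : Ctx G s w k L0 L) (j : Fin k) (A B : Finset V)
    (cA : A.card = 14 * w ^ (s+6)) (cB : B.card = 14 * w ^ (s+6)) (hAB : Disjoint A B)
    (hcomp : ∀ a ∈ A, ∀ b ∈ B, G.Adj a b)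
    (hdA : ∀ i, Disjoint A (L i)) (hdB : ∀ i, Disjoint B (L i))
    (hA : ∀ v ∈ A, ∀ i, i ≠ j → 7 * (nn G v (L i)).card ≤ w ^ (s+2))
    (hB : ∀ v ∈ B, ∀ i, i ≠ j → 7 * (nn G v (L i)).card ≤ w ^ (s+2)) : False := by
  let N : Fin k → Finset V := fun i => (L i).filter
    (fun y => ¬ (w^(s+3) < (nn G y A).card) ∧ ¬ (w^(s+3) < (nn G y B).card))
  have hNL : ∀ i, N i ⊆ L i := fun i => Finset.filter_subset _ _
  have key : ∀ A : Finset V, A.card = 14 * w^(s+6) →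
      (∀ v ∈ A, ∀ i, i ≠ j → 7 * (nn G v (L i)).card ≤ w ^ (s+2)) → ∀ i, i ≠ j →
      ((L i).filter (fun y => w^(s+3) < (nn G y A).card)).card ≤ 2 * w^(s+5) := by
    intro A cA hA i hi
    have h1 := dcount G A (L i) (w^(s+2) / 7) (w^(s+3)) (by
      intro x hx
      have := hA x hx i hi
      omega)
    have h2 : 7 * (w^(s+2)/7) ≤ w^(s+2) := Nat.mul_div_le _ _
    rw [cA] at h1
    have h3 : 14 * w^(s+6) * (w^(s+2)/7) ≤ (2 * w^(s+5)) * w^(s+3) := by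
      calc 14 * w^(s+6) * (w^(s+2)/7) = 2 * w^(s+6) * (7 * (w^(s+2)/7)) := by ring
        _ ≤ 2 * w^(s+6) * w^(s+2) := Nat.mul_le_mul_left _ h2
        _ = _ := by ring
    exact Nat.le_of_mul_le_mul_right (h1.trans h3) (C.pos _)
  have hcN : ∀ i, i ≠ j → (L i).card ≤ (N i).card + 4 * w^(s+5) := by
    intro i hi
    have h1 := key A cA hA i hi
    have h2 := key B cB hB i hi
    have h3 : L i ⊆ N i ∪ ((L i).filter (fun y => w^(s+3) < (nn G y A).card) ∪
        (L i).filter (fun y => w^(s+3) < (nn G y B).card)) := by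
      intro y hy
      simp only [N, Finset.mem_union, Finset.mem_filter]
      tauto
    have h4 := (Finset.card_le_card h3).trans (Finset.card_union_le _ _)
    have h5 := Finset.card_union_le ((L i).filter (fun y => w^(s+3) < (nn G y A).card))
        ((L i).filter (fun y => w^(s+3) < (nn G y B).card))
    omega
  let L' : Option (Fin k) → Finset V := fun o => o.elim A (fun i => if i = j then B else N i)
  have hj : L' (some j) = B := by simp [L']
  have hi' : ∀ i, i ≠ j → L' (some i) = N i := by intro i hi; simp [L', hi]
  have hn : L' none = A := rfl
  have p4 : w^(s+2) ≤ w^(s+3) := Nat.pow_le_pow_right (by have := C.hw; omega) (by omega)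
  have p5 : 200 * w^(s+5) ≤ w^(s+6) := C.pw (s+5)
  have pp := C.pos (s+5)
  have hAnn : ∀ v ∈ A, ∀ i, i ≠ j → (nn G v (N i)).card ≤ w^(s+3) := by
    intro v hv i hi
    have := hA v hv i hi
    have := Finset.card_le_card (nn_mono (G := G) v (hNL i))
    omega
  have hBnn : ∀ v ∈ B, ∀ i, i ≠ j → (nn G v (N i)).card ≤ w^(s+3) := by
    intro v hv i hi
    have := hB v hv i hi
    have := Finset.card_le_card (nn_mono (G := G) v (hNL i))
    omega
  have hT : Tmp G s w ∅ L' := by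
    refine ⟨by simp, ?_, by simp, by simp, ?_, ?_, ?_⟩
    · rintro (_ | i) (_ | i') hii
      · exact absurd rfl hii
      · by_cases h : i' = j
        · subst h; rw [hn, hj]; exact hAB
        · rw [hn, hi' i' h]; exact (hdA i').mono_right (hNL i')
      · by_cases h : i = j
        · subst h; rw [hn, hj]; exact hAB.symm
        · rw [hn, hi' i h]; exact ((hdA i).mono_right (hNL i)).symm
      · have hne : i ≠ i' := fun h => hii (by rw [h])
        by_cases h : i = j
        · subst h
          rw [hj, hi' i' (Ne.symm hne)]
          exact (hdB i').mono_right (hNL i')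
        · rw [hi' i h]
          by_cases h' : i' = j
          · subst h'
            rw [hj]; exact ((hdB i).mono_right (hNL i)).symm
          · rw [hi' i' h']
            exact (C.tmp.dis i i' hne).mono (hNL i) (hNL i')
    · rintro (_ | i)
      · rw [hn, cA]; have : 200 * w^(s+5) ≤ w^(s+6) := C.pw (s+5); omega
      · by_cases h : i = j
        · subst h; rw [hj, cB]; omega
        · rw [hi' i h]
          have h1 := hcN i h
          have h2 := C.O1 i
          omega
    · rintro (_ | i)
      · rw [hn, cA]
      · by_cases h : i = j
        · subst h; rw [hj, cB]
        · rw [hi' i h]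
          exact (Finset.card_le_card (hNL i)).trans (C.tmp.hi i)
    · rintro (_ | i) (_ | i') hii v hv
      · exact absurd rfl hii
      · rw [hn] at hv
        by_cases h : i' = j
        · subst h; rw [hj]
          have : nn G v B = ∅ := by
            rw [Finset.eq_empty_iff_forall_notMem]
            intro u hu
            rw [mem_nn] at hu
            exact hu.2 (hcomp v hv u hu.1)
          rw [this]; simp
        · rw [hi' i' h]; exact hAnn v hv i' h
      · rw [hn]
        by_cases h : i = j
        · subst h; rw [hj] at hv
          have : nn G v A = ∅ := by
            rw [Finset.eq_empty_iff_forall_notMem]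
            intro u hu
            rw [mem_nn] at hu
            exact hu.2 (hcomp u hu.1 v hv).symm
          rw [this]; simp
        · rw [hi' i h] at hv
          exact not_lt.1 (Finset.mem_filter.1 hv).2.1
      · have hne : i ≠ i' := fun h => hii (by rw [h])
        by_cases h : i = j
        · subst h
          rw [hj] at hv
          rw [hi' i' (Ne.symm hne)]
          exact hBnn v hv i' (Ne.symm hne)
        · rw [hi' i h] at hv
          by_cases h' : i' = j
          · subst h'
            rw [hj]; exact not_lt.1 (Finset.mem_filter.1 hv).2.2
          · rw [hi' i' h']
            exact (Finset.card_le_card (nn_mono v (hNL i'))).trans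
              (C.tmp.far i i' hne v (hNL i hv))
  have hopt := C.opt _ _ _ hT
  unfold val at hopt
  rw [Fintype.sum_option, hn, cA] at hopt
  have s1 := Finset.add_sum_erase Finset.univ (fun j => (L j).card + w^(s+5)) (Finset.mem_univ j)
  have s2 := Finset.add_sum_erase Finset.univ (fun j => (L' (some j)).card + w^(s+5))
    (Finset.mem_univ j)
  simp only [hj, cB] at s2
  have s3 : ∑ i ∈ Finset.univ.erase j, ((L i).card + w^(s+5)) ≤
      ∑ i ∈ Finset.univ.erase j, ((L' (some i)).card + w^(s+5)) + k * (4 * w^(s+5)) := by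
    have h1 : ∑ i ∈ Finset.univ.erase j, ((L i).card + w^(s+5)) ≤
        ∑ i ∈ Finset.univ.erase j, (((L' (some i)).card + w^(s+5)) + 4 * w^(s+5)) := by
      apply Finset.sum_le_sum
      intro i hi
      have hi := (Finset.mem_erase.1 hi).1
      have := hcN i hi
      rw [hi' i hi]
      omega
    rw [Finset.sum_add_distrib (f := fun i => (L' (some i)).card + w^(s+5)), Finset.sum_const, smul_eq_mul] at h1
    have h2 : (Finset.univ.erase j : Finset (Fin k)).card ≤ k :=
      (Finset.card_le_univ _).trans (by simp)
    have := Nat.mul_le_mul_right (4 * w^(s+5)) h2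
    omega
  have h6 := C.tmp.hi j
  have h7 := C.L0k
  have h8 : 7 * w^(s+5) * L0.card + k * (4 * w^(s+5)) ≤ 7 * w^(s+6) := by
    have : (L0.card + k) * (7 * w^(s+5)) ≤ w * (7 * w^(s+5)) := Nat.mul_le_mul_right _ h7
    have e : w * (7 * w^(s+5)) = 7 * w^(s+6) := by ring
    nlinarith [Nat.zero_le (k * w^(s+5))]
  simp only [Finset.card_empty, mul_zero, add_zero] at hopt
  omega

end Ctx
end DS

namespace DS
open scoped Classical

/-- Vertices of the template. -/
noncomputable def VL {V : Type*} {k : ℕ} (L0 : Finset V) (L : Fin k → Finset V) : Finset V :=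
  L0 ∪ Finset.univ.biUnion L

/-- A pendant-type configuration. -/
def PendAt {V : Type*} (G : SimpleGraph V) (s : ℕ) (u x : V) (S : Finset V) (v : V) : Prop :=
  G.Adj u x ∧ (∀ y ∈ S, G.Adj u y ∧ ¬ G.Adj x y ∧ ¬ G.Adj v y) ∧
  (∀ y ∈ S, ∀ z ∈ S, ¬ G.Adj y z) ∧ S.card = s ∧ G.Adj v x ∧ ¬ G.Adj v u

/-- Pendant-type vertices. -/
def Pend {V : Type*} (G : SimpleGraph V) (s : ℕ) (W : Finset V) (v : V) : Prop :=
  ∃ u ∈ W, ∃ x ∈ W, ∃ S ⊆ W, PendAt G s u x S v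

/-- Few non-neighbours. -/
def Few {V : Type*} (G : SimpleGraph V) (s w : ℕ) (X : Finset V) (v : V) : Prop :=
  7 * (nn G v X).card ≤ w ^ (s+2)

/-- No neighbours. -/
def Anti {V : Type*} (G : SimpleGraph V) (X : Finset V) (v : V) : Prop :=
  ∀ x ∈ X, ¬ G.Adj v x

namespace Ctx
variable {V : Type*} {G : SimpleGraph V} {s w k : ℕ} {L0 : Finset V} {L : Fin k → Finset V}

lemma mem_VL {v : V} : v ∈ VL L0 L ↔ v ∈ L0 ∨ ∃ i, v ∈ L i := by
  simp [VL]

lemma VL_card (C : Ctx G s w k L0 L) : (VL L0 L).card ≤ w ^ (s+8) := by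
  have h1 : (Finset.univ.biUnion L).card ≤ k * (14 * w^(s+6)) := by
    have := Finset.card_biUnion_le_card_mul Finset.univ L (14 * w^(s+6)) (fun i _ => C.tmp.hi i)
    simpa using this
  have h2 := C.L0k
  have h3 : k * (14 * w^(s+6)) ≤ 14 * w^(s+7) := by
    calc k * (14 * w^(s+6)) ≤ w * (14 * w^(s+6)) := Nat.mul_le_mul_right _ (by omega)
      _ = _ := by ring
  have h4 : 200 * w^(s+7) ≤ w^(s+8) := C.pw (s+7)
  have h5 : w ≤ w^(s+7) := Nat.le_self_pow (by omega) w
  have := Finset.card_union_le L0 (Finset.univ.biUnion L)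
  unfold VL
  omega

lemma pend_at_card (C : Ctx G s w k L0 L) (N W : Finset V) (hd : Disjoint N W) (u x : V)
    (S : Finset V) (hu : u ∈ W) :
    (N.filter (PendAt G s u x S)).card < ram w s := by
  by_contra hcon
  obtain ⟨T, h1, h2, h3⟩ := exists_stable G w C.clq s _ (not_lt.1 hcon)
  have hT : ∀ v ∈ T, v ∈ N ∧ PendAt G s u x S v := fun v hv => Finset.mem_filter.1 (h1 hv)
  have hs := C.hs
  obtain ⟨v, hv⟩ := Finset.card_pos.1 (show 0 < T.card by omega)
  obtain ⟨hvN, a1, a2, a3, a4, a5, a6⟩ := hT v hv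
  refine C.noH u x S T a1 a4 h2 ?_ ?_ a3 h3 ?_
  · intro y hy
    refine ⟨(a2 y hy).1, (a2 y hy).2.1, ?_⟩
    rintro rfl
    exact (a2 y hy).2.2 a5
  · intro t ht
    obtain ⟨htN, b1, b2, b3, b4, b5, b6⟩ := hT t ht
    refine ⟨b5.symm, fun h => b6 h.symm, ?_⟩
    rintro rfl
    exact Finset.disjoint_left.1 hd htN hu
  · intro y hy t ht h
    exact ((hT t ht).2.2.1 y hy).2.2 h.symm

lemma pend_card (C : Ctx G s w k L0 L) (N : Finset V) (hd : Disjoint N (VL L0 L)) :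
    (N.filter (Pend G s (VL L0 L))).card ≤ w ^ (2*s^2+15*s+6) := by
  set W := VL L0 L with hW
  have hs := C.hs
  have hsub : N.filter (Pend G s W) ⊆
      W.biUnion (fun u => W.biUnion (fun x => (W.powersetCard s).biUnion
        (fun S => N.filter (PendAt G s u x S)))) := by
    intro v hv
    obtain ⟨hvN, u, hu, x, hx, S, hS, h⟩ := Finset.mem_filter.1 hv
    simp only [Finset.mem_biUnion, Finset.mem_filter, Finset.mem_powersetCard]
    exact ⟨u, hu, x, hx, S, ⟨hS, h.2.2.2.1⟩, hvN, h⟩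
  have hcard : (N.filter (Pend G s W)).card ≤
      W.card * (W.card * ((W.powersetCard s).card * (ram w s - 1))) := by
    refine (Finset.card_le_card hsub).trans ?_
    refine Finset.card_biUnion_le_card_mul _ _ _ (fun u hu => ?_)
    refine Finset.card_biUnion_le_card_mul _ _ _ (fun x hx => ?_)
    refine Finset.card_biUnion_le_card_mul _ _ _ (fun S hS => ?_)
    have := C.pend_at_card N W hd u x S hu
    omega
  refine hcard.trans ?_
  by_cases h1 : s = 1
  · subst h1
    simp [ram]
  have hW' := C.VL_card
  have h2 : (W.powersetCard s).card ≤ (w^(s+8))^s := by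
    rw [Finset.card_powersetCard]
    exact (Nat.choose_le_pow _ _).trans (Nat.pow_le_pow_left hW' s)
  have h3 := ram_lt w s (by have := C.hw; omega)
  calc W.card * (W.card * ((W.powersetCard s).card * (ram w s - 1)))
      ≤ w^(s+8) * (w^(s+8) * ((w^(s+8))^s * w^s)) := by
        gcongr
        omega
    _ = w ^ (s^2 + 11 * s + 16) := by
        rw [← pow_mul, ← pow_add, ← pow_add, ← pow_add]; ring_nf
    _ ≤ _ := by
        apply Nat.pow_le_pow_right (by have := C.hw; omega)
        nlinarith [show 2 ≤ s by omega]

lemma adj_L0 (C : Ctx G s w k L0 L) {i : Fin k} {x : V} (hx : x ∈ L i) :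
    ∀ z ∈ L0, G.Adj x z := fun z hz => (C.tmp.comp z hz i x hx).symm

lemma O2in (C : Ctx G s w k L0 L) (i : Fin k) (x : V) (hx : x ∈ L i)
    (h : (nn G x (L i)).card ≤ 4 * w ^ (s+5)) : False := by
  have p3 : 200 * w^(s+3) ≤ w^(s+4) := C.pw (s+3)
  have p4 : 200 * w^(s+4) ≤ w^(s+5) := C.pw (s+4)
  have pp := C.pos (s+3)
  have hk := C.L0k
  refine C.O2 x (C.adj_L0 hx) ?_ ?_
  · intro j
    by_cases hj : i = j
    · subst hj; exact h
    · have := C.tmp.far i j hj x hx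
      omega
  · rw [← Finset.add_sum_erase Finset.univ _ (Finset.mem_univ i)]
    have h1 : ∑ j ∈ Finset.univ.erase i, (nn G x (L j)).card ≤
        (Finset.univ.erase i : Finset (Fin k)).card * w^(s+3) := by
      rw [← smul_eq_mul]
      apply Finset.sum_le_card_nsmul
      intro j hj
      exact C.tmp.far i j (Finset.mem_erase.1 hj).1.symm x hx
    have h2 : (Finset.univ.erase i : Finset (Fin k)).card ≤ w :=
      (Finset.card_le_univ _).trans (by simp; omega)
    have h3 := Nat.mul_le_mul_right (w^(s+3)) h2
    have h4 : w * w^(s+3) = w^(s+4) := by ring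
    omega

lemma star (C : Ctx G s w k L0 L) (v : V) (hp : ¬ Pend G s (VL L0 L) v)
    (i : Fin k) (u : V) (hu : u ∈ VL L0 L) (huv : ¬ G.Adj v u)
    (hn : (nn G u (L i)).card ≤ w ^ (s+3)) :
    (∀ x ∈ L i, G.Adj u x → ¬ G.Adj v x) ∨
    14 * ((L i).filter (fun x => G.Adj u x ∧ ¬ G.Adj v x)).card < w ^ (s+2) := by
  by_contra hcon
  push Not at hcon
  obtain ⟨⟨x0, hx0, hux0, hvx0⟩, hA0⟩ := hcon
  set A0 := (L i).filter (fun x => G.Adj u x ∧ ¬ G.Adj v x) with hA0d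
  set A1 := (L i).filter (fun x => G.Adj u x ∧ G.Adj v x) with hA1d
  have h0L : A0 ⊆ L i := Finset.filter_subset _ _
  have h1L : A1 ⊆ L i := Finset.filter_subset _ _
  have hdis : Disjoint A0 A1 := by
    rw [Finset.disjoint_left]
    intro a ha hb
    exact (Finset.mem_filter.1 ha).2.2 (Finset.mem_filter.1 hb).2.2
  have hcov : ∀ y ∈ L i, y ∈ A0 ∨ y ∈ A1 ∨ y ∈ nn G u (L i) := by
    intro y hy
    simp only [A0, A1, Finset.mem_filter, mem_nn]
    tauto
  have hLc : (L i).card ≤ A0.card + A1.card + w^(s+3) := by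
    have h1 : L i ⊆ (A0 ∪ A1) ∪ nn G u (L i) := by
      intro y hy
      have := hcov y hy
      simp only [Finset.mem_union]; tauto
    have h2 := (Finset.card_le_card h1).trans (Finset.card_union_le _ _)
    have h3 := Finset.card_union_le A0 A1
    omega
  have hsm : ∀ x ∈ A1, (nn G x A0).card ≤ w^s := by
    intro x hx
    obtain ⟨hx1, hx2, hx3⟩ := Finset.mem_filter.1 hx
    apply le_of_lt
    apply C.small
    intro S hS hSc hSs
    have hS' : ∀ y ∈ S, (y ∈ L i ∧ G.Adj u y ∧ ¬ G.Adj v y) ∧ ¬ G.Adj x y := by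
      intro y hy
      have := mem_nn.1 (hS hy)
      exact ⟨Finset.mem_filter.1 this.1, this.2⟩
    refine hp ⟨u, hu, x, mem_VL.2 (Or.inr ⟨i, hx1⟩), S,
      fun y hy => mem_VL.2 (Or.inr ⟨i, (hS' y hy).1.1⟩), hx2, ?_, hSs, hSc, hx3, huv⟩
    intro y hy
    exact ⟨(hS' y hy).1.2.1, (hS' y hy).2, (hS' y hy).1.2.2⟩
  have p1 : 200 * w^(s+1) ≤ w^(s+2) := C.pw (s+1)
  have p2 : 200 * w^(s+2) ≤ w^(s+3) := C.pw (s+2)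
  have p3 : 200 * w^(s+3) ≤ w^(s+4) := C.pw (s+3)
  have p4 : 200 * w^(s+4) ≤ w^(s+5) := C.pw (s+4)
  have p0 : 200 * w^(s) ≤ w^(s+1) := C.pw s
  have pp := C.pos s
  have hnn : ∀ x, (nn G x (L i)).card ≤ (nn G x A0).card + (nn G x A1).card + w^(s+3) := by
    intro x
    have h1 : nn G x (L i) ⊆ (nn G x A0 ∪ nn G x A1) ∪ nn G u (L i) := by
      intro y hy
      have hy := mem_nn.1 hy
      have := hcov y hy.1
      simp only [Finset.mem_union]
      rcases this with h | h | h
      · exact Or.inl (Or.inl (mem_nn.2 ⟨h, hy.2⟩))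
      · exact Or.inl (Or.inr (mem_nn.2 ⟨h, hy.2⟩))
      · exact Or.inr h
    have h2 := (Finset.card_le_card h1).trans (Finset.card_union_le _ _)
    have h3 := Finset.card_union_le (nn G x A0) (nn G x A1)
    omega
  by_cases c1 : A1.card < 2 * w^(s+5)
  · have hx0A : x0 ∈ A1 := Finset.mem_filter.2 ⟨hx0, hux0, hvx0⟩
    apply C.O2in i x0 hx0
    have a1 := hnn x0
    have a2 := hsm x0 hx0A
    have a3 := Finset.card_le_card (nn_sub (G := G) x0 A1)
    omega
  by_cases c0 : A0.card < 2 * w^(s+5)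
  · have hd := dcount G A1 A0 (w^s) (w^(s+5)) hsm
    have h3 := (Finset.card_le_card h1L).trans (C.tmp.hi i)
    have hb : (A0.filter (fun y => w^(s+5) < (nn G y A1).card)).card ≤ 14 * w^(s+1) := by
      have : (A0.filter (fun y => w^(s+5) < (nn G y A1).card)).card * w^(s+5) ≤
          (14 * w^(s+1)) * w^(s+5) := by
        refine hd.trans ((Nat.mul_le_mul_right _ h3).trans (le_of_eq ?_))
        ring
      exact Nat.le_of_mul_le_mul_right this (C.pos _)
    have h5 := Finset.card_filter_add_card_filter_not (s := A0)
      (fun y => w^(s+5) < (nn G y A1).card)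
    obtain ⟨a, ha⟩ := Finset.card_pos.1
      (show 0 < (A0.filter (fun y => ¬ (w^(s+5) < (nn G y A1).card))).card by omega)
    obtain ⟨ha0, ha1⟩ := Finset.mem_filter.1 ha
    apply C.O2in i a (h0L ha0)
    have a1 := hnn a
    have a3 := Finset.card_le_card (nn_sub (G := G) a A0)
    omega
  exact C.O3 i A0 A1 h0L h1L hdis (by omega) (by omega) hLc hsm

lemma sstar (C : Ctx G s w k L0 L) (v : V) (hp : ¬ Pend G s (VL L0 L) v)
    (j : Fin k) (hj : 2 * w ^ (s+3) ≤ (nn G v (L j)).card) (i : Fin k) (hij : i ≠ j) :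
    Few G s w (L i) v ∨ Anti G (L i) v := by
  by_contra hcon
  unfold Few Anti at hcon
  push Not at hcon
  obtain ⟨hfew, x, hx, hvx⟩ := hcon
  set B := nn G v (L j) with hB
  have hBL : ∀ u ∈ B, u ∈ L j ∧ ¬ G.Adj v u := fun u hu => mem_nn.1 hu
  have p2 : 200 * w^(s+2) ≤ w^(s+3) := C.pw (s+2)
  have p3 : 200 * w^(s+3) ≤ w^(s+4) := C.pw (s+3)
  have p4 : 200 * w^(s+4) ≤ w^(s+5) := C.pw (s+4)
  have pp := C.pos (s+2)
  have hst : ∀ u ∈ B, (∃ y ∈ L i, G.Adj u y ∧ G.Adj v y) →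
      14 * ((L i).filter (fun x => G.Adj u x ∧ ¬ G.Adj v x)).card < w ^ (s+2) := by
    rintro u hu ⟨y, hy, h1, h2⟩
    refine (C.star v hp i u (mem_VL.2 (Or.inr ⟨j, (hBL u hu).1⟩)) (hBL u hu).2
      (C.tmp.far j i (Ne.symm hij) u (hBL u hu).1)).resolve_left ?_
    intro h
    exact h y hy h1 h2
  -- first find one
  obtain ⟨u0, hu0, hu0x⟩ : ∃ u ∈ B, G.Adj u x := by
    by_contra hcon
    push Not at hcon
    have h1 : B ⊆ nn G x (L j) := fun u hu => mem_nn.2 ⟨(hBL u hu).1, fun h => hcon u hu h.symm⟩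
    have h2 := Finset.card_le_card h1
    have h3 := C.tmp.far i j hij x hx
    omega
  have h0 := hst u0 hu0 ⟨x, hx, hu0x, hvx⟩
  have hY : (nn G v (L i)).card ≤ w^(s+3) + w^(s+2) := by
    have h1 : nn G v (L i) ⊆ (L i).filter (fun x => G.Adj u0 x ∧ ¬ G.Adj v x) ∪ nn G u0 (L i) := by
      intro y hy
      have := mem_nn.1 hy
      simp only [Finset.mem_union, Finset.mem_filter, mem_nn]
      tauto
    have h2 := (Finset.card_le_card h1).trans (Finset.card_union_le _ _)
    have h3 := C.tmp.far j i (Ne.symm hij) u0 (hBL u0 hu0).1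
    omega
  have hall : ∀ u ∈ B, 14 * ((nn G v (L i)).filter (fun x => G.Adj u x)).card ≤ w ^ (s+2) := by
    intro u hu
    have h1 : ∃ y ∈ L i, G.Adj u y ∧ G.Adj v y := by
      by_contra hcon
      push Not at hcon
      have h1 : L i ⊆ nn G u (L i) ∪ nn G v (L i) := by
        intro y hy
        have := hcon y hy
        simp only [Finset.mem_union, mem_nn]
        tauto
      have h2 := (Finset.card_le_card h1).trans (Finset.card_union_le _ _)
      have h3 := C.tmp.far j i (Ne.symm hij) u (hBL u hu).1
      have h4 := C.tmp.lo i
      omega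
    have h2 := hst u hu h1
    have h3 : (nn G v (L i)).filter (fun x => G.Adj u x) ⊆
        (L i).filter (fun x => G.Adj u x ∧ ¬ G.Adj v x) := by
      intro y hy
      simp only [Finset.mem_filter, mem_nn] at hy ⊢
      tauto
    have := Finset.card_le_card h3
    omega
  set Y := nn G v (L i) with hYd
  -- double counting
  have d1 : ∑ u ∈ B, (Y.filter (fun x => G.Adj u x)).card =
      ∑ y ∈ Y, (B.filter (fun u => G.Adj u y)).card := by
    have := Finset.sum_card_bipartiteAbove_eq_sum_card_bipartiteBelow (s := B) (t := Y)
      (fun a b => G.Adj a b)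
    simpa only [Finset.bipartiteAbove, Finset.bipartiteBelow] using this
  have d2 : 14 * ∑ u ∈ B, (Y.filter (fun x => G.Adj u x)).card ≤ B.card * w^(s+2) := by
    rw [Finset.mul_sum, ← smul_eq_mul (a := B.card)]
    exact Finset.sum_le_card_nsmul _ _ _ hall
  have d3 : Y.card * B.card ≤ 2 * ∑ y ∈ Y, (B.filter (fun u => G.Adj u y)).card := by
    rw [Finset.mul_sum, ← smul_eq_mul (a := Y.card)]
    apply Finset.card_nsmul_le_sum
    intro y hy
    have hy := mem_nn.1 hy
    have h1 := C.tmp.far i j hij y hy.1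
    have h2 : B ⊆ B.filter (fun u => G.Adj u y) ∪ nn G y (L j) := by
      intro u hu
      have := (hBL u hu).1
      simp only [Finset.mem_union, Finset.mem_filter, mem_nn, G.adj_comm y u]
      tauto
    have h3 := (Finset.card_le_card h2).trans (Finset.card_union_le _ _)
    omega
  have d4 : B.card * (7 * Y.card) ≤ B.card * w^(s+2) := by
    rw [← d1] at d3
    nlinarith
  have d5 := Nat.le_of_mul_le_mul_left d4 (by have := C.pos (s+3); omega)
  omega

lemma tricho (C : Ctx G s w k L0 L) (v : V) (hp : ¬ Pend G s (VL L0 L) v)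
    (hN : ∃ i, ¬ Anti G (L i) v) :
    ((∀ i, Few G s w (L i) v ∨ Anti G (L i) v) ∧ ∃ i, Anti G (L i) v) ∨
    ∃ j, ∀ i, i ≠ j → Few G s w (L i) v := by
  by_cases hz : ∃ z ∈ L0, ¬ G.Adj v z
  · obtain ⟨z, hz, hvz⟩ := hz
    have hall : ∀ i, Few G s w (L i) v ∨ Anti G (L i) v := by
      intro i
      rcases C.star v hp i z (mem_VL.2 (Or.inl hz)) hvz (by rw [C.nn_L0 hz]; simp) with h | h
      · right
        intro x hx
        exact h x hx (C.tmp.comp z hz i x hx)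
      · left
        unfold Few
        have h1 : nn G v (L i) ⊆ (L i).filter (fun x => G.Adj z x ∧ ¬ G.Adj v x) := by
          intro y hy
          have hy := mem_nn.1 hy
          exact Finset.mem_filter.2 ⟨hy.1, C.tmp.comp z hz i y hy.1, hy.2⟩
        have := Finset.card_le_card h1
        omega
    by_cases ha : ∃ i, Anti G (L i) v
    · exact Or.inl ⟨hall, ha⟩
    · push Not at ha
      right
      obtain ⟨j, _⟩ := hN
      exact ⟨j, fun i _ => (hall i).resolve_right (ha i)⟩
  · push Not at hz
    have p3 : 200 * w^(s+3) ≤ w^(s+4) := C.pw (s+3)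
    have p4 : 200 * w^(s+4) ≤ w^(s+5) := C.pw (s+4)
    have pp := C.pos (s+3)
    obtain ⟨j, hj⟩ : ∃ j, 2 * w^(s+3) ≤ (nn G v (L j)).card := by
      by_contra hcon
      push Not at hcon
      refine C.O2 v hz (fun i => ?_) ?_
      · have := hcon i; omega
      · have h1 : ∑ i, (nn G v (L i)).card ≤ (Finset.univ : Finset (Fin k)).card * (2 * w^(s+3)) := by
          rw [← smul_eq_mul]
          exact Finset.sum_le_card_nsmul _ _ _ (fun i _ => (hcon i).le)
        have h2 := C.L0k
        have h3 : (Finset.univ : Finset (Fin k)).card * (2 * w^(s+3)) ≤ w * (2 * w^(s+3)) :=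
          Nat.mul_le_mul_right _ (by simp; omega)
        have h4 : w * (2 * w^(s+3)) = 2 * w^(s+4) := by ring
        have := C.pos (s+4)
        omega
    by_cases hQ : ∀ i, i ≠ j → Few G s w (L i) v
    · exact Or.inr ⟨j, hQ⟩
    push Not at hQ
    obtain ⟨i, hij, hi⟩ := hQ
    have hia := (C.sstar v hp j hj i hij).resolve_left hi
    have hib : 2 * w^(s+3) ≤ (nn G v (L i)).card := by
      have : nn G v (L i) = L i := by
        apply Finset.filter_true_of_mem
        exact hia
      rw [this]
      have := C.tmp.lo i
      omega
    left
    refine ⟨fun l => ?_, i, hia⟩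
    by_cases hl : l = j
    · exact C.sstar v hp i hib l (by rw [hl]; exact hij.symm)
    · exact C.sstar v hp j hj l hl

end Ctx
end DS

namespace DS
open scoped Classical

/-- Set of pure vertices. -/
def PureSet {V : Type*} (G : SimpleGraph V) (s w : ℕ) {k : ℕ} (L0 : Finset V)
    (L : Fin k → Finset V) (M : Finset V) : Prop :=
  ∀ v ∈ M, v ∉ VL L0 L ∧ (∀ i, Few G s w (L i) v ∨ Anti G (L i) v) ∧
    (∃ i, Anti G (L i) v) ∧ ∃ i, ¬ Anti G (L i) v

/-- Indices of anticomplete parts. -/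
noncomputable def Jf {V : Type*} (G : SimpleGraph V) {k : ℕ} (L : Fin k → Finset V) (v : V) :
    Finset (Fin k) := Finset.univ.filter (fun i => Anti G (L i) v)

lemma mem_Jf {V : Type*} {G : SimpleGraph V} {k : ℕ} {L : Fin k → Finset V} {v : V} {i : Fin k} :
    i ∈ Jf G L v ↔ Anti G (L i) v := by simp [Jf]

namespace Ctx
variable {V : Type*} {G : SimpleGraph V} {s w k : ℕ} {L0 : Finset V} {L : Fin k → Finset V}

lemma stable_in (C : Ctx G s w k L0 L) (X : Finset V) (h : w ^ s ≤ X.card) :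
    ∃ S ⊆ X, S.card = s ∧ ∀ x ∈ S, ∀ y ∈ S, ¬ G.Adj x y :=
  exists_stable G w C.clq s X ((ram_lt w s (by have := C.hw; omega)).le.trans h)

lemma few_of (C : Ctx G s w k L0 L) {M : Finset V} (hM : PureSet G s w L0 L M) {v : V}
    (hv : v ∈ M) {i : Fin k} (hi : i ∉ Jf G L v) : Few G s w (L i) v :=
  ((hM v hv).2.1 i).resolve_right (fun h => hi (mem_Jf.2 h))

lemma ne_of_M {M : Finset V} (hM : PureSet G s w L0 L M) {v x : V}
    (hv : v ∈ M) {i : Fin k} (hx : x ∈ L i) : v ≠ x := by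
  rintro rfl
  exact (hM v hv).1 (mem_VL.2 (Or.inr ⟨i, hx⟩))

lemma few_card (C : Ctx G s w k L0 L) {v : V} {i : Fin k} (h : Few G s w (L i) v) :
    w ^ s ≤ ((L i).filter (fun u => G.Adj v u)).card := by
  have h1 := nn_card_add G v (L i)
  have h2 := C.O1 i
  unfold Few at h
  have p0 : 200 * w^s ≤ w^(s+1) := C.pw s
  have p1 : 200 * w^(s+1) ≤ w^(s+2) := C.pw (s+1)
  have p2 : 200 * w^(s+2) ≤ w^(s+3) := C.pw (s+2)
  have p3 : 200 * w^(s+3) ≤ w^(s+4) := C.pw (s+3)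
  have p4 : 200 * w^(s+4) ≤ w^(s+5) := C.pw (s+4)
  omega

lemma far_card (C : Ctx G s w k L0 L) {x : V} {i j : Fin k} (hx : x ∈ L i) (hij : i ≠ j) :
    w ^ s ≤ ((L j).filter (fun u => G.Adj x u)).card := by
  have h1 := nn_card_add G x (L j)
  have h2 := C.O1 j
  have h := C.tmp.far i j hij x hx
  have p0 : 200 * w^s ≤ w^(s+1) := C.pw s
  have p1 : 200 * w^(s+1) ≤ w^(s+2) := C.pw (s+1)
  have p2 : 200 * w^(s+2) ≤ w^(s+3) := C.pw (s+2)
  have p3 : 200 * w^(s+3) ≤ w^(s+4) := C.pw (s+3)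
  have p4 : 200 * w^(s+4) ≤ w^(s+5) := C.pw (s+4)
  omega

lemma factA (C : Ctx G s w k L0 L) {M : Finset V} (hM : PureSet G s w L0 L M) {v : V}
    (hv : v ∈ M) {i j : Fin k} (hi : i ∉ Jf G L v) (hj : j ∈ Jf G L v) :
    (M.filter (fun v' => G.Adj v v' ∧ i ∈ Jf G L v' ∧ j ∈ Jf G L v')).card < w ^ s := by
  apply C.small
  intro T hT hTc hTs
  have hT' : ∀ t ∈ T, t ∈ M ∧ G.Adj v t ∧ Anti G (L i) t ∧ Anti G (L j) t := by
    intro t ht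
    have := Finset.mem_filter.1 (hT ht)
    rwa [mem_Jf, mem_Jf] at this
  rw [mem_Jf] at hj
  have hij : i ≠ j := by rintro rfl; exact hi (mem_Jf.2 hj)
  have h1 := C.few_card (C.few_of hM hv hi)
  obtain ⟨x, hx⟩ := Finset.card_pos.1 ((C.pos s).trans_le h1)
  obtain ⟨hxL, hvx⟩ := Finset.mem_filter.1 hx
  obtain ⟨S, hS, hSc, hSs⟩ := C.stable_in _ (C.far_card hxL hij)
  have hS' : ∀ y ∈ S, y ∈ L j ∧ G.Adj x y := fun y hy => Finset.mem_filter.1 (hS hy)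
  refine C.noH v x T S hvx hTc hSc ?_ ?_ hTs hSs ?_
  · intro t ht
    exact ⟨(hT' t ht).2.1, fun h => (hT' t ht).2.2.1 x hxL h.symm, ne_of_M hM (hT' t ht).1 hxL⟩
  · intro y hy
    exact ⟨(hS' y hy).2, hj y (hS' y hy).1, (ne_of_M hM hv (hS' y hy).1).symm⟩
  · intro t ht y hy
    exact (hT' t ht).2.2.2 y (hS' y hy).1

lemma factB (C : Ctx G s w k L0 L) {M : Finset V} (hM : PureSet G s w L0 L M) {v v' : V}
    (hv : v ∈ M) (hv' : v' ∈ M) (hadj : G.Adj v v') {j : Fin k} (hj : j ∉ Jf G L v)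
    (hj' : j ∈ Jf G L v') :
    (M.filter (fun u => G.Adj v' u ∧ ¬ G.Adj v u ∧ j ∈ Jf G L u)).card < w ^ s := by
  apply C.small
  intro T hT hTc hTs
  have hT' : ∀ t ∈ T, t ∈ M ∧ G.Adj v' t ∧ ¬ G.Adj v t ∧ Anti G (L j) t := by
    intro t ht
    have := Finset.mem_filter.1 (hT ht)
    rwa [mem_Jf] at this
  rw [mem_Jf] at hj'
  obtain ⟨S, hS, hSc, hSs⟩ := C.stable_in _ (C.few_card (C.few_of hM hv hj))
  have hS' : ∀ y ∈ S, y ∈ L j ∧ G.Adj v y := fun y hy => Finset.mem_filter.1 (hS hy)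
  refine C.noH v' v T S hadj.symm hTc hSc ?_ ?_ hTs hSs ?_
  · intro t ht
    refine ⟨(hT' t ht).2.1, (hT' t ht).2.2.1, ?_⟩
    rintro rfl
    exact hj (mem_Jf.2 (hT' t ht).2.2.2)
  · intro y hy
    exact ⟨(hS' y hy).2, hj' y (hS' y hy).1, (ne_of_M hM hv' (hS' y hy).1).symm⟩
  · intro t ht y hy
    exact (hT' t ht).2.2.2 y (hS' y hy).1

lemma few_common (C : Ctx G s w k L0 L) (P : Finset V) (i : Fin k)
    (h : ∀ p ∈ P, Few G s w (L i) p) (hP : P.card < 7 * w ^ 3) :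
    4 * w ^ (s+5) ≤ ((L i).filter (fun x => ∀ p ∈ P, G.Adj p x)).card := by
  have h1 := card_common G (L i) P (w^(s+2)/7) (by
    intro p hp
    have := h p hp
    unfold Few at this
    omega)
  have h2 : 7 * (w^(s+2)/7) ≤ w^(s+2) := Nat.mul_div_le _ _
  have h3 : P.card * (w^(s+2)/7) ≤ w^(s+5) := by
    calc P.card * (w^(s+2)/7) ≤ (7 * w^3) * (w^(s+2)/7) := Nat.mul_le_mul_right _ hP.le
      _ = w^3 * (7 * (w^(s+2)/7)) := by ring
      _ ≤ w^3 * w^(s+2) := Nat.mul_le_mul_left _ h2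
      _ = w^(s+5) := by ring
  have := C.O1 i
  omega

lemma factC (C : Ctx G s w k L0 L) {M : Finset V} (hM : PureSet G s w L0 L M) {j j' : Fin k}
    (hjj : j ≠ j') (T T' : Finset V) (hTM : T ⊆ M) (hTM' : T' ⊆ M) (cT : T.card = s)
    (cT' : T'.card = s)
    (hT : ∀ t ∈ T, j ∈ Jf G L t ∧ j' ∉ Jf G L t) (hT' : ∀ t ∈ T', j' ∈ Jf G L t ∧ j ∉ Jf G L t)
    (hTs : ∀ x ∈ T, ∀ y ∈ T, ¬ G.Adj x y) (hTs' : ∀ x ∈ T', ∀ y ∈ T', ¬ G.Adj x y)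
    (hTT : ∀ x ∈ T, ∀ y ∈ T', ¬ G.Adj x y) : False := by
  have hw3 := C.hw3
  have h1 := C.few_common T j' (fun p hp => C.few_of hM (hTM hp) (hT p hp).2) (by omega)
  have h2 := C.few_common T' j (fun p hp => C.few_of hM (hTM' hp) (hT' p hp).2) (by omega)
  have pp := C.pos (s+5)
  obtain ⟨x, hx⟩ := Finset.card_pos.1 (show 0 < ((L j').filter
      (fun x => ∀ p ∈ T, G.Adj p x)).card by omega)
  obtain ⟨hxL, hxT⟩ := Finset.mem_filter.1 hx
  have h3 := C.tmp.far j' j hjj.symm x hxL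
  have p3 : 200 * w^(s+3) ≤ w^(s+4) := C.pw (s+3)
  have p4 : 200 * w^(s+4) ≤ w^(s+5) := C.pw (s+4)
  obtain ⟨y, hy, hxy⟩ : ∃ y ∈ (L j).filter (fun x => ∀ p ∈ T', G.Adj p x), G.Adj x y := by
    by_contra hcon
    push Not at hcon
    have : (L j).filter (fun x => ∀ p ∈ T', G.Adj p x) ⊆ nn G x (L j) := by
      intro y hy
      exact mem_nn.2 ⟨(Finset.mem_filter.1 hy).1, hcon y hy⟩
    have := Finset.card_le_card this
    omega
  obtain ⟨hyL, hyT⟩ := Finset.mem_filter.1 hy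
  refine C.noH x y T T' hxy cT cT' ?_ ?_ hTs hTs' hTT
  · intro t ht
    exact ⟨(hxT t ht).symm, fun h => mem_Jf.1 (hT t ht).1 y hyL h.symm, ne_of_M hM (hTM ht) hyL⟩
  · intro t ht
    exact ⟨(hyT t ht).symm, fun h => mem_Jf.1 (hT' t ht).1 x hxL h.symm, ne_of_M hM (hTM' ht) hxL⟩

end Ctx

/-- Non-neighbours of `b` across a pair of indices. -/
noncomputable def Vb {V : Type*} (G : SimpleGraph V) {k : ℕ} (L : Fin k → Finset V)
    (M : Finset V) (j j' : Fin k) (b : V) : Finset V :=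
  M.filter (fun a => j ∈ Jf G L a ∧ j' ∉ Jf G L a ∧ ¬ G.Adj b a)

lemma mem_Vb {V : Type*} {G : SimpleGraph V} {k : ℕ} {L : Fin k → Finset V}
    {M : Finset V} {j j' : Fin k} {b a : V} : a ∈ Vb G L M j j' b ↔
    a ∈ M ∧ j ∈ Jf G L a ∧ j' ∉ Jf G L a ∧ ¬ G.Adj b a := by
  simp [Vb]

/-- Bad vertices for a pair. -/
noncomputable def Bad {V : Type*} (G : SimpleGraph V) (s w : ℕ) {k : ℕ} (L : Fin k → Finset V)
    (M : Finset V) (j j' : Fin k) : Finset V :=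
  M.filter (fun b => j' ∈ Jf G L b ∧ j ∉ Jf G L b ∧
    (s^2+s+1) * w ^ s ≤ (Vb G L M j j' b).card)

namespace Ctx
variable {V : Type*} {G : SimpleGraph V} {s w k : ℕ} {L0 : Finset V} {L : Fin k → Finset V}

lemma bad_col (C : Ctx G s w k L0 L) {M : Finset V} (hM : PureSet G s w L0 L M) (j j' : Fin k) :
    PCol G.Adj (Bad G s w L M j j') (2 * w ^ s + 1) := by
  have hBm : ∀ b ∈ Bad G s w L M j j', b ∈ M ∧ j' ∈ Jf G L b ∧ j ∉ Jf G L b ∧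
    (s^2+s+1) * w ^ s ≤ (Vb G L M j j' b).card := fun b hb => Finset.mem_filter.1 hb
  apply PCol.of_orient (fun u v h => SimpleGraph.Adj.symm h)
    (fun b b' => (Vb G L M j j' b \ Vb G L M j j' b').card ≤ (s+1) * w^s)
  · intro b hb b' hb' hne hadj
    by_contra hcon
    push Not at hcon
    obtain ⟨c1, c2⟩ := hcon
    obtain ⟨hbM, hb1, hb2, _⟩ := hBm b hb
    obtain ⟨hbM', hb1', hb2', _⟩ := hBm b' hb'
    have e1 : (s+1) * w^s = s * w^s + w^s := by ring
    obtain ⟨T, hT, hTc, hTs⟩ := C.stable_in (Vb G L M j j' b \ Vb G L M j j' b') (by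
      have := Nat.zero_le (s * w^s); omega)
    have hT' : ∀ t ∈ T, t ∈ M ∧ j ∈ Jf G L t ∧ ¬ G.Adj b t ∧ G.Adj b' t := by
      intro t ht
      have := Finset.mem_sdiff.1 (hT ht)
      rw [mem_Vb, mem_Vb] at this
      tauto
    -- remove the neighbours of T
    set Z := (Vb G L M j j' b' \ Vb G L M j j' b) with hZ
    have hZ' : ∀ t ∈ Z, t ∈ M ∧ j ∈ Jf G L t ∧ ¬ G.Adj b' t ∧ G.Adj b t := by
      intro t ht
      have := Finset.mem_sdiff.1 ht
      rw [mem_Vb, mem_Vb] at this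
      tauto
    have hcov : Z ⊆ Z.filter (fun z => ∀ t ∈ T, ¬ G.Adj t z) ∪
        T.biUnion (fun t => M.filter (fun u => G.Adj t u ∧ ¬ G.Adj b' u ∧ j ∈ Jf G L u)) := by
      intro z hz
      have := hZ' z hz
      simp only [Finset.mem_union, Finset.mem_filter, Finset.mem_biUnion]
      by_cases hh : ∀ t ∈ T, ¬ G.Adj t z
      · exact Or.inl ⟨hz, hh⟩
      · push Not at hh
        obtain ⟨t, ht, htz⟩ := hh
        exact Or.inr ⟨t, ht, this.1, htz, this.2.2.1, this.2.1⟩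
    have hb3 := Finset.card_biUnion_le_card_mul T
      (fun t => M.filter (fun u => G.Adj t u ∧ ¬ G.Adj b' u ∧ j ∈ Jf G L u)) (w^s) (by
        intro t ht
        exact (C.factB hM hbM' (hT' t ht).1 (hT' t ht).2.2.2 hb2' (hT' t ht).2.1).le)
    have hb4 := (Finset.card_le_card hcov).trans (Finset.card_union_le _ _)
    rw [hTc] at hb3
    obtain ⟨S, hS, hSc, hSs⟩ := C.stable_in (Z.filter (fun z => ∀ t ∈ T, ¬ G.Adj t z)) (by omega)
    have hS' : ∀ z ∈ S, z ∈ Z ∧ ∀ t ∈ T, ¬ G.Adj t z := fun z hz => Finset.mem_filter.1 (hS hz)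
    refine C.noH b b' S T hadj hSc hTc ?_ ?_ hSs hTs ?_
    · intro z hz
      have := hZ' z (hS' z hz).1
      refine ⟨this.2.2.2, this.2.2.1, ?_⟩
      rintro rfl
      exact hb2' this.2.1
    · intro t ht
      have := hT' t ht
      refine ⟨this.2.2.2, this.2.2.1, ?_⟩
      rintro rfl
      exact hb2 this.2.1
    · intro z hz t ht h
      exact (hS' z hz).2 t ht h.symm
  · intro b hb
    obtain ⟨hbM, hb1, hb2, hb3⟩ := hBm b hb
    apply le_of_lt
    refine lt_of_eq_of_lt ?_ (C.small ((Bad G s w L M j j').filter (fun b' => b' ≠ b ∧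
      (G.Adj b b' ∧ (Vb G L M j j' b \ Vb G L M j j' b').card ≤ (s+1) * w^s))) ?_)
    · congr 1
      ext x
      simp only [Finset.mem_filter]
    intro T' hT' hTc' hTs'
    have hT'' : ∀ t ∈ T', t ∈ Bad G s w L M j j' ∧
        (Vb G L M j j' b \ Vb G L M j j' t).card ≤ (s+1) * w^s := by
      intro t ht
      have := Finset.mem_filter.1 (hT' ht)
      tauto
    set Y := Vb G L M j j' b with hY
    have hcov : Y ⊆ Y.filter (fun z => ∀ t ∈ T', ¬ G.Adj t z) ∪
        T'.biUnion (fun t => Y \ Vb G L M j j' t) := by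
      intro z hz
      simp only [Finset.mem_union, Finset.mem_filter, Finset.mem_biUnion, Finset.mem_sdiff]
      by_cases hh : ∀ t ∈ T', ¬ G.Adj t z
      · exact Or.inl ⟨hz, hh⟩
      · push Not at hh
        obtain ⟨t, ht, htz⟩ := hh
        refine Or.inr ⟨t, ht, hz, ?_⟩
        rw [mem_Vb]; tauto
    have h3 := Finset.card_biUnion_le_card_mul T' (fun t => Y \ Vb G L M j j' t)
      ((s+1) * w^s) (fun t ht => (hT'' t ht).2)
    have h4 := (Finset.card_le_card hcov).trans (Finset.card_union_le _ _)
    rw [hTc'] at h3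
    have e1 : (s^2+s+1) * w^s = s * ((s+1) * w^s) + w^s := by ring
    obtain ⟨T, hT, hTc, hTs⟩ := C.stable_in (Y.filter (fun z => ∀ t ∈ T', ¬ G.Adj t z)) (by omega)
    have hTY : ∀ t ∈ T, t ∈ Y ∧ ∀ t' ∈ T', ¬ G.Adj t' t := fun t ht => Finset.mem_filter.1 (hT ht)
    have hjj : j ≠ j' := by rintro rfl; exact hb2 hb1
    refine C.factC hM hjj T T' (fun t ht => (mem_Vb.1 (hTY t ht).1).1)
      (fun t ht => (hBm t (hT'' t ht).1).1) hTc hTc' ?_ ?_ hTs hTs' ?_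
    · intro t ht
      have := mem_Vb.1 (hTY t ht).1
      exact ⟨this.2.1, this.2.2.1⟩
    · intro t ht
      have := hBm t (hT'' t ht).1
      exact ⟨this.2.1, this.2.2.1⟩
    · intro t ht t' ht' h
      exact (hTY t ht).2 t' ht' h.symm

end Ctx

/-- Every vertex of `X` has many neighbours in `X` of the same type. -/
def Thick {V : Type*} (G : SimpleGraph V) {k : ℕ} (L : Fin k → Finset V) (q : ℕ)
    (X : Finset V) : Prop :=
  ∀ v ∈ X, q ≤ (X.filter (fun u => u ≠ v ∧ (G.Adj v u ∧ Jf G L v = Jf G L u))).card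

namespace Ctx
variable {V : Type*} {G : SimpleGraph V} {s w k : ℕ} {L0 : Finset V} {L : Fin k → Finset V}

lemma thin_col (C : Ctx G s w k L0 L) {M : Finset V} (hM : PureSet G s w L0 L M) (q : ℕ)
    (M1 : Finset V) (hM1 : M1 ⊆ M) :
    ∃ M2 ⊆ M1, Thick G L q M2 ∧
      PCol G.Adj (M1 \ M2) (k * (q * (2 * (k * w ^ s) + 1))) := by
  obtain ⟨M2, hM2, hmax⟩ := Finset.exists_max_image
    (M1.powerset.filter (fun X : Finset V => Thick G L q X)) Finset.card
    ⟨∅, by simp [Thick]⟩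
  simp only [Finset.mem_filter, Finset.mem_powerset] at hM2 hmax
  refine ⟨M2, hM2.1, hM2.2, ?_⟩
  have hcol1 : PCol (fun u v => G.Adj u v ∧ Jf G L u = Jf G L v) (M1 \ M2) q := by
    apply PCol.of_degen (fun u v h => ⟨h.1.symm, h.2.symm⟩)
    intro Y hY hne
    by_contra hcon
    push Not at hcon
    have hYM : Y ⊆ M1 := hY.trans Finset.sdiff_subset
    have h1 := hmax (M2 ∪ Y) ⟨Finset.union_subset hM2.1 hYM, by
      intro v hv
      rcases Finset.mem_union.1 hv with hv | hv
      · exact (hM2.2 v hv).trans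
          (Finset.card_le_card (Finset.filter_subset_filter _ Finset.subset_union_left))
      · refine (hcon v hv).trans (Finset.card_le_card ?_)
        intro x hx
        simp only [Finset.mem_filter, Finset.mem_union] at hx ⊢
        tauto⟩
    have hd : Disjoint M2 Y := by
      rw [Finset.disjoint_left]
      intro a ha hb
      exact (Finset.mem_sdiff.1 (hY hb)).2 ha
    rw [Finset.card_union_of_disjoint hd] at h1
    have := Finset.card_pos.2 hne
    omega
  have hsub : M1 \ M2 ⊆ Finset.univ.biUnion
      (fun j : Fin k => (M1 \ M2).filter (fun v => j ∈ Jf G L v)) := by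
    intro v hv
    obtain ⟨j, hj⟩ := (hM v (hM1 (Finset.mem_sdiff.1 hv).1)).2.2.1
    simp only [Finset.mem_biUnion, Finset.mem_filter, Finset.mem_univ, true_and]
    exact ⟨j, hv, mem_Jf.2 hj⟩
  have key := PCol.biUnion (E := G.Adj) (Finset.univ : Finset (Fin k))
    (fun j : Fin k => (M1 \ M2).filter (fun v => j ∈ Jf G L v))
    (r := q * (2 * (k * w ^ s) + 1)) ?_
  · exact key.mono hsub (by simp)
  intro j _
  refine PCol.prod (E₁ := fun u v => G.Adj u v ∧ Jf G L u = Jf G L v)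
    (E₂ := fun u v => G.Adj u v ∧ Jf G L u ≠ Jf G L v)
    (hcol1.mono (Finset.filter_subset _ _) le_rfl) ?_ ?_
  · apply PCol.of_orient (fun u v h => ⟨h.1.symm, h.2.symm⟩)
      (fun u v => ∃ i, i ∈ Jf G L v ∧ i ∉ Jf G L u)
    · intro u _ v _ _ h
      by_contra hcon
      push Not at hcon
      exact h.2 (Finset.Subset.antisymm hcon.2 hcon.1)
    · intro u hu
      obtain ⟨hu1, hu2⟩ := Finset.mem_filter.1 hu
      have huM := hM1 (Finset.mem_sdiff.1 hu1).1
      have hcov : (((M1 \ M2).filter (fun v => j ∈ Jf G L v)).filter (fun v => v ≠ u ∧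
          (G.Adj u v ∧ Jf G L u ≠ Jf G L v) ∧ ∃ i, i ∈ Jf G L v ∧ i ∉ Jf G L u)) ⊆
          ((Finset.univ : Finset (Fin k)).filter (fun i => i ∉ Jf G L u)).biUnion
          (fun i => M.filter (fun v' => G.Adj u v' ∧ i ∈ Jf G L v' ∧ j ∈ Jf G L v')) := by
        intro v hv
        obtain ⟨hv1, hv2, hv3, i, hi1, hi2⟩ := Finset.mem_filter.1 hv
        obtain ⟨hv4, hv5⟩ := Finset.mem_filter.1 hv1
        refine Finset.mem_biUnion.2 ⟨i, by simpa using hi2, Finset.mem_filter.2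
          ⟨hM1 (Finset.mem_sdiff.1 hv4).1, hv3.1, hi1, hv5⟩⟩
      have h1 := Finset.card_biUnion_le_card_mul
        ((Finset.univ : Finset (Fin k)).filter (fun i => i ∉ Jf G L u))
          (fun i => M.filter (fun v' => G.Adj u v' ∧ i ∈ Jf G L v' ∧ j ∈ Jf G L v')) (w^s) (by
          intro i hi
          exact (C.factA hM huM (Finset.mem_filter.1 hi).2 hu2).le)
      refine (Finset.card_le_card (fun v hv => hcov (by
        simp only [Finset.mem_filter] at hv ⊢
        exact hv))).trans (h1.trans (Nat.mul_le_mul_right _ ?_))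
      exact (Finset.card_le_univ _).trans (by simp)
  · intro u _ v _ h
    by_cases hJ : Jf G L u = Jf G L v
    · exact Or.inl ⟨h, hJ⟩
    · exact Or.inr ⟨h, hJ⟩

lemma adj_J_aux (C : Ctx G s w k L0 L) {M : Finset V} (hM : PureSet G s w L0 L M) {q : ℕ}
    (hq : 2 * w ^ s ≤ q) {M2 : Finset V} (hM2 : M2 ⊆ M) (hth : Thick G L q M2) {u v : V}
    (hu : u ∈ M2) (hv : v ∈ M2) (huv : G.Adj u v) {i j : Fin k} (hj : j ∈ Jf G L u)
    (hj' : j ∈ Jf G L v) (hi : i ∈ Jf G L v) (hi' : i ∉ Jf G L u) : False := by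
  have h1 := C.factA hM (hM2 hu) hi' hj
  have h2 := C.factB hM (hM2 hu) (hM2 hv) huv hi' hi
  have h3 := hth v hv
  have h4 : M2.filter (fun x => x ≠ v ∧ (G.Adj v x ∧ Jf G L v = Jf G L x)) ⊆
      M.filter (fun v' => G.Adj u v' ∧ i ∈ Jf G L v' ∧ j ∈ Jf G L v') ∪
      M.filter (fun x => G.Adj v x ∧ ¬ G.Adj u x ∧ i ∈ Jf G L x) := by
    intro x hx
    obtain ⟨hx1, hx2, hx3, hx4⟩ := Finset.mem_filter.1 hx
    rw [hx4] at hi hj'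
    simp only [Finset.mem_union, Finset.mem_filter]
    have := hM2 hx1
    tauto
  have h5 := (Finset.card_le_card h4).trans (Finset.card_union_le _ _)
  omega

lemma adj_J (C : Ctx G s w k L0 L) {M : Finset V} (hM : PureSet G s w L0 L M) {q : ℕ}
    (hq : 2 * w ^ s ≤ q) {M2 : Finset V} (hM2 : M2 ⊆ M) (hth : Thick G L q M2) {u v : V}
    (hu : u ∈ M2) (hv : v ∈ M2) (huv : G.Adj u v) {j : Fin k} (hj : j ∈ Jf G L u)
    (hj' : j ∈ Jf G L v) : Jf G L u = Jf G L v := by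
  apply Finset.Subset.antisymm
  · intro i hi
    by_contra hcon
    exact C.adj_J_aux hM hq hM2 hth hv hu huv.symm hj' hj hi hcon
  · intro i hi
    by_contra hcon
    exact C.adj_J_aux hM hq hM2 hth hu hv huv hj hj' hi hcon

lemma no_cross (C : Ctx G s w k L0 L) {M : Finset V} (hM : PureSet G s w L0 L M) {q : ℕ}
    (hq : 2 * w ^ s ≤ q) (hq' : (s^2+s+1) * w ^ s ≤ q)
    {M2 : Finset V} (hM2 : M2 ⊆ M) (hth : Thick G L q M2)
    (hgood : ∀ b ∈ M2, ∀ j j', j' ∈ Jf G L b → j ∉ Jf G L b →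
      (Vb G L M j j' b).card < (s^2+s+1) * w ^ s)
    {u v : V} (hu : u ∈ M2) (hv : v ∈ M2) {i j j' : Fin k} (hj' : j' ∈ Jf G L u)
    (hj'' : j' ∉ Jf G L v) (hj : j ∈ Jf G L v) (hjn : j ∉ Jf G L u) (hi : i ∈ Jf G L u)
    (hi' : i ∈ Jf G L v) : False := by
  have h1 := hgood u hu j j' hj' hjn
  have h2 := hth v hv
  have h3 : M2.filter (fun x => x ≠ v ∧ (G.Adj v x ∧ Jf G L v = Jf G L x)) ⊆ Vb G L M j j' u := by
    intro x hx
    obtain ⟨hx1, hx2, hx3, hx4⟩ := Finset.mem_filter.1 hx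
    rw [hx4] at hj hj'' hi'
    rw [mem_Vb]
    refine ⟨hM2 hx1, hj, hj'', ?_⟩
    intro hadj
    have := C.adj_J hM hq hM2 hth hu hx1 hadj hi hi'
    rw [this] at hj'
    exact hj'' hj'
  have := Finset.card_le_card h3
  omega

lemma pure_decomp (C : Ctx G s w k L0 L) {M : Finset V} (hM : PureSet G s w L0 L M) (m : ℕ)
    (hm : m = (s^2+s+1) * w ^ s) :
    ∃ (R D1 D2 : Finset V) (p : ℕ), M ⊆ R ∪ (D1 ∪ D2) ∧
      PCol G.Adj R (k * k * (2 * w ^ s + 1) +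
        k * ((m + 2 * w^s) * (2 * (k * w ^ s) + 1)) + w * (k * m)) ∧
      1 ≤ p ∧ p + 1 ≤ w ∧
      (∀ K ⊆ D1, G.IsClique (K : Set V) → K.card ≤ p) ∧
      (∀ K ⊆ D2, G.IsClique (K : Set V) → K.card + p ≤ w) := by
  set q := m + 2 * w^s with hq
  let BB := (Finset.univ : Finset (Fin k × Fin k)).biUnion (fun jj => Bad G s w L M jj.1 jj.2)
  have hBB : PCol G.Adj BB (k * k * (2 * w^s + 1)) := by
    have := PCol.biUnion (E := G.Adj) (Finset.univ : Finset (Fin k × Fin k))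
      (fun jj => Bad G s w L M jj.1 jj.2) (fun jj _ => C.bad_col hM jj.1 jj.2)
    simpa using this
  obtain ⟨M2, hM21, hth, hthin⟩ := C.thin_col hM q (M \ BB) Finset.sdiff_subset
  have hM2 : M2 ⊆ M := hM21.trans Finset.sdiff_subset
  have hgood : ∀ b ∈ M2, ∀ j j', j' ∈ Jf G L b → j ∉ Jf G L b →
      (Vb G L M j j' b).card < m := by
    intro b hb j j' h1 h2
    by_contra hcon
    have := (Finset.mem_sdiff.1 (hM21 hb)).2
    apply this
    simp only [BB, Finset.mem_biUnion, Finset.mem_univ, true_and]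
    refine ⟨(j, j'), Finset.mem_filter.2 ⟨hM2 hb, h1, h2, ?_⟩⟩
    rw [← hm]; exact not_lt.1 hcon
  have hgood' := hgood
  rw [hm] at hgood'
  have hw := C.hw
  have hk := C.L0k
  have hR := hBB.union hthin
  by_cases hne : M2.Nonempty
  swap
  · rw [Finset.not_nonempty_iff_eq_empty] at hne
    subst hne
    refine ⟨BB ∪ (M \ BB) \ ∅, ∅, ∅, 1, ?_, hR.mono le_rfl (by omega), le_rfl, by omega, ?_, ?_⟩
    · intro v hv
      simp only [Finset.mem_union, Finset.mem_sdiff]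
      tauto
    · intro K hK _
      rw [Finset.subset_empty.1 hK]; simp
    · intro K hK _
      rw [Finset.subset_empty.1 hK]; simp; omega
  obtain ⟨v1, hv1, hmax⟩ := Finset.exists_max_image M2 (fun v => (Jf G L v).card) hne
  set D1 := M2.filter (fun v => Jf G L v ⊆ Jf G L v1) with hD1
  set D2 := M2.filter (fun v => Disjoint (Jf G L v) (Jf G L v1)) with hD2
  have hD1m : ∀ v ∈ D1, v ∈ M2 ∧ Jf G L v ⊆ Jf G L v1 := fun v hv => Finset.mem_filter.1 hv
  have hD2m : ∀ v ∈ D2, v ∈ M2 ∧ Disjoint (Jf G L v) (Jf G L v1) :=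
    fun v hv => Finset.mem_filter.1 hv
  have hcov : ∀ v ∈ M2, v ∈ D1 ∨ v ∈ D2 := by
    intro v hv
    by_contra hcon
    simp only [D1, D2, Finset.mem_filter, hv, true_and, not_or] at hcon
    obtain ⟨c1, c2⟩ := hcon
    rw [Finset.not_subset] at c1
    obtain ⟨j', hj', hj''⟩ := c1
    rw [Finset.not_disjoint_iff] at c2
    obtain ⟨i, hi, hi'⟩ := c2
    by_cases hsub : Jf G L v1 ⊆ Jf G L v
    · have h1 := hmax v hv
      have h2 := Finset.eq_of_subset_of_card_le hsub h1
      rw [h2] at hj''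
      exact hj'' hj'
    · rw [Finset.not_subset] at hsub
      obtain ⟨j, hj, hjn⟩ := hsub
      exact C.no_cross hM (by omega) (by omega) hM2 hth hgood' hv hv1 hj' hj'' hj hjn hi hi'
  obtain ⟨P, hP, hPmax⟩ := Finset.exists_max_image
    (D1.powerset.filter (fun K : Finset V => G.IsClique (K : Set V))) Finset.card
    ⟨∅, by simp⟩
  simp only [Finset.mem_filter, Finset.mem_powerset] at hP hPmax
  have hv1D : v1 ∈ D1 := Finset.mem_filter.2 ⟨hv1, le_rfl⟩
  have hP1 : 1 ≤ P.card := by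
    have := hPmax {v1} ⟨by simpa using hv1D, by simp⟩
    simpa using this
  have hPw : P.card + 1 ≤ w := by
    obtain ⟨i, hi⟩ := (hM v1 (hM2 hv1)).2.2.2
    rw [← mem_Jf] at hi
    have hPc := C.clq P hP.2
    have h1 := C.few_common P i (fun p hp => C.few_of hM (hM2 (hD1m p (hP.1 hp)).1)
      (fun h => hi ((hD1m p (hP.1 hp)).2 h))) (by have := C.hw3; omega)
    have pp := C.pos (s+5)
    obtain ⟨x, hx⟩ := Finset.card_pos.1 (show 0 < ((L i).filter
      (fun x => ∀ p ∈ P, G.Adj p x)).card by omega)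
    obtain ⟨hxL, hxP⟩ := Finset.mem_filter.1 hx
    have hxn : x ∉ P := fun h => (hxP x h).ne rfl
    rw [← Finset.card_insert_of_notMem hxn]
    apply C.clq
    rw [Finset.coe_insert, SimpleGraph.isClique_insert]
    exact ⟨hP.2, fun b hb _ => (hxP b hb).symm⟩
  let X := D2.filter (fun u => ∃ v ∈ P, ¬ G.Adj v u)
  have hX : X.card ≤ w * (k * m) := by
    have hXs : X ⊆ P.biUnion (fun v => D2.filter (fun u => ¬ G.Adj v u)) := by
      intro u hu
      obtain ⟨h1, v, hv, h2⟩ := Finset.mem_filter.1 hu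
      exact Finset.mem_biUnion.2 ⟨v, hv, Finset.mem_filter.2 ⟨h1, h2⟩⟩
    have h1 := Finset.card_biUnion_le_card_mul P
      (fun v => D2.filter (fun u => ¬ G.Adj v u)) (k * m) (by
      intro v hv
      obtain ⟨hvM, hvJ⟩ := hD1m v (hP.1 hv)
      obtain ⟨j', hj'⟩ := (hM v (hM2 hvM)).2.2.1
      rw [← mem_Jf] at hj'
      have hs2 : D2.filter (fun u => ¬ G.Adj v u) ⊆
          ((Finset.univ : Finset (Fin k)).filter (fun j => j ∉ Jf G L v)).biUnion
            (fun j => Vb G L M j j' v) := by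
        intro u hu
        obtain ⟨hu1, hu2⟩ := Finset.mem_filter.1 hu
        obtain ⟨hu3, hu4⟩ := hD2m u hu1
        obtain ⟨j, hj⟩ := (hM u (hM2 hu3)).2.2.1
        rw [← mem_Jf] at hj
        have hd := Finset.disjoint_left.1 hu4
        refine Finset.mem_biUnion.2 ⟨j, ?_, mem_Vb.2 ⟨hM2 hu3, hj, ?_, hu2⟩⟩
        · simp only [Finset.mem_filter, Finset.mem_univ, true_and]
          exact fun h => hd hj (hvJ h)
        · exact fun h => hd h (hvJ hj')
      have h2 := Finset.card_biUnion_le_card_mul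
        ((Finset.univ : Finset (Fin k)).filter (fun j => j ∉ Jf G L v))
        (fun j => Vb G L M j j' v) m (by
          intro j hj
          exact (hgood v hvM j j' hj' (Finset.mem_filter.1 hj).2).le)
      refine (Finset.card_le_card hs2).trans (h2.trans (Nat.mul_le_mul_right _ ?_))
      exact (Finset.card_le_univ _).trans (by simp))
    refine (Finset.card_le_card hXs).trans (h1.trans (Nat.mul_le_mul_right _ (by omega)))
  refine ⟨(BB ∪ (M \ BB) \ M2) ∪ X, D1, D2 \ X, P.card, ?_,
    (hR.union (PCol.card X)).mono le_rfl (by omega), hP1, hPw, ?_, ?_⟩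
  · intro v hv
    have := hcov v
    simp only [Finset.mem_union, Finset.mem_sdiff]
    tauto
  · intro K hK hKc
    exact hPmax K ⟨hK, hKc⟩
  · intro K hK hKc
    have hadj : ∀ a ∈ P, ∀ b ∈ K, G.Adj a b := by
      intro a ha b hb
      by_contra hcon
      have := Finset.mem_sdiff.1 (hK hb)
      exact this.2 (Finset.mem_filter.2 ⟨this.1, a, ha, hcon⟩)
    have hd : Disjoint K P := by
      rw [Finset.disjoint_left]
      intro a ha hb
      exact (hadj a hb a ha).ne rfl
    rw [← Finset.card_union_of_disjoint hd]
    apply C.clq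
    intro a ha b hb hab
    simp only [Finset.coe_union, Set.mem_union, Finset.mem_coe] at ha hb
    rcases ha with ha | ha <;> rcases hb with hb | hb
    · exact hKc ha hb hab
    · exact (hadj b hb a ha).symm
    · exact hadj a ha b hb
    · exact hP.2 ha hb hab

end Ctx
end DS

namespace DS
open scoped Classical

/-- Degeneracy on finsets. -/
def DegF {V : Type*} (G : SimpleGraph V) (d : ℕ) (Y : Finset V) : Prop :=
  ∀ Z ⊆ Y, Z.Nonempty → ∃ v ∈ Z, (Z.filter (fun u => G.Adj v u)).card ≤ d

/-- Degenerate colourings on finsets. -/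
def KDc {V : Type*} (G : SimpleGraph V) (X : Finset V) (r d : ℕ) : Prop :=
  ∃ f : V → ℕ, (∀ v ∈ X, f v < r) ∧ ∀ i, DegF G d (X.filter (fun v => f v = i))

lemma DegF.mono {V : Type*} {G : SimpleGraph V} {d : ℕ} {X Y : Finset V} (h : DegF G d Y)
    (hX : X ⊆ Y) : DegF G d X := fun Z hZ => h Z (hZ.trans hX)

lemma KDc.mono {V : Type*} {G : SimpleGraph V} {d r t : ℕ} {X Y : Finset V} (h : KDc G Y r d)
    (hX : X ⊆ Y) (ht : r ≤ t) : KDc G X t d := by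
  obtain ⟨f, h1, h2⟩ := h
  exact ⟨f, fun v hv => (h1 v (hX hv)).trans_le ht,
    fun i => (h2 i).mono (Finset.filter_subset_filter _ hX)⟩

lemma KDc.union {V : Type*} {G : SimpleGraph V} {d r t : ℕ} {X Y : Finset V} (h : KDc G X r d)
    (h' : KDc G Y t d) : KDc G (X ∪ Y) (r + t) d := by
  obtain ⟨f, h1, h2⟩ := h
  obtain ⟨g, g1, g2⟩ := h'
  refine ⟨fun v => if v ∈ X then f v else r + g v, ?_, ?_⟩
  · intro v hv
    by_cases hX : v ∈ X
    · simp only [hX, if_true]; have := h1 v hX; omega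
    · have := g1 v (by simpa [hX] using hv)
      simp only [hX, if_false]; omega
  · intro i
    by_cases hi : i < r
    · refine (h2 i).mono ?_
      intro v hv
      obtain ⟨hv1, hv2⟩ := Finset.mem_filter.1 hv
      by_cases hX : v ∈ X
      · simp only [hX, if_true] at hv2
        exact Finset.mem_filter.2 ⟨hX, hv2⟩
      · simp only [hX, if_false] at hv2
        omega
    · refine (g2 (i - r)).mono ?_
      intro v hv
      obtain ⟨hv1, hv2⟩ := Finset.mem_filter.1 hv
      by_cases hX : v ∈ X
      · simp only [hX, if_true] at hv2
        have := h1 v hX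
        omega
      · simp only [hX, if_false] at hv2
        refine Finset.mem_filter.2 ⟨(Finset.mem_union.1 hv1).resolve_left hX, by omega⟩

lemma PCol.kdc {V : Type*} {G : SimpleGraph V} {r : ℕ} {X : Finset V} (h : PCol G.Adj X r)
    (d : ℕ) : KDc G X r d := by
  obtain ⟨f, h1, h2⟩ := h
  refine ⟨f, h1, fun i Z hZ ⟨v, hv⟩ => ⟨v, hv, ?_⟩⟩
  rw [Finset.card_eq_zero.2]
  · exact Nat.zero_le _
  · rw [Finset.filter_eq_empty_iff]
    intro u hu hadj
    have a := Finset.mem_filter.1 (hZ hv)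
    have b := Finset.mem_filter.1 (hZ hu)
    exact h2 v a.1 u b.1 hadj.ne hadj (a.2.trans b.2.symm)

lemma free_comap {V W U : Type*} {G : SimpleGraph V} {H : SimpleGraph U} (e : W ↪ V)
    (h : IsInducedFree G H) : IsInducedFree (G.comap e) H := by
  intro S ⟨φ⟩
  apply h (e '' S)
  refine ⟨(RelIso.symm (?_ : (G.comap e).induce S ≃g G.induce (e '' S))).trans φ⟩
  refine ⟨Equiv.Set.image e S e.injective, ?_⟩
  intro a b
  rfl

lemma degF_of {V W : Type*} [Finite W] {G : SimpleGraph V} {H : SimpleGraph W} (e : W → V)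
    (he : Function.Injective e) (hH : ∀ a b, H.Adj a b ↔ G.Adj (e a) (e b)) {d : ℕ}
    (hd : DegeneracyAtMost H d) (Z : Finset V) (hZ : ∀ z ∈ Z, ∃ a, e a = z) : DegF G d Z := by
  intro Y hY hne
  let K : H.Subgraph := (⊤ : H.Subgraph).induce {a | e a ∈ Y}
  obtain ⟨v, hv, hvd⟩ := hd K (by
    obtain ⟨y, hy⟩ := hne
    obtain ⟨a, ha⟩ := hZ y (hY hy)
    exact ⟨a, by simpa [K, ha] using hy⟩)
  have hv' : e v ∈ Y := by simpa [K] using hv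
  refine ⟨e v, hv', ?_⟩
  refine le_trans ?_ hvd
  have h1 : ((Y.filter (fun u => G.Adj (e v) u) : Finset V) : Set V) ⊆ e '' (K.neighborSet v) := by
    intro u hu
    obtain ⟨hu1, hu2⟩ := Finset.mem_filter.1 (Finset.mem_coe.1 hu)
    obtain ⟨a, ha⟩ := hZ u (hY hu1)
    refine ⟨a, ?_, ha⟩
    subst ha
    simp [K, hv', hu1, hH, hu2]
  rw [← Set.ncard_coe_finset]
  refine (Set.ncard_le_ncard h1 (Set.toFinite _)).trans ?_
  exact Set.ncard_image_le (Set.toFinite _)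

lemma deg_of_degF {V W : Type*} [Finite W] {G : SimpleGraph V} {H : SimpleGraph W} (e : W → V)
    (he : Function.Injective e) (hH : ∀ a b, H.Adj a b ↔ G.Adj (e a) (e b)) {d : ℕ} {X : Finset V}
    (hd : DegF G d X) (hX : ∀ a, e a ∈ X) : DegeneracyAtMost H d := by
  intro K hK
  have hfin : (e '' K.verts).Finite := Set.toFinite _
  obtain ⟨v, hv, hvd⟩ := hd hfin.toFinset (by
    intro x hx
    obtain ⟨a, _, rfl⟩ := (Set.Finite.mem_toFinset hfin).1 hx
    exact hX a) (by
    obtain ⟨a, ha⟩ := hK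
    exact ⟨e a, (Set.Finite.mem_toFinset hfin).2 ⟨a, ha, rfl⟩⟩)
  obtain ⟨a, ha, rfl⟩ := (Set.Finite.mem_toFinset hfin).1 hv
  refine ⟨a, ha, ?_⟩
  refine le_trans ?_ hvd
  rw [← Set.ncard_image_of_injective _ he, ← Set.ncard_coe_finset]
  apply Set.ncard_le_ncard _ (Set.toFinite _)
  rintro _ ⟨b, hb, rfl⟩
  simp only [Finset.coe_filter, Set.Finite.mem_toFinset, Set.mem_ofPred_eq]
  exact ⟨⟨b, K.edge_vert (SimpleGraph.Subgraph.Adj.symm hb), rfl⟩, (hH a b).1 (K.adj_sub hb)⟩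

/-- An embedding of `Fin n` with range a given finset. -/
lemma exists_emb {V : Type*} (X : Finset V) : ∃ e : Fin X.card ↪ V, (∀ a, e a ∈ X) ∧
    ∀ x ∈ X, ∃ a, e a = x := by
  refine ⟨X.equivFin.symm.toEmbedding.trans (Function.Embedding.subtype _), ?_, ?_⟩
  · intro a
    simp
  · intro x hx
    exact ⟨X.equivFin ⟨x, hx⟩, by simp⟩

lemma kst_col {V : Type*} {G : SimpleGraph V} {s c : ℕ}
    (hfree : IsInducedFree G (doubleStarGraph s)) (hKST : KSTBound s c) (X : Finset V) (t : ℕ)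
    (hK : ∀ A ⊆ X, ∀ B ⊆ X, A.card = t → B.card = t → Disjoint A B →
      (∀ a ∈ A, ∀ b ∈ B, G.Adj a b) → False) : PCol G.Adj X (t ^ c) := by
  obtain ⟨e, he1, he2⟩ := exists_emb X
  rcases hKST (Fin X.card) (G.comap e) (free_comap e hfree) t with h | ⟨D, hD, h⟩
  · obtain ⟨A, B, cA, cB, hAB, hadj⟩ := h
    exfalso
    refine hK (A.map e) ?_ (B.map e) ?_ (by simpa using cA) (by simpa using cB)
      ((Finset.disjoint_map e).2 hAB) ?_
    · intro x hx
      obtain ⟨a, _, rfl⟩ := Finset.mem_map.1 hx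
      exact he1 a
    · intro x hx
      obtain ⟨a, _, rfl⟩ := Finset.mem_map.1 hx
      exact he1 a
    · intro a ha b hb
      obtain ⟨a', ha', rfl⟩ := Finset.mem_map.1 ha
      obtain ⟨b', hb', rfl⟩ := Finset.mem_map.1 hb
      exact hadj a' ha' b' hb'
  · have hF := degF_of (G := G) e e.injective (fun a b => Iff.rfl) h X he2
    apply PCol.of_degen (fun u v h => SimpleGraph.Adj.symm h)
    intro Y hY hne
    obtain ⟨v, hv, hvd⟩ := hF Y hY hne
    refine ⟨v, hv, lt_of_le_of_lt (le_trans (Finset.card_le_card ?_) hvd) hD⟩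
    intro u hu
    simp only [Finset.mem_filter] at hu ⊢
    tauto

lemma ind_col {V : Type*} {G : SimpleGraph V} {s d D w : ℕ}
    (hfree : IsInducedFree G (doubleStarGraph s))
    (hind : ∀ (W : Type) [Fintype W], ∀ G' : SimpleGraph W,
      IsInducedFree G' (doubleStarGraph s) → G'.cliqueNum < w →
      KDColorable G' (G'.cliqueNum ^ d) D) (X : Finset V) (p : ℕ) (hp : p < w)
    (hX : ∀ K ⊆ X, G.IsClique (K : Set V) → K.card ≤ p) : KDc G X (p ^ d) D := by
  obtain ⟨e, he1, he2⟩ := exists_emb X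
  have hcl : (G.comap e).cliqueNum ≤ p := by
    obtain ⟨K, hK⟩ := (G.comap e).exists_isNClique_cliqueNum
    rw [← hK.card_eq]
    have := hX (K.map e) (by
      intro x hx
      obtain ⟨a, _, rfl⟩ := Finset.mem_map.1 hx
      exact he1 a) (by
      intro x hx y hy hxy
      obtain ⟨a, ha, rfl⟩ := Finset.mem_map.1 (Finset.mem_coe.1 hx)
      obtain ⟨b, hb, rfl⟩ := Finset.mem_map.1 (Finset.mem_coe.1 hy)
      exact hK.isClique ha hb (by rintro rfl; exact hxy rfl))
    simpa using this
  obtain ⟨f, hf⟩ := hind (Fin X.card) (G.comap e) (free_comap e hfree) (hcl.trans_lt hp)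
  choose g hg using he2
  have key : KDc G X ((G.comap e).cliqueNum ^ d) D := by
    refine ⟨fun v => if h : v ∈ X then (f (g v h) : ℕ) else 0, ?_, ?_⟩
    · intro v hv
      simp only [hv, dif_pos]
      exact (f (g v hv)).2
    · intro i
      by_cases hi : i < (G.comap e).cliqueNum ^ d
      · refine degF_of (G := G) (fun a : {v | f v = ⟨i, hi⟩} => e a.1)
          (fun a b h => Subtype.ext (e.injective h)) (fun a b => Iff.rfl) (hf ⟨i, hi⟩) _ ?_
        intro z hz
        obtain ⟨hz1, hz2⟩ := Finset.mem_filter.1 hz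
        simp only [hz1, dif_pos] at hz2
        exact ⟨⟨g z hz1, Fin.ext hz2⟩, hg z hz1⟩
      · intro Z hZ ⟨z, hz⟩
        exfalso
        obtain ⟨hz1, hz2⟩ := Finset.mem_filter.1 (hZ hz)
        simp only [hz1, dif_pos] at hz2
        have := (f (g z hz1)).2
        omega
  exact key.mono le_rfl (Nat.pow_le_pow_left hcl d)

lemma kd_of_kdc {V : Type*} [Fintype V] {G : SimpleGraph V} {S : Set V} {X : Finset V} {r D : ℕ}
    (h : KDc G X r D) (hS : ∀ v ∈ S, v ∈ X) : KDColorable (G.induce S) r D := by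
  obtain ⟨f, h1, h2⟩ := h
  refine ⟨fun v => ⟨f v.1, h1 v.1 (hS v.1 v.2)⟩, fun i => ?_⟩
  refine deg_of_degF (G := G) (fun a => a.1.1)
    (fun a b h => Subtype.ext (Subtype.ext h)) (fun a b => Iff.rfl) (h2 i) ?_
  intro a
  refine Finset.mem_filter.2 ⟨hS _ a.1.2, ?_⟩
  have := a.2
  simp only [Set.mem_ofPred_eq] at this
  exact congrArg Fin.val this

lemma pow_conv (x y : ℕ) : ∀ d, 1 ≤ d → (1+x)^d + (1+y)^d ≤ (1+x+y)^d + 1 := by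
  intro d hd
  induction d, hd using Nat.le_induction with
  | base => simp; omega
  | succ d hd ih =>
    have h1 : (1+x)^d ≤ (1+x+y)^d := Nat.pow_le_pow_left (by omega) d
    have h2 : (1+y)^d ≤ (1+x+y)^d := Nat.pow_le_pow_left (by omega) d
    rw [pow_succ, pow_succ, pow_succ]
    nlinarith [Nat.mul_le_mul_right x h1, Nat.mul_le_mul_right y h2]

end DS

namespace DS
open scoped Classical

lemma budget (w s c k m : ℕ) (hw : 200 ≤ w) (hs : 1 ≤ s) (hw3 : 7 * w + s < 7 * w ^ 3)
    (hk : k ≤ w) (hc : 2 * s ≤ c) (hm : m = (s^2+s+1) * w ^ s) :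
    w^(s+8) + w^(2*s^2+15*s+6) + k * (14 * w^(s+6))^c + (k * k * (2 * w ^ s + 1) +
        k * ((m + 2 * w^s) * (2 * (k * w ^ s) + 1)) + w * (k * m)) + 1 ≤ w^((c+1)*(s+7)) := by
  have hw0 : 0 < w := by omega
  set F := c * (s+7) + s + 6 with hF
  have hE : (c+1)*(s+7) = F + 1 := by rw [hF]; ring
  have hcs : 2 * s * (s+7) ≤ c * (s+7) := Nat.mul_le_mul_right _ hc
  have e1 : 2 * s * (s+7) = 2 * s^2 + 14 * s := by ring
  have hs2 : s ≤ s^2 := by nlinarith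
  have mono : ∀ a, a ≤ F → w^a ≤ w^F := fun a ha => Nat.pow_le_pow_right hw0 ha
  have a1 : w^(s+8) ≤ w^F := mono _ (by omega)
  have a2 : w^(2*s^2+15*s+6) ≤ w^F := mono _ (by omega)
  have a3 : k * (14 * w^(s+6))^c ≤ w^F := by
    have : 14 * w^(s+6) ≤ w^(s+7) := by
      rw [show s + 7 = (s+6)+1 by ring, pow_succ w (s+6), mul_comm]
      exact Nat.mul_le_mul_left _ (by omega)
    calc k * (14 * w^(s+6))^c ≤ w * (w^(s+7))^c :=
          Nat.mul_le_mul hk (Nat.pow_le_pow_left this c)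
      _ = w^(c*(s+7)+1) := by rw [← pow_mul, pow_succ, mul_comm, mul_comm c]
      _ ≤ w^F := mono _ (by omega)
  have hm' : m ≤ w^(s+7) := by
    have h1 : s + 1 ≤ 7 * w^3 := by omega
    have h2 : s^2+s+1 ≤ w^7 := by
      calc s^2+s+1 ≤ (s+1)^2 := by nlinarith
        _ ≤ (7*w^3)^2 := Nat.pow_le_pow_left h1 2
        _ = 49 * w^6 := by ring
        _ ≤ w * w^6 := Nat.mul_le_mul_right _ (by omega)
        _ = w^7 := by ring
    rw [hm]
    calc (s^2+s+1) * w^s ≤ w^7 * w^s := Nat.mul_le_mul_right _ h2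
      _ = w^(s+7) := by ring
  have p0 : 1 ≤ w^s := Nat.pos_of_ne_zero (by positivity)
  have a4 : k * k * (2 * w ^ s + 1) ≤ 3 * w^F := by
    calc k * k * (2 * w ^ s + 1) ≤ w * w * (3 * w^s) :=
          Nat.mul_le_mul (Nat.mul_le_mul hk hk) (by omega)
      _ = 3 * w^(s+2) := by ring
      _ ≤ 3 * w^F := Nat.mul_le_mul_left _ (mono _ (by omega))
  have a5 : k * ((m + 2 * w^s) * (2 * (k * w ^ s) + 1)) ≤ 9 * w^F := by
    have b1 : w^s ≤ w^(s+7) := Nat.pow_le_pow_right hw0 (by omega)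
    have b2 : k * w^s ≤ w^(s+1) := by
      rw [pow_succ, mul_comm]; exact Nat.mul_le_mul_left _ hk
    have b3 : 1 ≤ w^(s+1) := Nat.pos_of_ne_zero (by positivity)
    calc k * ((m + 2 * w^s) * (2 * (k * w ^ s) + 1))
        ≤ w * ((3 * w^(s+7)) * (3 * w^(s+1))) :=
          Nat.mul_le_mul hk (Nat.mul_le_mul (by omega) (by omega))
      _ = 9 * w^(2*s+9) := by ring
      _ ≤ 9 * w^F := Nat.mul_le_mul_left _ (mono _ (by omega))
  have a6 : w * (k * m) ≤ w^F := by
    calc w * (k * m) ≤ w * (w * w^(s+7)) :=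
          Nat.mul_le_mul_left _ (Nat.mul_le_mul hk hm')
      _ = w^(s+9) := by ring
      _ ≤ w^F := mono _ (by omega)
  have a7 : 1 ≤ w^F := Nat.pos_of_ne_zero (by positivity)
  have a8 : 200 * w^F ≤ w^(F+1) := by
    rw [pow_succ, mul_comm]; exact Nat.mul_le_mul_left _ hw
  rw [hE]
  omega

namespace Ctx
variable {V : Type*} {G : SimpleGraph V} {s w k : ℕ} {L0 : Finset V} {L : Fin k → Finset V}

lemma main (C : Ctx G s w k L0 L) (hfree : IsInducedFree G (doubleStarGraph s))
    (d D : ℕ) (hd : 1 ≤ d)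
    (hind : ∀ (W : Type) [Fintype W], ∀ G' : SimpleGraph W,
      IsInducedFree G' (doubleStarGraph s) → G'.cliqueNum < w →
      KDColorable G' (G'.cliqueNum ^ d) D)
    (c : ℕ) (hc : 2 * s ≤ c) (hKST : KSTBound s c)
    (N : Finset V) (hN : Disjoint N (VL L0 L)) (hN' : ∀ v ∈ N, ∃ i, ¬ Anti G (L i) v) :
    KDc G (VL L0 L ∪ N) ((w-1)^d + w^((c+1)*(s+7))) D := by
  have hVL : KDc G (VL L0 L) (w^(s+8)) D :=
    (PCol.kdc (PCol.card (VL L0 L)) D).mono le_rfl C.VL_card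
  have hP : KDc G (N.filter (Pend G s (VL L0 L))) (w^(2*s^2+15*s+6)) D :=
    (PCol.kdc (PCol.card _) D).mono le_rfl (C.pend_card N hN)
  let Q : Fin k → Finset V := fun j => N.filter (fun v => ∀ i, i ≠ j → Few G s w (L i) v)
  have hdis : ∀ A ⊆ N, ∀ i, Disjoint A (L i) := by
    intro A hA i
    rw [Finset.disjoint_left]
    intro a ha hai
    exact Finset.disjoint_left.1 hN (hA ha) (mem_VL.2 (Or.inr ⟨i, hai⟩))
  have hQ : PCol G.Adj (Finset.univ.biUnion Q) (k * (14 * w^(s+6))^c) := by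
    have := PCol.biUnion (E := G.Adj) (Finset.univ : Finset (Fin k)) Q
      (r := (14 * w^(s+6))^c) (by
      intro j _
      apply kst_col hfree hKST
      intro A hA B hB cA cB hAB hadj
      refine C.O4 j A B cA cB hAB hadj (hdis A (hA.trans (Finset.filter_subset _ _)))
        (hdis B (hB.trans (Finset.filter_subset _ _))) ?_ ?_
      · intro v hv i hi
        exact (Finset.mem_filter.1 (hA hv)).2 i hi
      · intro v hv i hi
        exact (Finset.mem_filter.1 (hB hv)).2 i hi)
    simpa using this
  set M := N.filter (fun v => (∀ i, Few G s w (L i) v ∨ Anti G (L i) v) ∧ ∃ i, Anti G (L i) v)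
    with hMdef
  have hM : PureSet G s w L0 L M := by
    intro v hv
    obtain ⟨h1, h2, h3⟩ := Finset.mem_filter.1 hv
    exact ⟨Finset.disjoint_left.1 hN h1, h2, h3, hN' v h1⟩
  obtain ⟨R, D1, D2, p, hcov, hR, hp1, hp2, hD1, hD2⟩ := C.pure_decomp hM _ rfl
  have k1 := ind_col hfree hind D1 p (by omega) hD1
  have k2 := ind_col hfree hind D2 (w - p) (by omega) (by
    intro K hK hcl
    have := hD2 K hK hcl
    omega)
  have key := (((hVL.union hP).union (PCol.kdc hQ D)).union (PCol.kdc hR D)).union (k1.union k2)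
  refine key.mono ?_ ?_
  · intro v hv
    simp only [Finset.mem_union]
    rcases Finset.mem_union.1 hv with hv | hv
    · tauto
    · by_cases hp : Pend G s (VL L0 L) v
      · exact Or.inl (Or.inl (Or.inl (Or.inr (Finset.mem_filter.2 ⟨hv, hp⟩))))
      · rcases C.tricho v hp (hN' v hv) with h | ⟨j, hj⟩
        · have := hcov (Finset.mem_filter.2 ⟨hv, h⟩)
          simp only [Finset.mem_union] at this
          tauto
        · refine Or.inl (Or.inl (Or.inr ?_))
          exact Finset.mem_biUnion.2 ⟨j, Finset.mem_univ _, Finset.mem_filter.2 ⟨hv, hj⟩⟩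
  · have hk := C.L0k
    have hb := budget w s c k _ C.hw C.hs C.hw3 (by omega) hc rfl
    have hp := pow_conv (p-1) (w-p-1) d hd
    rw [show 1 + (p-1) = p by omega, show 1 + (w-p-1) = w - p by omega,
      show p + (w-p-1) = w - 1 by omega] at hp
    omega

end Ctx

lemma toF_card {V : Type*} [Fintype V] (S : Set V) : S.toFinset.card = S.ncard := by
  rw [Set.ncard_eq_toFinset_card']

lemma union_ncard {V : Type*} [Fintype V] {k : ℕ} (L : Fin k → Set V)
    (h : Pairwise fun i j : Fin k => Disjoint (L i) (L j)) :
    (⋃ i, L i).ncard = ∑ i, (L i).toFinset.card := by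
  rw [← toF_card, ← Finset.card_biUnion]
  · congr 1
    ext x
    simp
  · intro i _ j _ hij
    exact Set.disjoint_toFinset.2 (h hij)

lemma val_eq {V : Type*} [Fintype V] (G : SimpleGraph V) (s : ℕ) (L0 : Set V) {k : ℕ}
    (L : Fin k → Set V) (h : IsTemplate G s L0 L) :
    templateValue G s L0 L = val s G.cliqueNum L0.toFinset (fun i => (L i).toFinset) := by
  unfold templateValue val
  rw [union_ncard L h.2.1, toF_card, Finset.sum_add_distrib]
  simp
  ring

lemma ctx_of {V : Type*} [Fintype V] (G : SimpleGraph V) (s : ℕ)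
    (hs : 1 ≤ s) (hfree : IsInducedFree G (doubleStarGraph s))
    (hω : 200 ≤ G.cliqueNum) (hω3 : 7 * G.cliqueNum ^ 3 > 7 * G.cliqueNum + s)
    (L0 : Set V) (k : ℕ) (L : Fin k → Set V) (hT : IsOptimalTemplate G s L0 L) :
    Ctx G s G.cliqueNum k L0.toFinset (fun i => (L i).toFinset) where
  hs := hs
  noH := noHs_of_free G s hfree
  hw := hω
  hw3 := hω3
  clq := by
    intro K hK
    exact hK.card_le_cliqueNum
  tmp := by
    obtain ⟨h1, h2, h3, h4, h5, h6⟩ := hT.1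
    refine ⟨?_, ?_, ?_, ?_, ?_, ?_, ?_⟩
    · intro i; rw [Set.disjoint_toFinset]; exact h1 i
    · intro i j hij; rw [Set.disjoint_toFinset]; exact h2 hij
    · simpa using h3
    · intro u hu i v hv
      exact h4 u (by simpa using hu) i v (by simpa using hv)
    · intro i; rw [toF_card]; exact (h5 i).1
    · intro i; rw [toF_card]; exact (h5 i).2
    · intro i j hij v hv
      have := h6 i j hij v (by simpa using hv)
      rw [← toF_card] at this
      refine le_trans (Finset.card_le_card ?_) this
      intro u hu
      rw [mem_nn] at hu
      simpa using hu
  opt := by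
    intro ι _ L0' L' hT'
    let e := Fintype.equivFin ι
    have hT2 : IsTemplate G s (L0' : Set V) (fun i => ((L' (e.symm i) : Finset V) : Set V)) := by
      refine ⟨?_, ?_, hT'.clq, ?_, ?_, ?_⟩
      · intro i; exact Finset.disjoint_coe.2 (hT'.d0 _)
      · intro i j hij
        have := hT'.dis (e.symm i) (e.symm j) (by simpa using hij)
        exact Finset.disjoint_coe.2 this
      · intro u hu i v hv
        exact hT'.comp u (by simpa using hu) _ v (by simpa using hv)
      · intro i
        rw [Set.ncard_coe_finset]
        exact ⟨hT'.lo _, hT'.hi _⟩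
      · intro i j hij v hv
        have := hT'.far (e.symm i) (e.symm j) (by simpa using hij) v (by simpa using hv)
        rw [← Set.ncard_coe_finset] at this
        refine le_trans (le_of_eq ?_) this
        congr 1
        ext u
        simp [mem_nn]
    have h1 := hT.2 _ _ _ hT2
    rw [val_eq _ _ _ _ hT2, val_eq _ _ _ _ hT.1] at h1
    refine le_trans (le_of_eq ?_) h1
    unfold val
    simp only [Finset.toFinset_coe]
    congr 1
    exact (Equiv.sum_comp e.symm (fun i => (L' i).card + G.cliqueNum^(s+5))).symm

end DS

/-- If every `H_s`-free graph with smaller clique number is `(ω'^d, D)`-colourable and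
`c ≥ 2s` satisfies the Kővári–Sós–Turán-type bound for `H_s` (with `ω ≥ 200` and
`ω³ > ω + s/7`), then `V(𝓛) ∪ N(𝓛)` is `((ω−1)^d + ω^{(c+1)(s+7)}, D)`-colourable. -/
theorem template_nbhd_colourable {V : Type*} [Fintype V] (G : SimpleGraph V) (s : ℕ)
    (hs : 1 ≤ s) (hfree : IsInducedFree G (doubleStarGraph s))
    (hω : 200 ≤ G.cliqueNum) (hω3 : 7 * G.cliqueNum ^ 3 > 7 * G.cliqueNum + s)
    (L0 : Set V) (k : ℕ) (L : Fin k → Set V) (hT : IsOptimalTemplate G s L0 L)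
    (hval : 28 * G.cliqueNum ^ (s+6) ≤ templateValue G s L0 L)
    (d D : ℕ) (hd : 1 ≤ d)
    (hind : ∀ (W : Type) [Fintype W], ∀ G' : SimpleGraph W,
      IsInducedFree G' (doubleStarGraph s) → G'.cliqueNum < G.cliqueNum →
      KDColorable G' (G'.cliqueNum ^ d) D)
    (c : ℕ) (hc : 2 * s ≤ c) (hKST : KSTBound s c) :
    KDColorable (G.induce (templateVerts L0 L ∪ templateNbhd G L0 L))
      ((G.cliqueNum - 1) ^ d + G.cliqueNum ^ ((c+1) * (s+7))) D := by
  classical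
  have C := DS.ctx_of G s hs hfree hω hω3 L0 k L hT
  refine DS.kd_of_kdc (C.main hfree d D hd hind c hc hKST
    (Finset.univ.filter (fun v => v ∈ templateNbhd G L0 L)) ?_ ?_) ?_
  · rw [Finset.disjoint_left]
    intro v hv hv2
    have h1 := (Finset.mem_filter.1 hv).2.1
    apply h1
    rcases DS.Ctx.mem_VL.1 hv2 with h | ⟨i, h⟩
    · exact Or.inl (by simpa using h)
    · exact Or.inr (Set.mem_iUnion.2 ⟨i, by simpa using h⟩)
  · intro v hv
    obtain ⟨i, u, hu, hadj⟩ := (Finset.mem_filter.1 hv).2.2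
    exact ⟨i, fun h => h u (by simpa using hu) hadj⟩
  · intro v hv
    rw [Finset.mem_union]
    rcases hv with hv | hv
    · left
      apply DS.Ctx.mem_VL.2
      rcases hv with h | h
      · exact Or.inl (by simpa using h)
      · obtain ⟨i, h⟩ := Set.mem_iUnion.1 h
        exact Or.inr ⟨i, by simpa using h⟩
    · right
      exact Finset.mem_filter.2 ⟨Finset.mem_univ _, hv⟩
end

section
/- Let s ≥ 1 be an integer, let G be an H_s-free graph with clique number ω satisfying ω ≥ 15 and ω² > s+1, and let 𝓛 = (L_0, L_1, …, L_k) be an optimal s-template in G whose value is at least 28ω^{s+6}. Then every vertex in Y(𝓛) has at most ω^{s+7} neighbours in V(G) ∖ Y(𝓛). -/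
open SimpleGraph Set

section TemplateHelpers

lemma th_ramsey {V : Type*} [Fintype V] (G : SimpleGraph V) (n : ℕ) (hn : 2 ≤ n)
    (hcl : ∀ Q : Finset V, G.IsClique (Q : Set V) → Q.card ≤ n) :
    ∀ (s : ℕ) (A : Finset V), n ^ s ≤ A.card + 1 →
      ∃ S : Finset V, S ⊆ A ∧ S.card = s ∧ IsStableSet G (S : Set V) := by
  classical
  intro s
  induction s with
  | zero => intro A _; exact ⟨∅, by simp, by simp, by simp [IsStableSet]⟩
  | succ s ih =>
    intro A hA
    obtain ⟨Q, hQ, hmax⟩ := Finset.exists_max_image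
      (A.powerset.filter fun Q : Finset V => G.IsClique (Q : Set V)) Finset.card
      ⟨∅, by simp⟩
    simp only [Finset.mem_filter, Finset.mem_powerset] at hQ hmax
    have hcov : A ⊆ Q.biUnion fun q => A.filter fun u => ¬ G.Adj q u := by
      intro u hu
      by_contra hcon
      simp only [Finset.mem_biUnion, Finset.mem_filter, not_exists, not_and, not_not] at hcon
      have hadj : ∀ q ∈ Q, G.Adj q u := fun q hq => hcon q hq hu
      have huQ : u ∉ Q := fun h => G.irrefl (hadj u h)
      have := hmax (insert u Q) ⟨by
        intro x hx
        rcases Finset.mem_insert.1 hx with rfl | hx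
        · exact hu
        · exact hQ.1 hx, by
        rw [Finset.coe_insert, SimpleGraph.isClique_insert]
        exact ⟨hQ.2, fun b hb _ => (hadj b hb).symm⟩⟩
      rw [Finset.card_insert_of_notMem huQ] at this
      omega
    have hq : ∃ q ∈ Q, n ^ s ≤ (A.filter fun u => ¬ G.Adj q u).card := by
      by_contra hcon
      push Not at hcon
      have h1 := (Finset.card_le_card hcov).trans Finset.card_biUnion_le
      have h2 : ∑ q ∈ Q, (A.filter fun u => ¬ G.Adj q u).card ≤ Q.card * (n ^ s - 1) := by
        rw [← smul_eq_mul]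
        apply Finset.sum_le_card_nsmul
        intro q hq
        have := hcon q hq
        omega
      have h3 : Q.card * (n ^ s - 1) ≤ n * (n ^ s - 1) := Nat.mul_le_mul_right _ (hcl Q hQ.2)
      have h4 : 1 ≤ n ^ s := Nat.one_le_pow _ _ (by omega)
      have h5 : n * (n ^ s - 1) + n = n ^ (s+1) := by
        obtain ⟨m, hm⟩ := Nat.exists_eq_add_of_le h4
        rw [pow_succ, hm]; simp; ring
      omega
    obtain ⟨q, hqQ, hq⟩ := hq
    obtain ⟨S, hS, hSc, hSs⟩ := ih ((A.filter fun u => ¬ G.Adj q u).erase q) (by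
      rw [Finset.card_erase_of_mem (by simp [hQ.1 hqQ])]
      omega)
    have hqS : q ∉ S := fun h => by simpa using hS h
    refine ⟨insert q S, ?_, by rw [Finset.card_insert_of_notMem hqS, hSc], ?_⟩
    · intro x hx
      rcases Finset.mem_insert.1 hx with rfl | hx
      · exact hQ.1 hqQ
      · have := hS hx
        simp at this
        exact this.2.1
    · have hn' : ∀ x ∈ S, ¬ G.Adj q x := by
        intro x hx
        have := hS hx
        simp at this
        exact this.2.2
      intro a ha b hb hab
      simp only [Finset.coe_insert, Set.mem_insert_iff, Finset.mem_coe] at ha hb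
      rcases ha with rfl | ha <;> rcases hb with rfl | hb
      · exact absurd rfl hab
      · exact hn' b hb
      · exact fun h => hn' a ha h.symm
      · exact hSs a ha b hb hab

lemma th_doubleStar {V : Type*} (G : SimpleGraph V) (s : ℕ)
    (hs : 1 ≤ s) (hfree : IsInducedFree G (doubleStarGraph s)) (a b : V) (S T : Finset V)
    (hab : G.Adj a b) (hS : S.card = s) (hT : T.card = s)
    (hSs : IsStableSet G (S : Set V)) (hTs : IsStableSet G (T : Set V))
    (haS : ∀ x ∈ S, G.Adj a x) (hbT : ∀ x ∈ T, G.Adj b x)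
    (hbS : ∀ x ∈ S, ¬ G.Adj b x) (haT : ∀ x ∈ T, ¬ G.Adj a x)
    (hST : ∀ x ∈ S, ∀ y ∈ T, ¬ G.Adj x y) (hbS' : b ∉ S) (haT' : a ∉ T) : False := by
  classical
  let eS : Fin s ≃ S := (Fin.castOrderIso hS.symm).toEquiv.trans S.equivFin.symm
  let eT : Fin s ≃ T := (Fin.castOrderIso hT.symm).toEquiv.trans T.equivFin.symm
  have hdisj : ∀ x ∈ S, x ∉ T := fun x hx hx' => haT x hx' (haS x hx)
  let f : Fin (2*s+2) → V := fun i =>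
    if (i : ℕ) = 0 then a else if (i : ℕ) = 1 then b
    else if h : (i : ℕ) - 2 < s then (eS ⟨(i:ℕ) - 2, h⟩ : V)
    else (eT ⟨(i : ℕ) - 2 - s, by have := i.2; omega⟩ : V)
  have f0 : ∀ i : Fin (2*s+2), (i : ℕ) = 0 → f i = a := fun i h => by simp only [f, h, if_true, if_false, one_ne_zero]
  have f1 : ∀ i : Fin (2*s+2), (i : ℕ) = 1 → f i = b := fun i h => by simp only [f, h, if_true, if_false, one_ne_zero]
  have fS : ∀ i : Fin (2*s+2), 2 ≤ (i : ℕ) → (i : ℕ) ≤ s + 1 →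
      ∃ h : (i : ℕ) - 2 < s, f i = (eS ⟨(i:ℕ) - 2, h⟩ : V) := fun i h h' => by
    have h2 : (i : ℕ) - 2 < s := by omega
    refine ⟨h2, ?_⟩
    simp only [f]
    rw [if_neg (by omega), if_neg (by omega), dif_pos h2]
  have fT : ∀ i : Fin (2*s+2), s + 2 ≤ (i : ℕ) →
      ∃ h : (i : ℕ) - 2 - s < s, f i = (eT ⟨(i:ℕ) - 2 - s, h⟩ : V) := fun i h => by
    have h2 : (i : ℕ) - 2 - s < s := by have := i.2; omega
    refine ⟨h2, ?_⟩
    simp only [f]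
    rw [if_neg (by omega), if_neg (by omega), dif_neg (by omega)]
  have cases4 : ∀ i : Fin (2*s+2), ((i : ℕ) = 0 ∧ f i = a) ∨ ((i : ℕ) = 1 ∧ f i = b) ∨
      (2 ≤ (i : ℕ) ∧ (i : ℕ) ≤ s + 1 ∧ f i ∈ S) ∨ (s + 2 ≤ (i : ℕ) ∧ f i ∈ T) := by
    intro i
    have hi := i.2
    rcases (show (i : ℕ) = 0 ∨ (i : ℕ) = 1 ∨ (2 ≤ (i : ℕ) ∧ (i : ℕ) ≤ s + 1) ∨ s + 2 ≤ (i : ℕ) by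
      omega) with h | h | h | h
    · exact Or.inl ⟨h, f0 i h⟩
    · exact Or.inr (Or.inl ⟨h, f1 i h⟩)
    · obtain ⟨_, h'⟩ := fS i h.1 h.2
      exact Or.inr (Or.inr (Or.inl ⟨h.1, h.2, by rw [h']; exact Subtype.prop _⟩))
    · obtain ⟨_, h'⟩ := fT i h
      exact Or.inr (Or.inr (Or.inr ⟨h, by rw [h']; exact Subtype.prop _⟩))
  have haS' : a ∉ S := fun h => G.irrefl (haS a h)
  have hbT' : b ∉ T := fun h => G.irrefl (hbT b h)
  have hne : a ≠ b := hab.ne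
  have finj : Function.Injective f := by
    intro i j hij
    have hi := i.2
    have hj := j.2
    apply Fin.ext
    rcases cases4 i with ⟨h1, h2⟩ | ⟨h1, h2⟩ | ⟨h1, h1', h2⟩ | ⟨h1, h2⟩ <;>
    rcases cases4 j with ⟨h3, h4⟩ | ⟨h3, h4⟩ | ⟨h3, h3', h4⟩ | ⟨h3, h4⟩
    all_goals first
      | omega
      | (exfalso; grind)
      | skip
    · obtain ⟨p, hp⟩ := fS i h1 h1'
      obtain ⟨p', hp'⟩ := fS j h3 h3'
      rw [hp, hp'] at hij
      have := eS.injective (Subtype.ext hij)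
      simp only [Fin.mk.injEq] at this
      omega
    · obtain ⟨p, hp⟩ := fT i h1
      obtain ⟨p', hp'⟩ := fT j h3
      rw [hp, hp'] at hij
      have := eT.injective (Subtype.ext hij)
      simp only [Fin.mk.injEq] at this
      omega
  have fadj : ∀ i j, G.Adj (f i) (f j) ↔ (doubleStarGraph s).Adj i j := by
    intro i j
    by_cases hij : i = j
    · subst hij; simp
    have hfij : f i ≠ f j := fun h => hij (finj h)
    have hij' : (i : ℕ) ≠ j := fun h => hij (Fin.ext h)
    simp only [doubleStarGraph, SimpleGraph.fromRel_adj, ne_eq, hij, not_false_eq_true, true_and]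
    rcases cases4 i with ⟨h1, h2⟩ | ⟨h1, h2⟩ | ⟨h1, h1', h2⟩ | ⟨h1, h2⟩ <;>
    rcases cases4 j with ⟨h3, h4⟩ | ⟨h3, h4⟩ | ⟨h3, h3', h4⟩ | ⟨h3, h4⟩
    · omega
    · exact iff_of_true (h2 ▸ h4 ▸ hab) (by omega)
    · exact iff_of_true (h2 ▸ haS _ h4) (by omega)
    · exact iff_of_false (h2 ▸ haT _ h4) (by omega)
    · exact iff_of_true (h2 ▸ h4 ▸ hab.symm) (by omega)
    · omega
    · exact iff_of_false (h2 ▸ hbS _ h4) (by omega)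
    · exact iff_of_true (h2 ▸ hbT _ h4) (by omega)
    · exact iff_of_true (h4 ▸ (haS _ h2).symm) (by omega)
    · exact iff_of_false (fun h => hbS _ h2 (h4 ▸ h.symm)) (by omega)
    · exact iff_of_false (hSs _ h2 _ h4 hfij) (by omega)
    · exact iff_of_false (hST _ h2 _ h4) (by omega)
    · exact iff_of_false (fun h => haT _ h2 (h4 ▸ h.symm)) (by omega)
    · exact iff_of_true (h4 ▸ (hbT _ h2).symm) (by omega)
    · exact iff_of_false (fun h => hST _ h4 _ h2 h.symm) (by omega)
    · exact iff_of_false (hTs _ h2 _ h4 hfij) (by omega)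
  exact hfree (Set.range f) ⟨(⟨Equiv.ofInjective f finj, fun {i j} => fadj i j⟩ :
    doubleStarGraph s ≃g G.induce (Set.range f)).symm⟩

lemma th_cover {V : Type*} [Fintype V] (G : SimpleGraph V) (A : Set V) (c : ℕ) (K : Finset V)
    (h : ∀ x ∈ K, ({u ∈ A | ¬ G.Adj x u}).ncard ≤ c) :
    ({u ∈ A | ∃ x ∈ K, ¬ G.Adj x u}).ncard ≤ K.card * c := by
  classical
  induction K using Finset.induction_on with
  | empty => simp
  | insert a K ha ih =>
    have h1 : {u ∈ A | ∃ x ∈ insert a K, ¬ G.Adj x u} ⊆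
        {u ∈ A | ¬ G.Adj a u} ∪ {u ∈ A | ∃ x ∈ K, ¬ G.Adj x u} := by
      rintro u ⟨hu, x, hx, hxu⟩
      rcases Finset.mem_insert.1 hx with rfl | hx
      · exact Or.inl ⟨hu, hxu⟩
      · exact Or.inr ⟨hu, x, hx, hxu⟩
    have h2 := (Set.ncard_le_ncard h1 (Set.toFinite _)).trans (Set.ncard_union_le _ _)
    have h3 := ih fun x hx => h x (Finset.mem_insert_of_mem hx)
    have h4 := h a (Finset.mem_insert_self _ _)
    rw [Finset.card_insert_of_notMem ha, Nat.add_mul, one_mul]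
    omega

lemma th_iUnion {V : Type*} [Fintype V] {ι : Type*} [Fintype ι] (L : ι → Set V)
    (h : Pairwise fun i j => Disjoint (L i) (L j)) :
    (⋃ i, L i).ncard = ∑ i, (L i).ncard := by
  classical
  rw [Set.ncard_iUnion_of_finite (fun i => Set.toFinite _) h, finsum_eq_sum_of_fintype]

/-- Optimality against templates indexed by arbitrary finite types. -/
lemma th_opt {V : Type*} [Fintype V] (G : SimpleGraph V) (s : ℕ) (L0 : Set V) {k : ℕ}
    (L : Fin k → Set V) (hT : IsOptimalTemplate G s L0 L) {ι : Type} [Fintype ι]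
    (M0 : Set V) (M : ι → Set V)
    (h1 : ∀ i, Disjoint M0 (M i)) (h2 : Pairwise fun i j => Disjoint (M i) (M j))
    (h3 : G.IsClique M0) (h4 : ∀ u ∈ M0, ∀ i, ∀ v ∈ M i, G.Adj u v)
    (h5 : ∀ i, G.cliqueNum ^ (s+5) ≤ (M i).ncard ∧ (M i).ncard ≤ 14 * G.cliqueNum ^ (s+6))
    (h6 : ∀ i j, i ≠ j → ∀ v ∈ M i, ({u ∈ M j | ¬ G.Adj v u}).ncard ≤ G.cliqueNum ^ (s+3)) :
    ∑ i, (M i).ncard + 7 * G.cliqueNum ^ (s+5) * M0.ncard + Fintype.card ι * G.cliqueNum ^ (s+5)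
      ≤ ∑ i, (L i).ncard + 7 * G.cliqueNum ^ (s+5) * L0.ncard + k * G.cliqueNum ^ (s+5) := by
  classical
  let e := Fintype.equivFin ι
  have := hT.2 (Fintype.card ι) M0 (fun i => M (e.symm i))
    ⟨fun i => h1 _, fun i j hij => h2 (fun h => hij (e.symm.injective h)), h3,
      fun u hu i v hv => h4 u hu _ v hv, fun i => h5 _,
      fun i j hij v hv => h6 _ _ (fun h => hij (e.symm.injective h)) v hv⟩
  unfold templateValue at this
  rw [th_iUnion L hT.1.2.1, th_iUnion (fun i => M (e.symm i))
    (fun i j hij => h2 (fun h => hij (e.symm.injective h)))] at this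
  rwa [Equiv.sum_comp e.symm (fun i => (M i).ncard)] at this

/-- Absorbing a clique `K` into `L0`, deleting the parts indexed by `J`. -/
lemma th_absorb {V : Type*} [Fintype V] (G : SimpleGraph V) (s : ℕ) (L0 : Set V) {k : ℕ}
    (L : Fin k → Set V) (hT : IsOptimalTemplate G s L0 L)
    (J : Finset (Fin k)) (K : Finset V) (c : ℕ) (hK : G.IsClique (K : Set V))
    (hK0 : ∀ x ∈ K, ∀ y ∈ L0, G.Adj x y)
    (hc : ∀ i ∉ J, ({u ∈ L i | ∃ x ∈ K, ¬ G.Adj x u}).ncard ≤ c)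
    (hsz : ∀ i ∉ J, G.cliqueNum ^ (s+5) + c ≤ (L i).ncard) :
    7 * G.cliqueNum ^ (s+5) * K.card
      ≤ ∑ i ∈ J, ((L i).ncard + G.cliqueNum ^ (s+5)) + k * c := by
  classical
  obtain ⟨t1, t2, t3, t4, t5, t6⟩ := hT.1
  let M : {i : Fin k // i ∉ J} → Set V := fun i => {u ∈ L i | ∀ x ∈ K, G.Adj x u}
  have hM : ∀ i, M i ⊆ L i := fun i u hu => hu.1
  have hLM : ∀ i : {i : Fin k // i ∉ J}, (L i).ncard ≤ (M i).ncard + c := by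
    intro i
    have h1 : L i ⊆ M i ∪ {u ∈ L i | ∃ x ∈ K, ¬ G.Adj x u} := by
      intro u hu
      by_cases h : ∀ x ∈ K, G.Adj x u
      · exact Or.inl ⟨hu, h⟩
      · push Not at h
        exact Or.inr ⟨hu, h⟩
    have h2 := (Set.ncard_le_ncard h1 (Set.toFinite _)).trans (Set.ncard_union_le _ _)
    have h3 := hc i i.2
    omega
  have hdis : Disjoint L0 (K : Set V) := by
    rw [Set.disjoint_left]
    intro x hx hx'
    exact G.irrefl (hK0 x hx' x hx)
  have key := th_opt G s L0 L hT (L0 ∪ (K : Set V)) M ?_ ?_ ?_ ?_ ?_ ?_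
  · rw [Set.ncard_union_eq hdis (Set.toFinite _) (Set.toFinite _), Set.ncard_coe_finset] at key
    have hcard : Fintype.card {i : Fin k // i ∉ J} = (Jᶜ : Finset (Fin k)).card := by
      rw [Fintype.card_subtype]
      congr 1
      ext; simp
    have hk : J.card + (Jᶜ : Finset (Fin k)).card = k := by
      rw [Finset.card_add_card_compl, Fintype.card_fin]
    have hsum : ∑ i ∈ (Jᶜ : Finset (Fin k)), (L i).ncard
        ≤ ∑ i, (M i).ncard + (Jᶜ : Finset (Fin k)).card * c := by
      rw [Finset.sum_subtype (p := fun i => i ∉ J) _ (by simp)]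
      calc ∑ i : {i : Fin k // i ∉ J}, (L i).ncard
          ≤ ∑ i : {i : Fin k // i ∉ J}, ((M i).ncard + c) := Finset.sum_le_sum fun i _ => hLM i
        _ = _ := by
          rw [Finset.sum_add_distrib, Finset.sum_const, Finset.card_univ, hcard, smul_eq_mul]
    have hsplit := Finset.sum_add_sum_compl J (fun i => (L i).ncard)
    rw [hcard] at key
    rw [Finset.sum_add_distrib, Finset.sum_const, smul_eq_mul]
    have hle : (Jᶜ : Finset (Fin k)).card * c ≤ k * c := Nat.mul_le_mul_right _ (by omega)
    have hkw : k * G.cliqueNum ^ (s+5)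
        = J.card * G.cliqueNum ^ (s+5) + (Jᶜ : Finset (Fin k)).card * G.cliqueNum ^ (s+5) := by
      rw [← Nat.add_mul, hk]
    rw [Nat.mul_add] at key
    omega
  · intro i
    rw [Set.disjoint_left]
    rintro x (hx | hx) hx'
    · exact Set.disjoint_left.1 (t1 i) hx (hM i hx')
    · exact G.irrefl (hx'.2 x hx)
  · intro i j hij
    exact (t2 (fun h => hij (Subtype.ext h))).mono (hM i) (hM j)
  · rintro x (hx | hx) y (hy | hy) hxy
    · exact t3 hx hy hxy
    · exact (hK0 y hy x hx).symm
    · exact hK0 x hx y hy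
    · exact hK hx hy hxy
  · rintro x (hx | hx) i y hy
    · exact t4 x hx i y (hM i hy)
    · exact hy.2 x hx
  · intro i
    have h1 := hLM i
    have h2 := hsz i i.2
    exact ⟨by omega, (Set.ncard_le_ncard (hM i) (Set.toFinite _)).trans (t5 i).2⟩
  · intro i j hij v hv
    refine le_trans (Set.ncard_le_ncard ?_ (Set.toFinite _))
      (t6 i j (fun h => hij (Subtype.ext h)) v (hM i hv))
    rintro u ⟨hu, hnu⟩
    exact ⟨hM j hu, hnu⟩

/-- A clique transversal of few parts. -/
lemma th_transversal {V : Type*} [Fintype V] (G : SimpleGraph V) (s : ℕ) (L0 : Set V) {k : ℕ}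
    (L : Fin k → Set V) (hT : IsTemplate G s L0 L) (hω : 15 ≤ G.cliqueNum)
    (J : Finset (Fin k)) (hJ : J.card ≤ G.cliqueNum + 1) :
    ∃ f : Fin k → V, (∀ j ∈ J, f j ∈ L j) ∧ ∀ i ∈ J, ∀ j ∈ J, i ≠ j → G.Adj (f i) (f j) := by
  classical
  obtain ⟨t1, t2, t3, t4, t5, t6⟩ := hT
  have hV : Nonempty V := by
    by_contra h
    rw [not_nonempty_iff] at h
    obtain ⟨t, ht⟩ := G.exists_isNClique_cliqueNum
    have := ht.card_eq
    have : t = ∅ := Finset.eq_empty_of_isEmpty t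
    simp_all
  induction J using Finset.induction_on with
  | empty => exact ⟨fun _ => hV.some, by simp, by simp⟩
  | insert a J ha ih =>
    rw [Finset.card_insert_of_notMem ha] at hJ
    obtain ⟨f, hf, hf'⟩ := ih (by omega)
    have h1 := th_cover G (L a) (G.cliqueNum ^ (s+3)) (J.image f) (by
      intro x hx
      obtain ⟨j, hj, rfl⟩ := Finset.mem_image.1 hx
      exact t6 j a (by rintro rfl; exact ha hj) _ (hf j hj))
    have h2 : (J.image f).card * G.cliqueNum ^ (s+3) ≤ G.cliqueNum * G.cliqueNum ^ (s+3) :=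
      Nat.mul_le_mul_right _ (Finset.card_image_le.trans (by omega))
    have h3 : G.cliqueNum * G.cliqueNum ^ (s+3) < G.cliqueNum ^ (s+5) := by
      rw [← pow_succ']
      exact Nat.pow_lt_pow_right (by omega) (by omega)
    obtain ⟨w, hw, hw'⟩ := Set.exists_mem_notMem_of_ncard_lt_ncard
      (lt_of_le_of_lt (h1.trans h2) (h3.trans_le (t5 a).1)) (Set.toFinite _)
    have hadj : ∀ j ∈ J, G.Adj (f j) w := by
      intro j hj
      by_contra hcon
      exact hw' ⟨hw, f j, Finset.mem_image_of_mem f hj, hcon⟩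
    have hne : ∀ j ∈ J, j ≠ a := by rintro j hj rfl; exact ha hj
    refine ⟨Function.update f a w, ?_, ?_⟩
    · intro j hj
      rcases Finset.mem_insert.1 hj with rfl | hj
      · simpa using hw
      · rw [Function.update_of_ne (hne j hj)]
        exact hf j hj
    · intro i hi j hj hij
      rcases Finset.mem_insert.1 hi with rfl | hi1 <;> rcases Finset.mem_insert.1 hj with rfl | hj1
      · exact absurd rfl hij
      · rw [Function.update_self, Function.update_of_ne (hne j hj1)]
        exact (hadj j hj1).symm
      · rw [Function.update_self, Function.update_of_ne (hne i hi1)]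
        exact hadj i hi1
      · rw [Function.update_of_ne (hne i hi1), Function.update_of_ne (hne j hj1)]
        exact hf' i hi1 j hj1 hij

lemma th_card_image {V : Type*} [Fintype V] [DecidableEq V] (G : SimpleGraph V) {k : ℕ}
    (J : Finset (Fin k)) (f : Fin k → V)
    (hf : ∀ i ∈ J, ∀ j ∈ J, i ≠ j → G.Adj (f i) (f j)) :
    (J.image f).card = J.card ∧ G.IsClique (J.image f : Set V) := by
  constructor
  · apply Finset.card_image_of_injOn
    intro i hi j hj hij
    by_contra h
    exact (hf i hi j hj h).ne hij
  · rw [Finset.coe_image]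
    rintro _ ⟨i, hi, rfl⟩ _ ⟨j, hj, rfl⟩ hij
    exact hf i hi j hj (fun h => hij (h ▸ rfl))

lemma th_count {V : Type*} [Fintype V] (G : SimpleGraph V) (s : ℕ) (L0 : Set V) {k : ℕ}
    (L : Fin k → Set V) (hT : IsTemplate G s L0 L) (hω : 15 ≤ G.cliqueNum) :
    L0.ncard + k ≤ G.cliqueNum := by
  classical
  obtain ⟨J, hJ, hJc⟩ := Finset.exists_subset_card_eq
    (s := (Finset.univ : Finset (Fin k))) (n := min k (G.cliqueNum + 1)) (by simp)
  obtain ⟨f, hf, hf'⟩ := th_transversal G s L0 L hT hω J (by omega)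
  obtain ⟨hc1, hc2⟩ := th_card_image G J f hf'
  obtain ⟨t1, t2, t3, t4, t5, t6⟩ := hT
  have hcl : G.IsClique ((L0.toFinset ∪ J.image f : Finset V) : Set V) := by
    rw [Finset.coe_union, Set.coe_toFinset]
    have h : ∀ x ∈ L0, ∀ y ∈ ((J.image f : Finset V) : Set V), G.Adj x y := by
      intro x hx y hy
      rw [Finset.coe_image] at hy
      obtain ⟨j, hj, rfl⟩ := hy
      exact t4 x hx j _ (hf j hj)
    rintro x (hx | hx) y (hy | hy) hxy
    · exact t3 hx hy hxy
    · exact h x hx y hy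
    · exact (h y hy x hx).symm
    · exact hc2 hx hy hxy
  have hd : Disjoint L0.toFinset (J.image f) := by
    rw [Finset.disjoint_left]
    intro x hx hx'
    obtain ⟨j, hj, rfl⟩ := Finset.mem_image.1 hx'
    exact Set.disjoint_left.1 (t1 j) (Set.mem_toFinset.1 hx) (hf j hj)
  have h1 := hcl.card_le_cliqueNum
  rw [Finset.card_union_of_disjoint hd, hc1, ← Set.ncard_eq_toFinset_card'] at h1
  omega

/-- In an optimal template all parts are large. -/
lemma th_large {V : Type*} [Fintype V] (G : SimpleGraph V) (s : ℕ) (L0 : Set V) {k : ℕ}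
    (L : Fin k → Set V) (hT : IsOptimalTemplate G s L0 L) (hω : 15 ≤ G.cliqueNum) (i : Fin k) :
    5 * G.cliqueNum ^ (s+5) < (L i).ncard := by
  classical
  by_contra hcon
  have hcount := th_count G s L0 L hT.1 hω
  let J : Finset (Fin k) := Finset.univ.filter fun j => (L j).ncard ≤ 5 * G.cliqueNum ^ (s+5)
  have hiJ : i ∈ J := by simp [J]; omega
  have hJk : J.card ≤ k := by simpa using Finset.card_le_univ J
  obtain ⟨f, hf, hf'⟩ := th_transversal G s L0 L hT.1 hω J (by omega)
  obtain ⟨hc1, hc2⟩ := th_card_image G J f hf'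
  obtain ⟨t1, t2, t3, t4, t5, t6⟩ := hT.1
  have e4 : G.cliqueNum * G.cliqueNum ^ (s+3) = G.cliqueNum ^ (s+4) := by ring
  have e5 : G.cliqueNum * G.cliqueNum ^ (s+4) = G.cliqueNum ^ (s+5) := by ring
  have hp : 0 < G.cliqueNum ^ (s+4) := Nat.pow_pos (by omega)
  have h45 : 15 * G.cliqueNum ^ (s+4) ≤ G.cliqueNum ^ (s+5) := by
    rw [← e5]; exact Nat.mul_le_mul_right _ hω
  have hcle : J.card * G.cliqueNum ^ (s+3) ≤ G.cliqueNum ^ (s+4) := by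
    rw [← e4]; exact Nat.mul_le_mul_right _ (by omega)
  have key := th_absorb G s L0 L hT J (J.image f) (J.card * G.cliqueNum ^ (s+3)) hc2 (by
      intro x hx y hy
      obtain ⟨j, hj, rfl⟩ := Finset.mem_image.1 hx
      exact (t4 y hy j _ (hf j hj)).symm) (by
      intro a ha
      have := th_cover G (L a) (G.cliqueNum ^ (s+3)) (J.image f) (by
        intro x hx
        obtain ⟨j, hj, rfl⟩ := Finset.mem_image.1 hx
        exact t6 j a (by rintro rfl; exact ha hj) _ (hf j hj))
      rwa [hc1] at this) (by
      intro a ha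
      simp [J] at ha
      omega)
  have hsum : ∑ i ∈ J, ((L i).ncard + G.cliqueNum ^ (s+5)) ≤ J.card * (6 * G.cliqueNum ^ (s+5)) := by
    rw [← smul_eq_mul]
    apply Finset.sum_le_card_nsmul
    intro a ha
    simp [J] at ha
    omega
  rw [hc1] at key
  have hkc : k * (J.card * G.cliqueNum ^ (s+3)) ≤ J.card * G.cliqueNum ^ (s+4) := by
    rw [← e4]
    calc k * (J.card * G.cliqueNum ^ (s+3)) = J.card * (k * G.cliqueNum ^ (s+3)) := by ring
      _ ≤ _ := Nat.mul_le_mul_left _ (Nat.mul_le_mul_right _ (by omega))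
  have hJpos : 0 < J.card := Finset.card_pos.2 ⟨i, hiJ⟩
  have : J.card * (6 * G.cliqueNum ^ (s+5) + G.cliqueNum ^ (s+4)) <
      J.card * (7 * G.cliqueNum ^ (s+5)) := Nat.mul_lt_mul_of_pos_left (by omega) hJpos
  nlinarith

lemma th_Z {V : Type*} [Fintype V] (G : SimpleGraph V) (s : ℕ) (L0 : Set V) {k : ℕ}
    (L : Fin k → Set V) (hT : IsOptimalTemplate G s L0 L) (hω : 15 ≤ G.cliqueNum) :
    ({v ∈ templateNbhd G L0 L |
      ∀ i : Fin k, 4 * ({u ∈ L i | ¬ G.Adj v u}).ncard ≤ G.cliqueNum ^ (s+2)}).ncard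
      < 14 * G.cliqueNum ^ (s+6) := by
  classical
  by_contra hcon
  push Not at hcon
  obtain ⟨P, hP, hPc⟩ := Set.exists_subset_card_eq hcon
  have hcount := th_count G s L0 L hT.1 hω
  have hlarge := th_large G s L0 L hT hω
  obtain ⟨t1, t2, t3, t4, t5, t6⟩ := hT.1
  set w := G.cliqueNum with hw
  have hp : 0 < w ^ (s+2) := Nat.pow_pos (by omega)
  have e3 : w * w ^ (s+2) = w ^ (s+3) := by ring
  have e5 : w * w ^ (s+5) = w ^ (s+6) := by ring
  have hp5 : 0 < w ^ (s+5) := Nat.pow_pos (by omega)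
  have hp6 : 0 < w ^ (s+6) := Nat.pow_pos (by omega)
  have h56 : 15 * w ^ (s+5) ≤ w ^ (s+6) := by
    rw [← e5]; exact Nat.mul_le_mul_right _ hω
  have h23 : 15 * w ^ (s+2) ≤ w ^ (s+3) := by
    rw [← e3]; exact Nat.mul_le_mul_right _ hω
  let N : Fin k → Set V := fun i => {u ∈ L i | ({x ∈ P | ¬ G.Adj u x}).ncard ≤ w ^ (s+3)}
  have hNL : ∀ i, N i ⊆ L i := fun i u hu => hu.1
  have hPL : ∀ i, Disjoint P (L i) := by
    intro i
    rw [Set.disjoint_left]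
    intro x hx hx'
    exact (hP hx).1.1 (Or.inr (Set.mem_iUnion.2 ⟨i, hx'⟩))
  have hN : ∀ i, 2 * (L i).ncard ≤ 2 * (N i).ncard + 7 * w ^ (s+5) := by
    intro i
    let B : Finset V := (L i).toFinset.filter fun u => w ^ (s+3) < ({x ∈ P | ¬ G.Adj u x}).ncard
    have hB : (L i).ncard ≤ (N i).ncard + B.card := by
      have h1 : L i ⊆ N i ∪ (B : Set V) := by
        intro u hu
        by_cases h : ({x ∈ P | ¬ G.Adj u x}).ncard ≤ w ^ (s+3)
        · exact Or.inl ⟨hu, h⟩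
        · push Not at h
          right
          simp only [B, Finset.coe_filter, Set.mem_toFinset]
          exact ⟨hu, h⟩
      have h2 := (Set.ncard_le_ncard h1 (Set.toFinite _)).trans (Set.ncard_union_le _ _)
      rwa [Set.ncard_coe_finset] at h2
    -- double counting
    have hdc := Finset.sum_card_bipartiteAbove_eq_sum_card_bipartiteBelow
      (s := B) (t := P.toFinset) (fun u x => ¬ G.Adj u x)
    have hlow : B.card * w ^ (s+3) ≤
        ∑ a ∈ B, (P.toFinset.bipartiteAbove (fun u x => ¬ G.Adj u x) a).card := by
      rw [← smul_eq_mul]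
      apply Finset.card_nsmul_le_sum
      intro u hu
      have h1 := (Finset.mem_filter.1 hu).2
      refine h1.le.trans (le_of_eq ?_)
      rw [← Set.ncard_coe_finset]
      congr 1
      ext x
      simp [Finset.bipartiteAbove]
    have hup : 4 * ∑ b ∈ P.toFinset, (B.bipartiteBelow (fun u x => ¬ G.Adj u x) b).card
        ≤ P.toFinset.card * w ^ (s+2) := by
      rw [Finset.mul_sum, ← smul_eq_mul (a := P.toFinset.card)]
      apply Finset.sum_le_card_nsmul
      intro x hx
      have h1 := (hP (Set.mem_toFinset.1 hx)).2 i
      refine le_trans (Nat.mul_le_mul_left 4 ?_) h1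
      rw [← Set.ncard_coe_finset]
      apply Set.ncard_le_ncard _ (Set.toFinite _)
      intro u hu
      simp [Finset.bipartiteBelow, B] at hu
      exact ⟨hu.1.1, fun h => hu.2 h.symm⟩
    rw [← Set.ncard_eq_toFinset_card', hPc] at hup
    have h1 : (4 * B.card) * w ^ (s+3) ≤ (14 * w ^ (s+5)) * w ^ (s+3) := by
      calc (4 * B.card) * w ^ (s+3) = 4 * (B.card * w ^ (s+3)) := by ring
        _ ≤ 14 * w ^ (s+6) * w ^ (s+2) := by rw [hdc] at hlow; omega
        _ = _ := by ring
    have h2 := Nat.le_of_mul_le_mul_right h1 (by omega)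
    omega
  let M : Option (Fin k) → Set V := fun o => o.elim P N
  have key := th_opt G s L0 L hT (∅ : Set V) M (by simp) ?_ (by simp) (by simp) ?_ ?_
  · rw [Fintype.sum_option] at key
    simp only [M, Option.elim, hPc, Set.ncard_empty, Fintype.card_option, Fintype.card_fin] at key
    have hs1 : 2 * ∑ i, (L i).ncard ≤ 2 * ∑ i, (N i).ncard + k * (7 * w ^ (s+5)) := by
      rw [Finset.mul_sum, Finset.mul_sum]
      calc ∑ i, 2 * (L i).ncard ≤ ∑ i, (2 * (N i).ncard + 7 * w ^ (s+5)) :=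
            Finset.sum_le_sum fun i _ => hN i
        _ = _ := by simp [Finset.sum_add_distrib]
    have hk : k * (7 * w ^ (s+5)) ≤ 7 * w ^ (s+6) := by
      rw [← e5]
      calc k * (7 * w ^ (s+5)) ≤ w * (7 * w ^ (s+5)) := Nat.mul_le_mul_right _ (by omega)
        _ = _ := by ring
    have h0 : 7 * w ^ (s+5) * L0.ncard ≤ 7 * w ^ (s+6) := by
      rw [← e5]
      calc 7 * w ^ (s+5) * L0.ncard ≤ 7 * w ^ (s+5) * w := Nat.mul_le_mul_left _ (by omega)
        _ = _ := by ring
    rw [Nat.add_mul, ← hw] at key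
    omega
  · intro a b hab
    rcases a with _ | i <;> rcases b with _ | j
    · exact absurd rfl hab
    · exact (hPL j).mono_right (hNL j)
    · exact ((hPL i).mono_right (hNL i)).symm
    · exact (t2 (fun h => hab (congrArg some h))).mono (hNL i) (hNL j)
  · intro a
    rcases a with _ | i
    · simp only [M, Option.elim, hPc, ← hw]
      omega
    · have h1 := hN i
      have h2 := hlarge i
      exact ⟨by simp only [M, Option.elim, ← hw]; omega,
        (Set.ncard_le_ncard (hNL i) (Set.toFinite _)).trans (t5 i).2⟩
  · intro a b hab v hv
    rcases a with _ | i <;> rcases b with _ | j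
    · exact absurd rfl hab
    · have h1 := (hP hv).2 j
      have h2 : ({u ∈ M (some j) | ¬ G.Adj v u}).ncard ≤ ({u ∈ L j | ¬ G.Adj v u}).ncard :=
        Set.ncard_le_ncard (fun u hu => ⟨hNL j hu.1, hu.2⟩) (Set.toFinite _)
      rw [← hw]
      omega
    · exact hv.2
    · refine le_trans (Set.ncard_le_ncard ?_ (Set.toFinite _))
        (t6 i j (fun h => hab (congrArg some h)) v (hNL i hv))
      exact fun u hu => ⟨hNL j hu.1, hu.2⟩

/-- If `v` has a neighbour in the template and many neighbours with no neighbour in the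
template, then no vertex `u` of the template adjacent to `v` has a stable set of `s`
neighbours in the template that are not adjacent to `v`. -/
lemma th_few_nonnbrs {V : Type*} [Fintype V] (G : SimpleGraph V) (s : ℕ)
    (hfree : IsInducedFree G (doubleStarGraph s)) (hs : 1 ≤ s)
    (hω : 15 ≤ G.cliqueNum) (hω2 : s + 1 < G.cliqueNum ^ 2)
    (L0 : Set V) (k : ℕ) (L : Fin k → Set V) (hT : IsOptimalTemplate G s L0 L)
    (hk : 2 ≤ k) (v : V) (j0 : Fin k) (u0 : V) (hu0 : u0 ∈ L j0) (hvu0 : G.Adj v u0)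
    (X : Finset V) (hX : X.card = s) (hXs : IsStableSet G (X : Set V))
    (hvX : ∀ x ∈ X, G.Adj v x) (hXL : ∀ x ∈ X, ∀ i, x ∉ L i ∧ ∀ u ∈ L i, ¬ G.Adj x u) :
    (∀ i, ({u ∈ L i | ¬ G.Adj v u}).ncard ≤ 2 * G.cliqueNum ^ (s+3)) ∧
    ((∀ i, v ∉ L i) → ∀ i, ({u ∈ L i | ¬ G.Adj v u}).ncard < G.cliqueNum ^ s) := by
  classical
  have hlarge := th_large G s L0 L hT hω
  have hcl : ∀ Q : Finset V, G.IsClique (Q : Set V) → Q.card ≤ G.cliqueNum :=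
    fun Q hQ => hQ.card_le_cliqueNum
  obtain ⟨t1, t2, t3, t4, t5, t6⟩ := hT.1
  set w := G.cliqueNum with hw
  have hps : 0 < w ^ s := Nat.pow_pos (by omega)
  have hs3 : w ^ s < w ^ (s+3) := Nat.pow_lt_pow_right (by omega) (by omega)
  have e5 : w ^ (s+5) = w ^ 2 * w ^ (s+3) := by ring
  -- the core configuration
  have core : ∀ j, ∀ u ∈ L j, G.Adj v u → ∀ i, ∀ T : Finset V, T.card = s →
      IsStableSet G (T : Set V) → (∀ x ∈ T, x ∈ L i) → (∀ x ∈ T, G.Adj u x) →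
      (∀ x ∈ T, ¬ G.Adj v x) → v ∉ T → False := by
    intro j u hu hvu i T hTc hTs hTL huT hvT hv
    exact th_doubleStar G s hs hfree v u X T hvu hX hTc hXs hTs hvX huT
      (fun x hx h => (hXL x hx j).2 u hu h.symm) hvT
      (fun x hx y hy => (hXL x hx i).2 y (hTL y hy)) (fun h => (hXL u h j).1 hu) hv
  have ramsey : ∀ A : Set V, w ^ s ≤ A.ncard + 1 → ∃ S : Finset V, (∀ x ∈ S, x ∈ A) ∧ S.card = s ∧
      IsStableSet G (S : Set V) := by
    intro A hA
    obtain ⟨S, h1, h2, h3⟩ := th_ramsey G w (by omega) hcl s A.toFinset (by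
      rwa [← Set.ncard_eq_toFinset_card'])
    exact ⟨S, fun x hx => Set.mem_toFinset.1 (h1 hx), h2, h3⟩
  have step : ∀ j, ∀ u ∈ L j, G.Adj v u → ∀ i, i ≠ j →
      ({u ∈ L i | ¬ G.Adj v u}).ncard ≤ 2 * w ^ (s+3) := by
    intro j u hu hvu i hij
    have h1 : ({x ∈ L i | G.Adj u x ∧ ¬ G.Adj v x ∧ x ≠ v}).ncard < w ^ s := by
      by_contra hcon
      obtain ⟨T, hTA, hTc, hTs⟩ := ramsey _ ((not_lt.1 hcon).trans (Nat.le_succ _))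
      exact core j u hu hvu i T hTc hTs (fun x hx => (hTA x hx).1) (fun x hx => (hTA x hx).2.1)
        (fun x hx => (hTA x hx).2.2.1) (fun h => (hTA v h).2.2.2 rfl)
    have h2 : {u ∈ L i | ¬ G.Adj v u} ⊆ ({x ∈ L i | G.Adj u x ∧ ¬ G.Adj v x ∧ x ≠ v} ∪
        {x ∈ L i | ¬ G.Adj u x}) ∪ {v} := by
      rintro x ⟨hx, hx'⟩
      by_cases hxv : x = v
      · exact Or.inr hxv
      by_cases hux : G.Adj u x
      · exact Or.inl (Or.inl ⟨hx, hux, hx', hxv⟩)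
      · exact Or.inl (Or.inr ⟨hx, hux⟩)
    have h3 := (Set.ncard_le_ncard h2 (Set.toFinite _)).trans (Set.ncard_union_le _ _)
    have h4 := Set.ncard_union_le {x ∈ L i | G.Adj u x ∧ ¬ G.Adj v x ∧ x ≠ v}
      {x ∈ L i | ¬ G.Adj u x}
    have h5 := t6 j i hij.symm u hu
    rw [Set.ncard_singleton] at h3
    omega
  have hsq : s + 2 ≤ w ^ 2 := hω2
  have hmul : (s + 2) * w ^ (s+3) ≤ w ^ (s+5) := by
    rw [e5]; exact Nat.mul_le_mul_right _ hsq
  have other : ∀ i : Fin k, ∃ j, j ≠ i := by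
    intro i
    by_cases h : (i : ℕ) = 0
    · exact ⟨⟨1, by omega⟩, fun h' => by rw [← h'] at h; simp at h⟩
    · exact ⟨⟨0, by omega⟩, fun h' => by rw [← h'] at h; simp at h⟩
  have all : ∀ i, ({u ∈ L i | ¬ G.Adj v u}).ncard ≤ 2 * w ^ (s+3) := by
    intro i
    by_cases hi : i = j0
    · subst hi
      obtain ⟨j, hj⟩ := other i
      have h1 := step i u0 hu0 hvu0 j hj
      have h2 := hlarge j
      have h3 : 2 * w ^ (s+3) ≤ (s + 2) * w ^ (s+3) := Nat.mul_le_mul_right _ (by omega)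
      obtain ⟨u, hu, hu'⟩ := Set.exists_mem_notMem_of_ncard_lt_ncard
        (show ({u ∈ L j | ¬ G.Adj v u}).ncard < (L j).ncard by omega) (Set.toFinite _)
      have hvu : G.Adj v u := by
        by_contra h
        exact hu' ⟨hu, h⟩
      exact step j u hu hvu i hj.symm
    · exact step j0 u0 hu0 hvu0 i hi
  refine ⟨all, fun hvL i => ?_⟩
  by_contra hcon
  obtain ⟨T, hTA, hTc, hTs⟩ := ramsey _ ((not_lt.1 hcon).trans (Nat.le_succ _))
  obtain ⟨j, hj⟩ := other i
  have h1 := th_cover G (L j) (w ^ (s+3)) T (fun x hx => t6 i j hj.symm x (hTA x hx).1)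
  have h2 := all j
  have h3 := Set.ncard_union_le {u ∈ L j | ¬ G.Adj v u} {u ∈ L j | ∃ x ∈ T, ¬ G.Adj x u}
  have h4 := hlarge j
  rw [hTc] at h1
  have h5 : (s + 2) * w ^ (s+3) = s * w ^ (s+3) + 2 * w ^ (s+3) := by ring
  have hp5 : 0 < w ^ (s+5) := Nat.pow_pos (by omega)
  obtain ⟨u, hu, hu'⟩ := Set.exists_mem_notMem_of_ncard_lt_ncard
    (show ({u ∈ L j | ¬ G.Adj v u} ∪ {u ∈ L j | ∃ x ∈ T, ¬ G.Adj x u}).ncard < (L j).ncard by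
      omega) (Set.toFinite _)
  have hvu : G.Adj v u := by
    by_contra h
    exact hu' (Or.inl ⟨hu, h⟩)
  exact core j u hu hvu i T hTc hTs (fun x hx => (hTA x hx).1)
    (fun x hx => by
      by_contra h
      exact hu' (Or.inr ⟨hu, x, hx, fun h' => h h'.symm⟩))
    (fun x hx => (hTA x hx).2) (fun h => hvL i (hTA v h).1)

end TemplateHelpers

/-- If `G` is `H_s`-free with `ω ≥ 15` and `ω² > s+1`, and `𝓛` is an optimal `s`-template of
value at least `28 ω^{s+6}`, then every vertex of `Y(𝓛)` has at most `ω^{s+7}` neighbours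
outside `Y(𝓛)`. -/
theorem template_out_neighbours {V : Type*} [Fintype V] (G : SimpleGraph V) (s : ℕ)
    (hs : 1 ≤ s) (hfree : IsInducedFree G (doubleStarGraph s))
    (hω : 15 ≤ G.cliqueNum) (hω2 : s + 1 < G.cliqueNum ^ 2)
    (L0 : Set V) (k : ℕ) (L : Fin k → Set V) (hT : IsOptimalTemplate G s L0 L)
    (hval : 28 * G.cliqueNum ^ (s+6) ≤ templateValue G s L0 L) :
    ∀ v ∈ templateY G s L0 L,
      ({u | u ∉ templateY G s L0 L ∧ G.Adj v u}).ncard ≤ G.cliqueNum ^ (s+7) := by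
  classical
  intro v hv
  by_contra hcon
  push Not at hcon
  have hlarge := th_large G s L0 L hT hω
  have hcount := th_count G s L0 L hT.1 hω
  have hZ := th_Z G s L0 L hT hω
  have hcl : ∀ Q : Finset V, G.IsClique (Q : Set V) → Q.card ≤ G.cliqueNum :=
    fun Q hQ => hQ.card_le_cliqueNum
  obtain ⟨t1, t2, t3, t4, t5, t6⟩ := hT.1
  unfold templateValue at hval
  rw [th_iUnion L t2] at hval
  have p0 : 0 < G.cliqueNum ^ s := Nat.pow_pos (by omega)
  have p3 : 0 < G.cliqueNum ^ (s+3) := Nat.pow_pos (by omega)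
  have e2 : G.cliqueNum ^ (s+2) = G.cliqueNum ^ 2 * G.cliqueNum ^ s := by ring
  have e4 : G.cliqueNum ^ (s+4) = G.cliqueNum * G.cliqueNum ^ (s+3) := by ring
  have e5 : G.cliqueNum ^ (s+5) = G.cliqueNum * G.cliqueNum ^ (s+4) := by ring
  have e6 : G.cliqueNum ^ (s+6) = G.cliqueNum * G.cliqueNum ^ (s+5) := by ring
  have e7 : G.cliqueNum ^ (s+7) = G.cliqueNum * G.cliqueNum ^ (s+6) := by ring
  have l4 : 15 * G.cliqueNum ^ (s+3) ≤ G.cliqueNum ^ (s+4) := e4 ▸ Nat.mul_le_mul_right _ hω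
  have l5 : 15 * G.cliqueNum ^ (s+4) ≤ G.cliqueNum ^ (s+5) := e5 ▸ Nat.mul_le_mul_right _ hω
  have l6 : 15 * G.cliqueNum ^ (s+5) ≤ G.cliqueNum ^ (s+6) := e6 ▸ Nat.mul_le_mul_right _ hω
  have l7 : 15 * G.cliqueNum ^ (s+6) ≤ G.cliqueNum ^ (s+7) := e7 ▸ Nat.mul_le_mul_right _ hω
  have l2 : 4 * G.cliqueNum ^ s ≤ G.cliqueNum ^ (s+2) :=
    e2 ▸ Nat.mul_le_mul_right _ (by nlinarith)
  have l03 : G.cliqueNum ^ s ≤ G.cliqueNum ^ (s+3) := Nat.pow_le_pow_right (by omega) (by omega)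
  have l13 : G.cliqueNum ≤ G.cliqueNum ^ (s+3) := Nat.le_self_pow (by omega) _
  -- at least two parts
  have hk : 2 ≤ k := by
    by_contra hk
    have h1 : 7 * G.cliqueNum ^ (s+5) * L0.ncard ≤ 7 * G.cliqueNum ^ (s+6) := by
      rw [e6]
      calc 7 * G.cliqueNum ^ (s+5) * L0.ncard ≤ 7 * G.cliqueNum ^ (s+5) * G.cliqueNum :=
            Nat.mul_le_mul_left _ (by omega)
        _ = _ := by ring
    have h2 : ∑ i, (L i).ncard ≤ k * (14 * G.cliqueNum ^ (s+6)) := by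
      have := Finset.sum_le_card_nsmul Finset.univ (fun i => (L i).ncard) _
        (fun i _ => (t5 i).2)
      simpa using this
    have h3 : k * (14 * G.cliqueNum ^ (s+6)) ≤ 1 * (14 * G.cliqueNum ^ (s+6)) :=
      Nat.mul_le_mul_right _ (by omega)
    have h4 : k * G.cliqueNum ^ (s+5) ≤ 1 * G.cliqueNum ^ (s+5) :=
      Nat.mul_le_mul_right _ (by omega)
    omega
  -- many neighbours anticomplete to the template
  have hX : ∃ X : Finset V, X.card = s ∧ IsStableSet G (X : Set V) ∧ (∀ x ∈ X, G.Adj v x) ∧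
      ∀ x ∈ X, ∀ i, x ∉ L i ∧ ∀ u ∈ L i, ¬ G.Adj x u := by
    let A : Set V := {x | G.Adj v x ∧ ∀ i, x ∉ L i ∧ ∀ u ∈ L i, ¬ G.Adj x u}
    have hsub : {u | u ∉ templateY G s L0 L ∧ G.Adj v u} ⊆ (L0 ∪ {v ∈ templateNbhd G L0 L |
        ∀ i : Fin k, 4 * ({u ∈ L i | ¬ G.Adj v u}).ncard ≤ G.cliqueNum ^ (s+2)}) ∪ A := by
      rintro x ⟨hx, hvx⟩
      by_cases hxZ : x ∈ templateZ G s L0 L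
      · exact Or.inl hxZ
      · right
        have hx1 : x ∉ templateVerts L0 L ∪ templateNbhd G L0 L := fun h => hx ⟨h, hxZ⟩
        have hx2 : x ∉ templateVerts L0 L := fun h => hx1 (Or.inl h)
        refine ⟨hvx, fun i => ⟨fun h => hx2 (Or.inr (Set.mem_iUnion.2 ⟨i, h⟩)), fun u hu h => ?_⟩⟩
        exact hx1 (Or.inr ⟨hx2, i, u, hu, h⟩)
    have h1 := (Set.ncard_le_ncard hsub (Set.toFinite _)).trans (Set.ncard_union_le _ _)
    have h2 := Set.ncard_union_le L0 {v ∈ templateNbhd G L0 L |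
        ∀ i : Fin k, 4 * ({u ∈ L i | ¬ G.Adj v u}).ncard ≤ G.cliqueNum ^ (s+2)}
    have h3 : G.cliqueNum ^ s ≤ A.ncard + 1 := by omega
    obtain ⟨S, g1, g2, g3⟩ := th_ramsey G G.cliqueNum (by omega) hcl s A.toFinset (by
      rwa [← Set.ncard_eq_toFinset_card'])
    have g4 : ∀ x ∈ S, x ∈ A := fun x hx => Set.mem_toFinset.1 (g1 hx)
    exact ⟨S, g2, g3, fun x hx => (g4 x hx).1, fun x hx => (g4 x hx).2⟩
  obtain ⟨X, hXc, hXs, hvX, hXL⟩ := hX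
  obtain ⟨hvVN, hvZ⟩ := hv
  have hvL0 : v ∉ L0 := fun h => hvZ (Or.inl h)
  rcases hvVN with (hv0 | hvL) | hvN
  · exact hvL0 hv0
  · obtain ⟨i, hvi⟩ := Set.mem_iUnion.1 hvL
    obtain ⟨j, hj⟩ : ∃ j, j ≠ i := by
      by_cases h : (i : ℕ) = 0
      · exact ⟨⟨1, by omega⟩, fun h' => by rw [← h'] at h; simp at h⟩
      · exact ⟨⟨0, by omega⟩, fun h' => by rw [← h'] at h; simp at h⟩
    have h1 := t6 i j hj.symm v hvi
    have h2 := hlarge j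
    obtain ⟨u, hu, hu'⟩ := Set.exists_mem_notMem_of_ncard_lt_ncard
      (show ({u ∈ L j | ¬ G.Adj v u}).ncard < (L j).ncard by omega) (Set.toFinite _)
    have hvu : G.Adj v u := by
      by_contra h
      exact hu' ⟨hu, h⟩
    have h3 := (th_few_nonnbrs G s hfree hs hω hω2 L0 k L hT hk v j u hu hvu X hXc hXs hvX hXL).1
    have h4 := th_absorb G s L0 L hT ∅ {v} (2 * G.cliqueNum ^ (s+3)) (by simp)
      (by
        intro x hx y hy
        rw [Finset.mem_singleton.1 hx]
        exact (t4 y hy i v hvi).symm)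
      (by
        intro a _
        simpa using h3 a)
      (by
        intro a _
        have := hlarge a
        omega)
    have h5 : k * (2 * G.cliqueNum ^ (s+3)) ≤ 2 * G.cliqueNum ^ (s+4) := by
      rw [e4]
      calc k * (2 * G.cliqueNum ^ (s+3)) ≤ G.cliqueNum * (2 * G.cliqueNum ^ (s+3)) :=
            Nat.mul_le_mul_right _ (by omega)
        _ = _ := by ring
    rw [Finset.sum_empty, Finset.card_singleton] at h4
    omega
  · obtain ⟨hvV, j, u, hu, hvu⟩ := hvN
    have h3 := (th_few_nonnbrs G s hfree hs hω hω2 L0 k L hT hk v j u hu hvu X hXc hXs hvX hXL).2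
      (fun i hi => hvV (Or.inr (Set.mem_iUnion.2 ⟨i, hi⟩)))
    refine hvZ (Or.inr ⟨⟨hvV, j, u, hu, hvu⟩, fun i => ?_⟩)
    have := h3 i
    omega
end
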